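/- Let F be continuous and uniformly elliptic with constants λ, Λ on 2×2 symmetric matrices, with F(0) = 0, and let g be continuous on ∂B₁, B₁ ⊂ ℝ². Then there exists a unique function u, continuous on B̄₁ and of class C^{2,ᾱ} on every compact subset of B₁ (with ᾱ the universal interior Hölder exponent), solving F(D²u) = 0 in B₁ (classically in the interior) with u = g on ∂B₁; moreover, for every 0 < r < 1, ‖u‖_{C^{2,ᾱ}(B̄_r)} ≤ C‖g‖_{L^∞(∂B₁)}, where C depends only on λ, Λ and r. -/

import Mathlib

open Metric Set Real
open scoped Classical

noncomputable section

abbrev E2 : Type := EuclideanSpace ℝ (Fin 2)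
abbrev Mat2 : Type := Matrix (Fin 2) (Fin 2) ℝ

/-- `‖A⁺‖`: the sum of the positive parts of the eigenvalues of a symmetric matrix `A`. -/
noncomputable def posNorm (A : Mat2) : ℝ :=
  if h : A.IsHermitian then ∑ i, max (h.eigenvalues i) 0 else 0

/-- `‖A⁻‖`: the sum of the negative parts of the eigenvalues of a symmetric matrix `A`. -/
noncomputable def negNorm (A : Mat2) : ℝ :=
  if h : A.IsHermitian then ∑ i, max (-(h.eigenvalues i)) 0 else 0

/-- A norm on 2×2 matrices: sum of absolute values of entries. -/
noncomputable def matNorm (A : Mat2) : ℝ := ∑ i, ∑ j, |A i j|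

/-- `F` is uniformly elliptic with constants `0 < lam ≤ Lam`:
`F M - F N ≤ Lam ‖(M-N)⁺‖ - lam ‖(M-N)⁻‖` for all symmetric `M, N`. -/
def UniformlyElliptic (lam Lam : ℝ) (F : Mat2 → ℝ) : Prop :=
  ∀ M N : Mat2, M.IsHermitian → N.IsHermitian →
    F M - F N ≤ Lam * posNorm (M - N) - lam * negNorm (M - N)

/-- The Hessian matrix `D²u(x)` of `u : ℝ² → ℝ` at `x`. -/
noncomputable def hess (u : E2 → ℝ) (x : E2) : Mat2 :=
  Matrix.of fun i j =>
    fderiv ℝ (fun y => fderiv ℝ u y (EuclideanSpace.single j 1)) x (EuclideanSpace.single i 1)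

/-- `sup_s |u|`, the `L^∞` norm of `u` on `s`. -/
noncomputable def supAbs (u : E2 → ℝ) (s : Set E2) : ℝ := ⨆ x ∈ s, |u x|

/-- `u` is a viscosity solution of `F(D²u) = 0` on `Ω`. -/
def IsViscositySol (F : Mat2 → ℝ) (u : E2 → ℝ) (Ω : Set E2) : Prop :=
  ∀ φ : E2 → ℝ, ContDiff ℝ 2 φ → ∀ x₀ ∈ Ω,
    (IsLocalMax (fun x => u x - φ x) x₀ → 0 ≤ F (hess φ x₀)) ∧
    (IsLocalMin (fun x => u x - φ x) x₀ → F (hess φ x₀) ≤ 0)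


open MeasureTheory Filter Topology



/-- Smooth functions on the plane. -/
def Sm (f : E2 → ℝ) : Prop := ContDiff ℝ ((⊤ : ℕ∞) : WithTop ℕ∞) f

/-- Partial derivative. -/
def dd (i : Fin 2) (f : E2 → ℝ) : E2 → ℝ := fun x => fderiv ℝ f x (EuclideanSpace.single i 1)

theorem hess_apply (u : E2 → ℝ) (x : E2) (i j : Fin 2) : hess u x i j = dd i (dd j u) x := rfl

theorem Sm.contDiff {f : E2 → ℝ} (hf : Sm f) (n : ℕ) : ContDiff ℝ n f :=
  ContDiff.of_le hf (by exact_mod_cast le_top)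

theorem Sm.differentiable {f : E2 → ℝ} (hf : Sm f) : Differentiable ℝ f :=
  (hf.contDiff 1).differentiable (by norm_num)

theorem Sm.continuous {f : E2 → ℝ} (hf : Sm f) : Continuous f := ContDiff.continuous hf

theorem Sm.dd {f : E2 → ℝ} (hf : Sm f) (i : Fin 2) : Sm (dd i f) := by
  unfold Sm _root_.dd
  have h : ContDiff ℝ ((⊤ : ℕ∞) : WithTop ℕ∞) (fderiv ℝ f) := ContDiff.fderiv_right hf (by simp)
  exact h.clm_apply contDiff_const

theorem Sm.add {f g : E2 → ℝ} (hf : Sm f) (hg : Sm g) : Sm (fun x => f x + g x) := ContDiff.add hf hg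
theorem Sm.sub {f g : E2 → ℝ} (hf : Sm f) (hg : Sm g) : Sm (fun x => f x - g x) := ContDiff.sub hf hg
theorem Sm.mul {f g : E2 → ℝ} (hf : Sm f) (hg : Sm g) : Sm (fun x => f x * g x) := ContDiff.mul hf hg
theorem Sm.pow {f : E2 → ℝ} (hf : Sm f) (n : ℕ) : Sm (fun x => f x ^ n) := ContDiff.pow hf n
theorem Sm.const (c : ℝ) : Sm (fun _ => c) := contDiff_const
theorem Sm.shift {f : E2 → ℝ} (hf : Sm f) (h : E2) : Sm (fun x => f (x + h)) :=
  ContDiff.comp hf (contDiff_id.add contDiff_const)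
theorem Sm.coord (i : Fin 2) : Sm (fun x => x i) := by
  unfold Sm; fun_prop

theorem dd_add {f g : E2 → ℝ} (hf : Sm f) (hg : Sm g) (i : Fin 2) :
    dd i (fun x => f x + g x) = fun x => dd i f x + dd i g x := by
  ext x; unfold dd
  rw [fderiv_fun_add (hf.differentiable x) (hg.differentiable x)]; rfl
theorem dd_sub {f g : E2 → ℝ} (hf : Sm f) (hg : Sm g) (i : Fin 2) :
    dd i (fun x => f x - g x) = fun x => dd i f x - dd i g x := by
  ext x; unfold dd
  rw [fderiv_fun_sub (hf.differentiable x) (hg.differentiable x)]; rfl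
theorem dd_mul {f g : E2 → ℝ} (hf : Sm f) (hg : Sm g) (i : Fin 2) :
    dd i (fun x => f x * g x) = fun x => f x * dd i g x + g x * dd i f x := by
  ext x; unfold dd
  rw [fderiv_fun_mul (hf.differentiable x) (hg.differentiable x)]; simp
theorem dd_const (c : ℝ) (i : Fin 2) : dd i (fun _ => c) = fun _ => 0 := by
  ext x; unfold dd; simp
theorem dd_coord (j i : Fin 2) : dd i (fun x => x j) = fun _ => if j = i then 1 else 0 := by
  ext x; unfold dd
  have : HasFDerivAt (fun x : E2 => x j) (EuclideanSpace.proj j : E2 →L[ℝ] ℝ) x :=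
    (EuclideanSpace.proj j : E2 →L[ℝ] ℝ).hasFDerivAt
  rw [this.fderiv]; simp
theorem dd_shift (f : E2 → ℝ) (h : E2) (i : Fin 2) :
    dd i (fun x => f (x + h)) = fun x => dd i f (x + h) := by
  ext x; unfold dd; rw [fderiv_comp_add_right]
theorem dd_comm {f : E2 → ℝ} (hf : Sm f) (i j : Fin 2) : dd i (dd j f) = dd j (dd i f) := by
  ext x
  have h2 : ContDiffAt ℝ 2 f x := (hf.contDiff 2).contDiffAt
  have hs := h2.isSymmSndFDerivAt (by simp)
  have hd : DifferentiableAt ℝ (fderiv ℝ f) x :=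
    ((hf.contDiff 2).fderiv_right (m := 1) (by norm_num)).differentiable (by norm_num) x
  have key : ∀ i j : Fin 2, dd i (dd j f) x
      = fderiv ℝ (fderiv ℝ f) x (EuclideanSpace.single i 1) (EuclideanSpace.single j 1) := by
    intro i j
    unfold dd
    rw [fderiv_clm_apply hd (by fun_prop)]
    simp
  rw [key, key]; exact hs _ _

theorem dd_eval {f : E2 → ℝ} {x : E2} (v : E2) :
    fderiv ℝ f x v = v 0 * dd 0 f x + v 1 * dd 1 f x := by
  have : v = v 0 • EuclideanSpace.single (0 : Fin 2) (1:ℝ) + v 1 • EuclideanSpace.single (1 : Fin 2) (1:ℝ) := by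
    ext i; fin_cases i <;> simp
  conv_lhs => rw [this]
  simp [dd]

/-- polar point -/
def pt (x : E2) (ρ θ : ℝ) : E2 := x + !₂[ρ * cos θ, ρ * sin θ]

theorem continuous_pt (x : E2) : Continuous (fun p : ℝ × ℝ => pt x p.1 p.2) := by
  unfold pt
  refine continuous_const.add ?_
  refine (PiLp.continuous_toLp 2 _).comp ?_
  refine continuous_pi ?_
  intro i; fin_cases i <;> simp <;> fun_prop

theorem hasDerivAt_toLp {f g : ℝ → ℝ} {f' g' t : ℝ} (hf : HasDerivAt f f' t) (hg : HasDerivAt g g' t) :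
    HasDerivAt (fun s => (!₂[f s, g s] : E2)) (!₂[f', g']) t := by
  have h : HasDerivAt (fun s => (![f s, g s] : Fin 2 → ℝ)) (![f', g']) t := by
    rw [hasDerivAt_pi]
    intro i; fin_cases i <;> simpa
  exact (PiLp.continuousLinearEquiv 2 ℝ (fun _ : Fin 2 => ℝ)).symm.toContinuousLinearMap.hasFDerivAt.comp_hasDerivAt t h

theorem hasDerivAt_pt_rho (x : E2) (ρ θ : ℝ) :
    HasDerivAt (fun r => pt x r θ) (!₂[cos θ, sin θ]) ρ := by
  unfold pt
  refine HasDerivAt.const_add x ?_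
  refine hasDerivAt_toLp ?_ ?_
  · simpa using (hasDerivAt_id ρ).mul_const (cos θ)
  · simpa using (hasDerivAt_id ρ).mul_const (sin θ)

theorem hasDerivAt_pt_theta (x : E2) (ρ θ : ℝ) :
    HasDerivAt (fun t => pt x ρ t) (!₂[-(ρ * sin θ), ρ * cos θ]) θ := by
  unfold pt
  refine HasDerivAt.const_add x ?_
  refine hasDerivAt_toLp ?_ ?_
  · simpa using (hasDerivAt_cos θ).const_mul ρ
  · simpa using (hasDerivAt_sin θ).const_mul ρ

/-- radial and angular derivative factors -/
def dr (f : E2 → ℝ) (x : E2) (ρ θ : ℝ) : ℝ := cos θ * dd 0 f (pt x ρ θ) + sin θ * dd 1 f (pt x ρ θ)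
def dt (f : E2 → ℝ) (x : E2) (ρ θ : ℝ) : ℝ :=
  ρ * (cos θ * dd 1 f (pt x ρ θ) - sin θ * dd 0 f (pt x ρ θ))

theorem Sm.hasDerivAt_rho {f : E2 → ℝ} (hf : Sm f) (x : E2) (ρ θ : ℝ) :
    HasDerivAt (fun r => f (pt x r θ)) (dr f x ρ θ) ρ := by
  have := (hf.differentiable (pt x ρ θ)).hasFDerivAt.comp_hasDerivAt ρ (hasDerivAt_pt_rho x ρ θ)
  refine this.congr_deriv ?_
  rw [dd_eval]; simp [dr]
theorem Sm.hasDerivAt_theta {f : E2 → ℝ} (hf : Sm f) (x : E2) (ρ θ : ℝ) :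
    HasDerivAt (fun t => f (pt x ρ t)) (dt f x ρ θ) θ := by
  have := (hf.differentiable (pt x ρ θ)).hasFDerivAt.comp_hasDerivAt θ (hasDerivAt_pt_theta x ρ θ)
  refine this.congr_deriv ?_
  rw [dd_eval]; simp [dt]; ring

theorem Sm.cont_pt {f : E2 → ℝ} (hf : Continuous f) (x : E2) :
    Continuous (fun p : ℝ × ℝ => f (pt x p.1 p.2)) := hf.comp (continuous_pt x)

theorem Sm.cont_dr {f : E2 → ℝ} (hf : Sm f) (x : E2) : Continuous (fun p : ℝ × ℝ => dr f x p.1 p.2) := by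
  unfold dr
  have h0 := Sm.cont_pt (hf.dd 0).continuous x
  have h1 := Sm.cont_pt (hf.dd 1).continuous x
  fun_prop
theorem Sm.cont_dt {f : E2 → ℝ} (hf : Sm f) (x : E2) : Continuous (fun p : ℝ × ℝ => dt f x p.1 p.2) := by
  unfold dt
  have h0 := Sm.cont_pt (hf.dd 0).continuous x
  have h1 := Sm.cont_pt (hf.dd 1).continuous x
  fun_prop

theorem pt_pi (x : E2) (ρ : ℝ) : pt x ρ π = pt x ρ (-π) := by simp [pt]

theorem norm_pt (ρ θ : ℝ) : ‖pt 0 ρ θ‖ = |ρ| := by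
  simp only [pt, zero_add, EuclideanSpace.norm_eq, Fin.sum_univ_two]
  simp only [Matrix.cons_val_zero, Matrix.cons_val_one, Real.norm_eq_abs, sq_abs]
  rw [show (ρ * cos θ)^2 + (ρ * sin θ)^2 = ρ^2 * (sin θ ^2 + cos θ ^2) by ring, sin_sq_add_cos_sq, mul_one, sqrt_sq_eq_abs]
theorem dist_pt (x : E2) (ρ θ : ℝ) : dist (pt x ρ θ) x = |ρ| := by
  rw [← norm_pt ρ θ, dist_eq_norm]; simp [pt]


theorem polar_int {f : E2 → ℝ} (hf : Continuous f) (x : E2) {R : ℝ} (hR : 0 ≤ R) :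
    ∫ y in ball x R, f y = ∫ ρ in (0:ℝ)..R, ∫ θ in (-π)..π, ρ * f (pt x ρ θ) := by
  have e1 : ∫ y in ball x R, f y = ∫ y : E2, (ball (0:E2) R).indicator (fun y => f (x + y)) y := by
    rw [← integral_indicator measurableSet_ball, ← integral_add_left_eq_self _ x]
    congr 1; ext y
    simp only [indicator, mem_ball, dist_zero_right, dist_self_add_left]
  have mp := (EuclideanSpace.volume_preserving_symm_measurableEquiv_toLp (Fin 2)).symm
  have mp2 := (volume_preserving_finTwoArrow ℝ).symm
  rw [e1, ← mp.integral_comp' , ← mp2.integral_comp', ← integral_comp_polarCoord_symm]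
  have ht : polarCoord.target = Ioi (0:ℝ) ×ˢ Ioo (-π) π := rfl
  have e2 : ∀ p ∈ polarCoord.target, p.1 • (ball (0:E2) R).indicator (fun y => f (x + y))
      ((MeasurableEquiv.toLp 2 (Fin 2 → ℝ)).symm.symm (MeasurableEquiv.finTwoArrow.symm (polarCoord.symm p)))
      = (Ioo (0:ℝ) R ×ˢ Ioo (-π) π).indicator (fun p => p.1 * f (pt x p.1 p.2)) p := by
    rintro ⟨ρ, θ⟩ hp
    rw [ht] at hp
    have hp1 : 0 < ρ := hp.1
    have : ((MeasurableEquiv.toLp 2 (Fin 2 → ℝ)).symm.symm (MeasurableEquiv.finTwoArrow.symm (polarCoord.symm (ρ,θ)))) = pt 0 ρ θ := by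
      ext i
      fin_cases i <;> simp [pt, polarCoord, MeasurableEquiv.finTwoArrow]
    rw [this]
    have h2 : x + pt 0 ρ θ = pt x ρ θ := by simp [pt]
    simp only [indicator, mem_ball, dist_pt, abs_of_pos hp1, h2, mem_prod, mem_Ioo, hp1, true_and]
    have hp2 : -π < θ ∧ θ < π := hp.2
    simp [hp2]
  rw [setIntegral_congr_fun polarCoord.open_target.measurableSet e2, setIntegral_indicator (by measurability)]
  have : polarCoord.target ∩ Ioo (0:ℝ) R ×ˢ Ioo (-π) π = Ioo (0:ℝ) R ×ˢ Ioo (-π) π := by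
    rw [ht]; ext p; simp; tauto
  rw [this, Measure.volume_eq_prod, setIntegral_prod]
  · rw [intervalIntegral.integral_of_le hR, integral_Ioc_eq_integral_Ioo]
    refine setIntegral_congr_fun measurableSet_Ioo ?_
    intro ρ _
    simp only
    rw [intervalIntegral.integral_of_le (by linarith [pi_pos]), integral_Ioc_eq_integral_Ioo]
  · have hc : Continuous (fun p : ℝ × ℝ => p.1 * f (pt x p.1 p.2)) :=
      continuous_fst.mul (Sm.cont_pt hf x)
    rw [← Measure.volume_eq_prod]
    exact (hc.continuousOn.integrableOn_compact (isCompact_Icc.prod isCompact_Icc)).mono_set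
      (Set.prod_mono Ioo_subset_Icc_self Ioo_subset_Icc_self)

theorem cont_snd {g : ℝ → ℝ → ℝ} (hg : Continuous (fun p : ℝ × ℝ => g p.1 p.2)) (a : ℝ) :
    Continuous (fun t => g a t) := hg.comp (by fun_prop : Continuous (fun t : ℝ => (a, t)))
theorem cont_fst {g : ℝ → ℝ → ℝ} (hg : Continuous (fun p : ℝ × ℝ => g p.1 p.2)) (a : ℝ) :
    Continuous (fun t => g t a) := hg.comp (by fun_prop : Continuous (fun t : ℝ => (t, a)))
theorem cont_int {g : ℝ → ℝ → ℝ} (hg : Continuous (fun p : ℝ × ℝ => g p.1 p.2)) (a b : ℝ) :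
    Continuous (fun s => ∫ t in a..b, g s t) :=
  intervalIntegral.continuous_parametric_intervalIntegral_of_continuous' hg a b

theorem ii_swap {g : ℝ → ℝ → ℝ} (hg : Continuous (fun p : ℝ × ℝ => g p.1 p.2)) {a b c d : ℝ}
    (hab : a ≤ b) (hcd : c ≤ d) :
    ∫ s in a..b, ∫ t in c..d, g s t = ∫ t in c..d, ∫ s in a..b, g s t := by
  simp only [intervalIntegral.integral_of_le hab, intervalIntegral.integral_of_le hcd]
  refine integral_integral_swap ?_
  rw [Measure.prod_restrict, ← Measure.volume_eq_prod]
  exact (hg.continuousOn.integrableOn_compact (isCompact_Icc.prod isCompact_Icc)).mono_set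
      (Set.prod_mono Ioc_subset_Icc_self Ioc_subset_Icc_self)

/-- Green's identity for the Jacobian on a disk. -/
theorem jac_int {P Q : E2 → ℝ} (hP : Sm P) (hQ : Sm Q) (x : E2) {R : ℝ} (hR : 0 ≤ R) :
    ∫ y in ball x R, (dd 0 P y * dd 1 Q y - dd 1 P y * dd 0 Q y)
      = ∫ θ in (-π)..π, P (pt x R θ) * dt Q x R θ := by
  have hpi : -π ≤ π := by linarith [pi_pos]
  rw [polar_int (by
    exact ((hP.dd 0).continuous.mul (hQ.dd 1).continuous).sub
      ((hP.dd 1).continuous.mul (hQ.dd 0).continuous)) x hR]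
  -- mixed second derivative
  set A : ℝ → ℝ → ℝ := fun ρ θ => dr P x ρ θ * dt Q x ρ θ with hA
  set B : ℝ → ℝ → ℝ := fun ρ θ => dt P x ρ θ * dr Q x ρ θ with hB
  set M : ℝ → ℝ → ℝ := fun ρ θ => (cos θ * dd 1 Q (pt x ρ θ) - sin θ * dd 0 Q (pt x ρ θ)) +
    ρ * (cos θ * dr (dd 1 Q) x ρ θ - sin θ * dr (dd 0 Q) x ρ θ) with hM
  have cP := Sm.cont_pt hP.continuous x
  have cA : Continuous (fun p : ℝ × ℝ => A p.1 p.2) := (hP.cont_dr x).mul (hQ.cont_dt x)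
  have cB : Continuous (fun p : ℝ × ℝ => B p.1 p.2) := (hP.cont_dt x).mul (hQ.cont_dr x)
  have cM : Continuous (fun p : ℝ × ℝ => M p.1 p.2) := by
    have h0 := Sm.cont_pt (hQ.dd 0).continuous x
    have h1 := Sm.cont_pt (hQ.dd 1).continuous x
    have h2 := (hQ.dd 0).cont_dr x
    have h3 := (hQ.dd 1).cont_dr x
    simp only [hM]; fun_prop
  have cPM : Continuous (fun p : ℝ × ℝ => P (pt x p.1 p.2) * M p.1 p.2) := cP.mul cM
  have c1 : ∀ θ, Continuous (fun ρ => A ρ θ + P (pt x ρ θ) * M ρ θ) := fun θ =>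
    cont_fst (g := fun ρ θ => A ρ θ + P (pt x ρ θ) * M ρ θ) (cA.add cPM) θ
  have c2 : ∀ ρ, Continuous (fun θ => A ρ θ + P (pt x ρ θ) * M ρ θ) := fun θ =>
    cont_snd (g := fun ρ θ => A ρ θ + P (pt x ρ θ) * M ρ θ) (cA.add cPM) θ
  have c3 : ∀ ρ, Continuous (fun θ => B ρ θ + P (pt x ρ θ) * M ρ θ) := fun θ =>
    cont_snd (g := fun ρ θ => B ρ θ + P (pt x ρ θ) * M ρ θ) (cB.add cPM) θ
  have dtQ_rho : ∀ ρ θ, HasDerivAt (fun r => dt Q x r θ) (M ρ θ) ρ := by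
    intro ρ θ
    have h1 := (hQ.dd 1).hasDerivAt_rho x ρ θ
    have h0 := (hQ.dd 0).hasDerivAt_rho x ρ θ
    have := (hasDerivAt_id ρ).mul ((h1.const_mul (cos θ)).sub (h0.const_mul (sin θ)))
    refine this.congr_deriv ?_
    simp [hM]
  have drQ_theta : ∀ ρ θ, HasDerivAt (fun t => dr Q x ρ t) (M ρ θ) θ := by
    intro ρ θ
    have h1 := (hQ.dd 1).hasDerivAt_theta x ρ θ
    have h0 := (hQ.dd 0).hasDerivAt_theta x ρ θ
    have := ((hasDerivAt_cos θ).mul h0).add ((hasDerivAt_sin θ).mul h1)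
    refine this.congr_deriv ?_
    simp only [hM, dt, dr]
    rw [dd_comm hQ 1 0]; ring
  -- radial FTC
  have f1 : ∀ θ, ∫ ρ in (0:ℝ)..R, (A ρ θ + P (pt x ρ θ) * M ρ θ) = P (pt x R θ) * dt Q x R θ := by
    intro θ
    have := intervalIntegral.integral_eq_sub_of_hasDerivAt (a := 0) (b := R)
      (f := fun ρ => P (pt x ρ θ) * dt Q x ρ θ) (f' := fun ρ => A ρ θ + P (pt x ρ θ) * M ρ θ)
      (fun ρ _ => (hP.hasDerivAt_rho x ρ θ).mul (dtQ_rho ρ θ))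
      ((c1 θ).intervalIntegrable _ _)
    rw [this]; simp [dt]
  have f2 : ∀ ρ, ∫ θ in (-π)..π, (B ρ θ + P (pt x ρ θ) * M ρ θ) = 0 := by
    intro ρ
    have := intervalIntegral.integral_eq_sub_of_hasDerivAt (a := -π) (b := π)
      (f := fun θ => P (pt x ρ θ) * dr Q x ρ θ) (f' := fun θ => B ρ θ + P (pt x ρ θ) * M ρ θ)
      (fun θ _ => (hP.hasDerivAt_theta x ρ θ).mul (drQ_theta ρ θ))
      ((c3 ρ).intervalIntegrable _ _)
    rw [this]; simp [dr, pt_pi]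
  have f3 : ∀ ρ θ, ρ * (dd 0 P (pt x ρ θ) * dd 1 Q (pt x ρ θ) - dd 1 P (pt x ρ θ) * dd 0 Q (pt x ρ θ))
      = (A ρ θ + P (pt x ρ θ) * M ρ θ) - (B ρ θ + P (pt x ρ θ) * M ρ θ) := by
    intro ρ θ
    simp only [hA, hB, dr, dt]
    linear_combination (-ρ * (dd 0 P (pt x ρ θ) * dd 1 Q (pt x ρ θ) - dd 1 P (pt x ρ θ) * dd 0 Q (pt x ρ θ))) * (sin_sq_add_cos_sq θ)
  simp only [f3]
  have f4 : ∀ ρ, ∫ θ in (-π)..π, ((A ρ θ + P (pt x ρ θ) * M ρ θ) - (B ρ θ + P (pt x ρ θ) * M ρ θ))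
      = ∫ θ in (-π)..π, (A ρ θ + P (pt x ρ θ) * M ρ θ) := by
    intro ρ
    rw [intervalIntegral.integral_sub ((c2 ρ).intervalIntegrable _ _)
      ((c3 ρ).intervalIntegrable _ _), f2, sub_zero]
  simp only [f4]
  rw [ii_swap (g := fun ρ θ => A ρ θ + P (pt x ρ θ) * M ρ θ) (cA.add cPM) hR hpi]
  simp only [f1]


def hh (u : E2 → ℝ) (x : E2) : ℝ := (dd 0 (dd 0 u) x + dd 1 (dd 1 u) x) / 2
def aa (u : E2 → ℝ) (x : E2) : ℝ := (dd 0 (dd 0 u) x - dd 1 (dd 1 u) x) / 2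
def bb (u : E2 → ℝ) (x : E2) : ℝ := dd 0 (dd 1 u) x
def QQ (u : E2 → ℝ) (x : E2) : ℝ := aa u x ^ 2 + bb u x ^ 2

theorem Sm.hh {u : E2 → ℝ} (hu : Sm u) : Sm (hh u) :=
  ContDiff.div_const (((hu.dd 0).dd 0).add ((hu.dd 1).dd 1)) 2
theorem Sm.aa {u : E2 → ℝ} (hu : Sm u) : Sm (aa u) :=
  ContDiff.div_const (((hu.dd 0).dd 0).sub ((hu.dd 1).dd 1)) 2
theorem Sm.bb {u : E2 → ℝ} (hu : Sm u) : Sm (bb u) := (hu.dd 1).dd 0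
theorem Sm.QQ {u : E2 → ℝ} (hu : Sm u) : Sm (QQ u) := (hu.aa.pow 2).add (hu.bb.pow 2)
theorem QQ_nonneg (u : E2 → ℝ) (x : E2) : 0 ≤ QQ u x := by unfold QQ; positivity

theorem det_eq {u : E2 → ℝ} (hu : Sm u) (x : E2) :
    dd 0 (dd 0 u) x * dd 1 (dd 1 u) x - dd 1 (dd 0 u) x * dd 0 (dd 1 u) x
      = hh u x ^ 2 - QQ u x := by
  rw [dd_comm hu 1 0]; simp only [hh, QQ, aa, bb]; ring

theorem int_ball {f : E2 → ℝ} (hf : Continuous f) (x : E2) (R : ℝ) : IntegrableOn f (ball x R) :=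
  (hf.continuousOn.integrableOn_compact (isCompact_closedBall x R)).mono_set ball_subset_closedBall

theorem ii_cont {f : ℝ → ℝ} (hf : Continuous f) (a b : ℝ) : IntervalIntegrable f volume a b :=
  hf.intervalIntegrable a b

theorem cs_int {α : Type*} [MeasurableSpace α] {μ : Measure α} [IsFiniteMeasure μ] {f : α → ℝ}
    (hf : Integrable f μ) (hf2 : Integrable (fun x => f x ^ 2) μ) :
    (∫ x, f x ∂μ) ^ 2 ≤ μ.real univ * ∫ x, f x ^ 2 ∂μ := by
  have key : ∀ t : ℝ, 0 ≤ ∫ x, f x ^ 2 ∂μ - 2 * t * ∫ x, f x ∂μ + t ^ 2 * μ.real univ := by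
    intro t
    have h : ∫ x, (f x - t) ^ 2 ∂μ = ∫ x, f x ^ 2 ∂μ - 2 * t * ∫ x, f x ∂μ + t ^ 2 * μ.real univ := by
      have e : ∀ x, (f x - t) ^ 2 = (f x ^ 2 - (2 * t) * f x) + t ^ 2 := by intro x; ring
      simp only [e]
      have h1 : Integrable (fun x => f x ^ 2 - (2 * t) * f x) μ := hf2.sub (hf.const_mul _)
      rw [integral_add h1 (integrable_const _), integral_sub hf2 (hf.const_mul _), integral_const_mul, integral_const]
      simp [mul_comm]
    rw [← h]; exact integral_nonneg (fun x => sq_nonneg _)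
  have hV : 0 ≤ μ.real univ := measureReal_nonneg
  rcases hV.eq_or_lt with h0 | hpos
  · have h1 := key (∫ x, f x ∂μ)
    rw [← h0] at h1 ⊢
    have hμ : μ = 0 := by
      have : μ univ = 0 := by
        have := h0.symm
        rwa [measureReal_eq_zero_iff] at this
      exact Measure.measure_univ_eq_zero.1 this
    simp [hμ]
  · have h1 := key ((∫ x, f x ∂μ) / μ.real univ)
    have h2 : ∫ x, f x ^ 2 ∂μ - 2 * ((∫ x, f x ∂μ) / μ.real univ) * ∫ x, f x ∂μ
       + ((∫ x, f x ∂μ) / μ.real univ) ^ 2 * μ.real univ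
       = ∫ x, f x ^ 2 ∂μ - (∫ x, f x ∂μ) ^ 2 / μ.real univ := by field_simp; ring
    rw [h2, sub_nonneg, div_le_iff₀ hpos] at h1
    linarith

theorem cs_interval {f : ℝ → ℝ} (hf : Continuous f) {a b : ℝ} (hab : a ≤ b) :
    (∫ t in a..b, f t) ^ 2 ≤ (b - a) * ∫ t in a..b, f t ^ 2 := by
  rw [intervalIntegral.integral_of_le hab, intervalIntegral.integral_of_le hab]
  have := cs_int (μ := volume.restrict (Ioc a b)) (f := f)
    ((ii_cont hf a b).1) ((ii_cont (hf.pow 2) a b).1)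
  simpa [Measure.real, hab] using this

theorem vol_ball (x : E2) {R : ℝ} (hR : 0 ≤ R) : (volume (ball x R)).toReal = π * R ^ 2 := by
  rw [EuclideanSpace.volume_ball_fin_two]
  simp [ENNReal.toReal_mul, ENNReal.toReal_ofReal hR, mul_comm]
  left; exact pi_pos.le

theorem cs_ball {f : E2 → ℝ} (hf : Continuous f) (x : E2) {R : ℝ} (hR : 0 ≤ R) :
    (∫ y in ball x R, f y) ^ 2 ≤ π * R ^ 2 * ∫ y in ball x R, f y ^ 2 := by
  have hfin : IsFiniteMeasure (volume.restrict (ball x R)) := ⟨by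
    rw [Measure.restrict_apply_univ]; exact measure_ball_lt_top⟩
  have := cs_int (μ := volume.restrict (ball x R)) (f := f) (int_ball hf x R) (int_ball (hf.pow 2) x R)
  rwa [Measure.real, Measure.restrict_apply_univ, vol_ball x hR] at this

/-- Boundary identity for functions vanishing on the unit circle. -/
theorem bdry_identity {v : E2 → ℝ} (hv : Sm v) (h0 : ∀ x ∈ sphere (0:E2) 1, v x = 0) :
    ∫ y in ball (0:E2) 1, (hh v y ^ 2 - QQ v y)
      = (1/2) * ∫ θ in (-π)..π, (dd 0 v (pt 0 1 θ) ^ 2 + dd 1 v (pt 0 1 θ) ^ 2) := by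
  have hj := jac_int (hv.dd 0) (hv.dd 1) 0 (R := 1) zero_le_one
  simp only [det_eq hv] at hj
  rw [hj]
  have hv0 : ∀ θ, v (pt 0 1 θ) = 0 := fun θ => h0 _ (by simp [norm_pt])
  have hstar : ∀ θ, cos θ * dd 1 v (pt 0 1 θ) - sin θ * dd 0 v (pt 0 1 θ) = 0 := by
    intro θ
    have h1 := hv.hasDerivAt_theta 0 1 θ
    have h2 : HasDerivAt (fun t => v (pt 0 1 t)) 0 θ := by simp only [hv0]; exact hasDerivAt_const _ _
    have := h1.unique h2
    simpa [dt] using this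
  have hstar2 : ∀ θ, cos θ * dt (dd 1 v) 0 1 θ - sin θ * dt (dd 0 v) 0 1 θ
      = cos θ * dd 0 v (pt 0 1 θ) + sin θ * dd 1 v (pt 0 1 θ) := by
    intro θ
    have h1 := ((hasDerivAt_cos θ).mul ((hv.dd 1).hasDerivAt_theta 0 1 θ)).sub
      ((hasDerivAt_sin θ).mul ((hv.dd 0).hasDerivAt_theta 0 1 θ))
    have h2 : HasDerivAt (fun t => cos t * dd 1 v (pt 0 1 t) - sin t * dd 0 v (pt 0 1 t)) 0 θ := by
      simp only [hstar]; exact hasDerivAt_const _ _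
    have := h1.unique h2
    linarith
  have c0 := cont_snd (g := fun ρ θ => dd 0 v (pt 0 ρ θ)) (Sm.cont_pt (hv.dd 0).continuous 0) 1
  have c1 := cont_snd (g := fun ρ θ => dd 1 v (pt 0 ρ θ)) (Sm.cont_pt (hv.dd 1).continuous 0) 1
  have d0 := cont_snd (g := fun ρ θ => dt (dd 0 v) 0 ρ θ) ((hv.dd 0).cont_dt 0) 1
  have d1 := cont_snd (g := fun ρ θ => dt (dd 1 v) 0 ρ θ) ((hv.dd 1).cont_dt 0) 1
  have hparts : ∫ θ in (-π)..π, (dt (dd 0 v) 0 1 θ * dd 1 v (pt 0 1 θ) + dd 0 v (pt 0 1 θ) * dt (dd 1 v) 0 1 θ) = 0 := by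
    rw [intervalIntegral.integral_eq_sub_of_hasDerivAt
      (f := fun θ => dd 0 v (pt 0 1 θ) * dd 1 v (pt 0 1 θ))
      (fun θ _ => ((hv.dd 0).hasDerivAt_theta 0 1 θ).mul ((hv.dd 1).hasDerivAt_theta 0 1 θ))
      (ii_cont ((d0.mul c1).add (c0.mul d1)) _ _)]
    simp [pt_pi]
  have key : ∀ θ, dd 0 v (pt 0 1 θ) * dt (dd 1 v) 0 1 θ =
      (1/2) * (dd 0 v (pt 0 1 θ) ^ 2 + dd 1 v (pt 0 1 θ) ^ 2)
      + (1/2) * (dt (dd 0 v) 0 1 θ * dd 1 v (pt 0 1 θ) + dd 0 v (pt 0 1 θ) * dt (dd 1 v) 0 1 θ) := by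
    intro θ
    have h1 := hstar θ
    have h2 := hstar2 θ
    have h3 := sin_sq_add_cos_sq θ
    generalize dd 0 v (pt 0 1 θ) = p at *
    generalize dd 1 v (pt 0 1 θ) = q at *
    generalize dt (dd 0 v) 0 1 θ = p' at *
    generalize dt (dd 1 v) 0 1 θ = q' at *
    generalize cos θ = c at *
    generalize sin θ = s at *
    have hp : p = (c * p + s * q) * c := by linear_combination (-p) * h3 - s * h1
    have hq : q = (c * p + s * q) * s := by linear_combination (-q) * h3 + c * h1
    have e1 : p * q' - q * p' = (c * p + s * q) ^ 2 := by
      have : p * q' - q * p' = (c * p + s * q) * (c * q' - s * p') := by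
        linear_combination q' * hp - p' * hq
      rw [this, h2]; ring
    have e2 : p ^ 2 + q ^ 2 = (c * p + s * q) ^ 2 := by
      linear_combination p * hp + q * hq
    linear_combination (1/2) * e1 - (1/2) * e2
  rw [funext key]
  rw [intervalIntegral.integral_add, intervalIntegral.integral_const_mul, intervalIntegral.integral_const_mul, hparts]
  · ring
  · exact ii_cont (by fun_prop) _ _
  · exact ii_cont (by fun_prop) _ _

theorem talenti {v : E2 → ℝ} (hv : Sm v) (h0 : ∀ x ∈ sphere (0:E2) 1, v x = 0) :
    ∫ y in ball (0:E2) 1, QQ v y ≤ ∫ y in ball (0:E2) 1, hh v y ^ 2 := by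
  have h := bdry_identity hv h0
  rw [integral_sub (int_ball (hv.hh.pow 2).continuous _ _) (int_ball hv.QQ.continuous _ _)] at h
  have : 0 ≤ ∫ θ in (-π)..π, (dd 0 v (pt 0 1 θ) ^ 2 + dd 1 v (pt 0 1 θ) ^ 2) :=
    intervalIntegral.integral_nonneg (by linarith [pi_pos]) (fun θ _ => by positivity)
  linarith

theorem bdry_grad {v : E2 → ℝ} (hv : Sm v) (h0 : ∀ x ∈ sphere (0:E2) 1, v x = 0) :
    ∫ θ in (-π)..π, (dd 0 v (pt 0 1 θ) ^ 2 + dd 1 v (pt 0 1 θ) ^ 2)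
      ≤ 2 * ∫ y in ball (0:E2) 1, hh v y ^ 2 := by
  have h := bdry_identity hv h0
  rw [integral_sub (int_ball (hv.hh.pow 2).continuous _ _) (int_ball hv.QQ.continuous _ _)] at h
  have : 0 ≤ ∫ y in ball (0:E2) 1, QQ v y := integral_nonneg (fun y => QQ_nonneg v y)
  linarith


theorem cart_int {f : E2 → ℝ} (hf : Continuous f) :
    Integrable (fun p : ℝ × ℝ => (ball (0:E2) 1).indicator f !₂[p.1, p.2]) ∧
    ∫ y in ball (0:E2) 1, f y = ∫ t : ℝ, ∫ s : ℝ, (ball (0:E2) 1).indicator f !₂[t, s] := by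
  have mp := (EuclideanSpace.volume_preserving_symm_measurableEquiv_toLp (Fin 2)).symm
  have mp2 := (volume_preserving_finTwoArrow ℝ).symm
  have hintg : Integrable ((ball (0:E2) 1).indicator f) :=
    (integrable_indicator_iff measurableSet_ball).2 (int_ball hf 0 1)
  have h1 : Integrable (fun p : ℝ × ℝ => (ball (0:E2) 1).indicator f !₂[p.1, p.2]) := by
    have := (mp2.trans mp).integrable_comp_of_integrable hintg
    exact this
  refine ⟨h1, ?_⟩
  rw [← integral_indicator measurableSet_ball, ← mp.integral_comp' , ← mp2.integral_comp']
  rw [Measure.volume_eq_prod, integral_prod]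
  · rfl
  · exact h1

theorem hasDerivAt_c0 {f : E2 → ℝ} (hf : Sm f) (t b : ℝ) :
    HasDerivAt (fun t => f !₂[t, b]) (dd 0 f !₂[t, b]) t := by
  have h1 := (hf.differentiable !₂[t, b]).hasFDerivAt.comp_hasDerivAt t
    (hasDerivAt_toLp (hasDerivAt_id t) (hasDerivAt_const t b))
  rw [dd_eval] at h1
  simp at h1
  exact h1
theorem hasDerivAt_c1 {f : E2 → ℝ} (hf : Sm f) (t b : ℝ) :
    HasDerivAt (fun b => f !₂[t, b]) (dd 1 f !₂[t, b]) b := by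
  have h1 := (hf.differentiable !₂[t, b]).hasFDerivAt.comp_hasDerivAt b
    (hasDerivAt_toLp (hasDerivAt_const b t) (hasDerivAt_id b))
  rw [dd_eval] at h1
  simp at h1
  exact h1

theorem cont_c {f : E2 → ℝ} (hf : Continuous f) {a b : ℝ → ℝ} (ha : Continuous a) (hb : Continuous b) :
    Continuous (fun t => f !₂[a t, b t]) := by
  refine hf.comp ?_
  refine (PiLp.continuous_toLp 2 _).comp ?_
  refine continuous_pi fun i => ?_
  fin_cases i <;> simpa

theorem mem_ball_c (t s : ℝ) : (!₂[t, s] : E2) ∈ ball (0:E2) 1 ↔ t ^ 2 + s ^ 2 < 1 := by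
  rw [mem_ball_zero_iff, EuclideanSpace.norm_eq, Real.sqrt_lt' one_pos]
  simp [Fin.sum_univ_two]

theorem supbound_ {v : E2 → ℝ} (hv : Sm v) (h0 : ∀ x ∈ sphere (0:E2) 1, v x = 0)
    {a b : ℝ} (hab : a ^ 2 + b ^ 2 ≤ 1) :
    |v !₂[a, b]| ≤ (∫ θ in (-π)..π, |dd 0 v (pt 0 1 θ)|) + ∫ y in ball (0:E2) 1, |bb v y| := by
  obtain ⟨hi, he⟩ := cart_int (f := fun y => |bb v y|) hv.bb.continuous.abs
  rw [Measure.volume_eq_prod] at hi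
  set m : ℝ → ℝ := fun t => ∫ s : ℝ, (ball (0:E2) 1).indicator (fun y => |bb v y|) !₂[t, s] with hm
  have hmi : Integrable m := hi.integral_prod_left
  have hm0 : ∀ t, 0 ≤ m t := fun t => integral_nonneg fun s => indicator_nonneg (fun _ _ => abs_nonneg _) _
  set φ : ℝ → ℝ := fun t => |dd 0 v !₂[t, -√(1 - t ^ 2)]| with hφ
  have hφc : Continuous φ :=
    (cont_c (hv.dd 0).continuous continuous_id (by fun_prop)).abs
  have hslice : ∀ t, t ^ 2 ≤ 1 - b ^ 2 → |dd 0 v !₂[t, b]| ≤ φ t + m t := by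
    intro t ht
    set σ := √(1 - t ^ 2) with hσ
    have hσ2 : σ ^ 2 = 1 - t ^ 2 := Real.sq_sqrt (by nlinarith [sq_nonneg b])
    have hσ0 : 0 ≤ σ := Real.sqrt_nonneg _
    have hbσ : |b| ≤ σ := abs_le_of_sq_le_sq (by nlinarith) hσ0
    have hb1 := (abs_le.1 hbσ).1
    have hb2 := (abs_le.1 hbσ).2
    have hc := cont_c hv.bb.continuous (continuous_const (y := t)) continuous_id
    have ftc : ∫ s in (-σ)..b, bb v !₂[t, s] = dd 0 v !₂[t, b] - dd 0 v !₂[t, -σ] := by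
      refine intervalIntegral.integral_eq_sub_of_hasDerivAt (f := fun s => dd 0 v !₂[t, s]) (fun s _ => ?_)
        (ii_cont hc _ _)
      have := hasDerivAt_c1 (hv.dd 0) t s
      rwa [dd_comm hv 1 0] at this
    have h2 : |∫ s in (-σ)..b, bb v !₂[t, s]| ≤ ∫ s in (-σ)..b, |bb v !₂[t, s]| :=
      intervalIntegral.abs_integral_le_integral_abs hb1
    have h3 : ∫ s in (-σ)..b, |bb v !₂[t, s]| ≤ m t := by
      have e : ∀ s, (ball (0:E2) 1).indicator (fun y => |bb v y|) !₂[t, s]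
          = (Ioo (-σ) σ).indicator (fun s => |bb v !₂[t, s]|) s := by
        intro s
        have : (!₂[t, s] : E2) ∈ ball (0:E2) 1 ↔ s ∈ Ioo (-σ) σ := by
          rw [mem_ball_c, mem_Ioo, ← abs_lt, ← abs_of_nonneg hσ0, ← sq_lt_sq, hσ2]
          constructor <;> intro h <;> linarith
        simp only [indicator, this]
      simp only [hm, e]
      rw [integral_indicator measurableSet_Ioo, ← integral_Ioc_eq_integral_Ioo,
        ← intervalIntegral.integral_of_le (by linarith)]
      refine intervalIntegral.integral_mono_interval le_rfl hb1 hb2 ?_ (ii_cont hc.abs _ _)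
      exact Eventually.of_forall fun s => abs_nonneg _
    have : dd 0 v !₂[t, b] = dd 0 v !₂[t, -σ] + ∫ s in (-σ)..b, bb v !₂[t, s] := by rw [ftc]; ring
    rw [this]
    calc _ ≤ |dd 0 v !₂[t, -σ]| + |∫ s in (-σ)..b, bb v !₂[t, s]| := abs_add_le _ _
      _ ≤ _ := by simp only [hφ]; rw [← hσ]; linarith
  set c := √(1 - b ^ 2) with hc
  have hc2 : c ^ 2 = 1 - b ^ 2 := Real.sq_sqrt (by nlinarith [sq_nonneg a])
  have hc0 : 0 ≤ c := Real.sqrt_nonneg _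
  have hac : |a| ≤ c := abs_le_of_sq_le_sq (by nlinarith) hc0
  have ha1 := (abs_le.1 hac).1
  have ha2 := (abs_le.1 hac).2
  have hc1 : c ≤ 1 := by nlinarith [sq_nonneg b]
  have cc := cont_c (hv.dd 0).continuous continuous_id (continuous_const (y := b))
  have ftc : ∫ t in (-c)..a, dd 0 v !₂[t, b] = v !₂[a, b] - v !₂[-c, b] :=
    intervalIntegral.integral_eq_sub_of_hasDerivAt (f := fun t => v !₂[t, b])
      (fun t _ => hasDerivAt_c0 hv t b) (ii_cont cc _ _)
  have hz : v !₂[-c, b] = 0 := h0 _ (by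
    rw [mem_sphere_zero_iff_norm, EuclideanSpace.norm_eq]; simp [Fin.sum_univ_two, hc2])
  rw [hz, sub_zero] at ftc
  rw [← ftc]
  have hφm : ∀ x y : ℝ, IntervalIntegrable (fun t => φ t + m t) volume x y := fun x y =>
    (ii_cont hφc x y).add hmi.intervalIntegrable
  have s1 : |∫ t in (-c)..a, dd 0 v !₂[t, b]| ≤ ∫ t in (-c)..a, (φ t + m t) := by
    refine (intervalIntegral.abs_integral_le_integral_abs ha1).trans ?_
    refine intervalIntegral.integral_mono_on ha1 (ii_cont cc.abs _ _) (hφm _ _) (fun t ht => hslice t ?_)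
    rw [← hc2]; exact sq_le_sq' ht.1 (ht.2.trans ha2)
  have s2 : ∫ t in (-c)..a, (φ t + m t) ≤ ∫ t in (-1:ℝ)..1, (φ t + m t) := by
    refine intervalIntegral.integral_mono_interval (by linarith) ha1 (by linarith) ?_ (hφm _ _)
    exact Eventually.of_forall fun s => add_nonneg (abs_nonneg _) (hm0 _)
  have s3 : ∫ t in (-1:ℝ)..1, (φ t + m t) = (∫ t in (-1:ℝ)..1, φ t) + ∫ t in (-1:ℝ)..1, m t :=
    intervalIntegral.integral_add (ii_cont hφc _ _) hmi.intervalIntegrable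
  have s4 : ∫ t in (-1:ℝ)..1, m t ≤ ∫ y in ball (0:E2) 1, |bb v y| := by
    rw [he, intervalIntegral.integral_of_le (by norm_num)]
    exact setIntegral_le_integral hmi (Eventually.of_forall hm0)
  have s5 : ∫ t in (-1:ℝ)..1, φ t ≤ ∫ θ in (-π)..π, |dd 0 v (pt 0 1 θ)| := by
    have hp := pi_pos
    have cv := intervalIntegral.integral_comp_mul_deriv (a := -π) (b := 0) (f := cos) (f' := fun x => - sin x) (g := φ)
      (fun x _ => hasDerivAt_cos x) (by fun_prop) hφc
    simp only [cos_neg, cos_pi, cos_zero] at cv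
    rw [← cv]
    have cpt := (cont_snd (g := fun ρ θ => dd 0 v (pt 0 ρ θ)) (Sm.cont_pt (hv.dd 0).continuous 0) 1).abs
    calc _ ≤ ∫ θ in (-π)..0, |dd 0 v (pt 0 1 θ)| := by
          refine intervalIntegral.integral_mono_on (by linarith) (ii_cont (by
            exact (hφc.comp continuous_cos).mul continuous_sin.neg) _ _)
            (ii_cont cpt _ _) (fun θ hθ => ?_)
          have hs : sin θ ≤ 0 := sin_nonpos_of_nonpos_of_neg_pi_le hθ.2 hθ.1
          have : -√(1 - cos θ ^ 2) = sin θ := by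
            rw [← abs_sin_eq_sqrt_one_sub_cos_sq, abs_of_nonpos hs]; ring
          simp only [hφ, Function.comp, this]
          have e : pt 0 1 θ = !₂[cos θ, sin θ] := by simp [pt]
          rw [e]
          nlinarith [neg_one_le_sin θ, abs_nonneg (dd 0 v !₂[cos θ, sin θ])]
      _ ≤ _ := by
          refine intervalIntegral.integral_mono_interval le_rfl (by linarith) (by linarith) ?_ (ii_cont cpt _ _)
          exact Eventually.of_forall fun s => abs_nonneg _
  linarith

theorem supbound {v : E2 → ℝ} (hv : Sm v) (h0 : ∀ x ∈ sphere (0:E2) 1, v x = 0)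
    {x : E2} (hx : x ∈ closedBall (0:E2) 1) :
    v x ^ 2 ≤ 10 * π * ∫ y in ball (0:E2) 1, hh v y ^ 2 := by
  have hx' : x = !₂[x 0, x 1] := by ext i; fin_cases i <;> simp
  have hn : x 0 ^ 2 + x 1 ^ 2 ≤ 1 := by
    rw [mem_closedBall_zero_iff, EuclideanSpace.norm_eq, Real.sqrt_le_one] at hx
    simpa [Fin.sum_univ_two] using hx
  have h1 := supbound_ hv h0 hn
  rw [← hx'] at h1
  have hp := pi_pos
  have cpt := (cont_snd (g := fun ρ θ => dd 0 v (pt 0 ρ θ)) (Sm.cont_pt (hv.dd 0).continuous 0) 1)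
  have cpt1 := (cont_snd (g := fun ρ θ => dd 1 v (pt 0 ρ θ)) (Sm.cont_pt (hv.dd 1).continuous 0) 1)
  have h2 := cs_interval cpt.abs (by linarith : -π ≤ π)
  have h3 := cs_ball hv.bb.continuous.abs 0 (R := 1) zero_le_one
  simp only [sq_abs] at h2 h3
  have h4 := bdry_grad hv h0
  have h5 := talenti hv h0
  have h6 : ∫ θ in (-π)..π, dd 0 v (pt 0 1 θ) ^ 2 ≤ ∫ θ in (-π)..π, (dd 0 v (pt 0 1 θ) ^ 2 + dd 1 v (pt 0 1 θ) ^ 2) :=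
    intervalIntegral.integral_mono_on (by linarith) (ii_cont (cpt.pow 2) _ _)
      (ii_cont ((cpt.pow 2).add (cpt1.pow 2)) _ _) (fun θ _ => by nlinarith [sq_nonneg (dd 1 v (pt 0 1 θ))])
  have h7 : ∫ y in ball (0:E2) 1, bb v y ^ 2 ≤ ∫ y in ball (0:E2) 1, QQ v y :=
    setIntegral_mono (int_ball (hv.bb.pow 2).continuous _ _) (int_ball hv.QQ.continuous _ _)
      (fun y => by simp only [QQ]; nlinarith [sq_nonneg (aa v y)])
  set I := ∫ y in ball (0:E2) 1, hh v y ^ 2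
  set A := ∫ θ in (-π)..π, |dd 0 v (pt 0 1 θ)|
  set B := ∫ y in ball (0:E2) 1, |bb v y|
  have hA : A ^ 2 ≤ 4 * π * I := by nlinarith
  have hB : B ^ 2 ≤ π * I := by nlinarith
  have : v x ^ 2 ≤ (A + B) ^ 2 := sq_le_sq' (by linarith [neg_abs_le (v x)]) (by linarith [le_abs_self (v x)])
  nlinarith [sq_nonneg (A - B)]


/-- squared Hilbert-Schmidt norm of the Hessian -/
def HS (u : E2 → ℝ) (x : E2) : ℝ := 2 * hh u x ^ 2 + 2 * QQ u x
theorem HS_nonneg (u : E2 → ℝ) (x : E2) : 0 ≤ HS u x := by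
  unfold HS; have := QQ_nonneg u x; positivity
theorem Sm.HS {u : E2 → ℝ} (hu : Sm u) : Sm (HS u) :=
  ((Sm.const 2).mul (hu.hh.pow 2)).add ((Sm.const 2).mul hu.QQ)
theorem HS_eq {u : E2 → ℝ} (hu : Sm u) (x : E2) : HS u x =
    dd 0 (dd 0 u) x ^ 2 + dd 1 (dd 0 u) x ^ 2 + dd 0 (dd 1 u) x ^ 2 + dd 1 (dd 1 u) x ^ 2 := by
  rw [dd_comm hu 1 0]; simp only [HS, QQ, hh, aa, bb]; ring

theorem mono_int {f g : E2 → ℝ} (hf : Continuous f) (hg : Continuous g) (x : E2) (R : ℝ)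
    (h : ∀ y ∈ ball x R, f y ≤ g y) : ∫ y in ball x R, f y ≤ ∫ y in ball x R, g y :=
  setIntegral_mono_on (int_ball hf x R) (int_ball hg x R) measurableSet_ball h

theorem mono_ball {f : E2 → ℝ} (hf : Continuous f) (h0 : ∀ y, 0 ≤ f y) {x x' : E2} {R R' : ℝ}
    (h : ball x R ⊆ ball x' R') : ∫ y in ball x R, f y ≤ ∫ y in ball x' R', f y :=
  setIntegral_mono_set (int_ball hf _ _) (Eventually.of_forall h0) (Eventually.of_forall h)

theorem nonneg_int {f : E2 → ℝ} (h0 : ∀ y, 0 ≤ f y) (x : E2) (R : ℝ) : 0 ≤ ∫ y in ball x R, f y :=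
  integral_nonneg h0

/-- isoperimetric-type estimate -/
theorem det_bdry {v : E2 → ℝ} (hv : Sm v) (x : E2) {s : ℝ} (hs : 0 ≤ s) :
    |∫ y in ball x s, (hh v y ^ 2 - QQ v y)| ≤ π * s ^ 2 * ∫ θ in (-π)..π, HS v (pt x s θ) := by
  have hp := pi_pos
  have hpi : -π ≤ π := by linarith
  have hj := jac_int (hv.dd 0) (hv.dd 1) x hs
  simp only [det_eq hv] at hj
  rw [hj]
  have c0 := cont_snd (g := fun ρ θ => dd 0 v (pt x ρ θ)) (Sm.cont_pt (hv.dd 0).continuous x) s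
  have cH := cont_snd (g := fun ρ θ => HS v (pt x ρ θ)) (Sm.cont_pt hv.HS.continuous x) s
  have d0 := cont_snd (g := fun ρ θ => dt (dd 0 v) x ρ θ) ((hv.dd 0).cont_dt x) s
  have d1 := cont_snd (g := fun ρ θ => dt (dd 1 v) x ρ θ) ((hv.dd 1).cont_dt x) s
  set c := dd 0 v (pt x s (-π)) with hc
  set D0 := ∫ θ in (-π)..π, |dt (dd 0 v) x s θ| with hD0
  set D1 := ∫ θ in (-π)..π, |dt (dd 1 v) x s θ| with hD1
  have z1 : ∫ θ in (-π)..π, dt (dd 1 v) x s θ = 0 := by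
    rw [intervalIntegral.integral_eq_sub_of_hasDerivAt (f := fun θ => dd 1 v (pt x s θ))
      (fun θ _ => (hv.dd 1).hasDerivAt_theta x s θ) (ii_cont d1 _ _)]
    simp [pt_pi]
  have e1 : ∫ θ in (-π)..π, dd 0 v (pt x s θ) * dt (dd 1 v) x s θ
      = ∫ θ in (-π)..π, (dd 0 v (pt x s θ) - c) * dt (dd 1 v) x s θ := by
    have : ∀ θ, (dd 0 v (pt x s θ) - c) * dt (dd 1 v) x s θ
      = dd 0 v (pt x s θ) * dt (dd 1 v) x s θ - c * dt (dd 1 v) x s θ := by intro θ; ring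
    rw [funext this, intervalIntegral.integral_sub, intervalIntegral.integral_const_mul, z1]
    · ring
    · exact ii_cont (by fun_prop) _ _
    · exact ii_cont (by fun_prop) _ _
  have osc : ∀ θ ∈ Icc (-π) π, |dd 0 v (pt x s θ) - c| ≤ D0 := by
    intro θ hθ
    have : dd 0 v (pt x s θ) - c = ∫ t in (-π)..θ, dt (dd 0 v) x s t :=
      (intervalIntegral.integral_eq_sub_of_hasDerivAt (f := fun θ => dd 0 v (pt x s θ))
      (fun θ _ => (hv.dd 0).hasDerivAt_theta x s θ) (ii_cont d0 _ _)).symm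
    rw [this]
    refine (intervalIntegral.abs_integral_le_integral_abs hθ.1).trans ?_
    exact intervalIntegral.integral_mono_interval le_rfl hθ.1 hθ.2
      (Eventually.of_forall fun s => abs_nonneg _) (ii_cont d0.abs _ _)
  have e2 : |∫ θ in (-π)..π, (dd 0 v (pt x s θ) - c) * dt (dd 1 v) x s θ| ≤ D0 * D1 := by
    refine (intervalIntegral.abs_integral_le_integral_abs hpi).trans ?_
    rw [hD1, ← intervalIntegral.integral_const_mul]
    refine intervalIntegral.integral_mono_on hpi (ii_cont ((c0.sub continuous_const).mul d1).abs _ _)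
      (ii_cont (continuous_const.mul d1.abs) _ _) (fun θ hθ => ?_)
    rw [abs_mul]
    exact mul_le_mul_of_nonneg_right (osc θ hθ) (abs_nonneg _)
  have q0 := cs_interval d0.abs hpi
  have q1 := cs_interval d1.abs hpi
  simp only [sq_abs] at q0 q1
  rw [← hD0] at q0
  rw [← hD1] at q1
  have e3 : (∫ θ in (-π)..π, dt (dd 0 v) x s θ ^ 2) + (∫ θ in (-π)..π, dt (dd 1 v) x s θ ^ 2)
      ≤ s ^ 2 * ∫ θ in (-π)..π, HS v (pt x s θ) := by
    rw [← intervalIntegral.integral_add, ← intervalIntegral.integral_const_mul]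
    rotate_left
    · exact ii_cont (by fun_prop) _ _
    · exact ii_cont (by fun_prop) _ _
    refine intervalIntegral.integral_mono_on hpi (ii_cont ((d0.pow 2).add (d1.pow 2)) _ _)
      (ii_cont (continuous_const.mul cH) _ _) (fun θ hθ => ?_)
    rw [HS_eq hv]
    simp only [dt]
    have h3 := sin_sq_add_cos_sq θ
    have key : ∀ a b c' s' : ℝ, s' ^ 2 + c' ^ 2 = 1 → (c' * b - s' * a) ^ 2 ≤ a ^ 2 + b ^ 2 := by
      intro a b c' s' h
      have : a ^ 2 + b ^ 2 = (s' ^ 2 + c' ^ 2) * (a ^ 2 + b ^ 2) := by rw [h]; ring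
      rw [this]; nlinarith [sq_nonneg (c' * a + s' * b)]
    have k1 := key (dd 0 (dd 0 v) (pt x s θ)) (dd 1 (dd 0 v) (pt x s θ)) _ _ h3
    have k2 := key (dd 0 (dd 1 v) (pt x s θ)) (dd 1 (dd 1 v) (pt x s θ)) _ _ h3
    rw [mul_pow, mul_pow, ← mul_add]
    refine mul_le_mul_of_nonneg_left ?_ (sq_nonneg s)
    linarith
  rw [e1]
  refine e2.trans ?_
  nlinarith [sq_nonneg (D0 - D1)]

theorem decay {v E : E2 → ℝ} (hv : Sm v) (hE : Continuous E) (hE0 : ∀ y, 0 ≤ E y) {k : ℝ}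
    (hk0 : 0 ≤ k) (hk : k < 1) (x : E2) {s R : ℝ} (hs : 0 < s) (hsR : s ≤ R)
    (h : ∀ y ∈ ball x R, hh v y ^ 2 ≤ k * QQ v y + E y) :
    ∫ y in ball x s, HS v y ≤ (s / R) ^ ((1 - k) / (4 * π)) * (∫ y in ball x R, HS v y)
      + (4 * π / (1 - k)) * ∫ y in ball x R, E y := by
  have hp := pi_gt_three
  set K := 4 * π / (1 - k) with hK
  have h1k : 0 < 1 - k := by linarith
  have hK0 : 0 < K := by positivity
  have hKi : (1 - k) / (4 * π) = 1 / K := by rw [hK]; field_simp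
  rw [hKi]
  set ε := ∫ y in ball x R, E y with hε
  have hε0 : 0 ≤ ε := nonneg_int hE0 _ _
  set m : ℝ → ℝ := fun s => s * ∫ θ in (-π)..π, HS v (pt x s θ) with hm
  have hmc : Continuous m := continuous_id.mul
    (cont_int (g := fun ρ θ => HS v (pt x ρ θ)) (Sm.cont_pt hv.HS.continuous x) _ _)
  set I : ℝ → ℝ := fun s => ∫ ρ in (0:ℝ)..s, m ρ with hI
  have hId : ∀ s, HasDerivAt I (m s) s := fun s =>
    intervalIntegral.integral_hasDerivAt_right (ii_cont hmc _ _)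
      (hmc.stronglyMeasurableAtFilter _ _) hmc.continuousAt
  have hIe : ∀ s, 0 ≤ s → ∫ y in ball x s, HS v y = I s := by
    intro s hs
    rw [polar_int hv.HS.continuous x hs]
    simp only [hI, hm, intervalIntegral.integral_const_mul]
  have main : ∀ s, 0 ≤ s → s ≤ R → I s ≤ K * s * m s + K * ε := by
    intro s hs hsR
    have hsub : ball x s ⊆ ball x R := ball_subset_ball hsR
    have d := det_bdry hv x hs
    have d1 := (abs_le.1 d).1
    rw [← hIe s hs]
    have hεs : ∫ y in ball x s, E y ≤ ε := mono_ball hE hE0 hsub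
    have cA : Continuous (fun y => (4 / (1-k)) * (-(hh v y ^ 2 - QQ v y))) :=
      continuous_const.mul ((hv.hh.pow 2).sub hv.QQ).continuous.neg
    have b1 : ∫ y in ball x s, HS v y ≤
        ∫ y in ball x s, ((4 / (1-k)) * (-(hh v y ^ 2 - QQ v y)) + (6 / (1 - k)) * E y) := by
      refine mono_int hv.HS.continuous (by fun_prop) _ _ (fun y hy => ?_)
      have h1 := h y (hsub hy)
      have h2 := hE0 y
      have h3 := QQ_nonneg v y
      have e : (4 / (1-k)) * (-(hh v y ^ 2 - QQ v y)) + (6 / (1 - k)) * E y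
        = (4 * (QQ v y - hh v y ^ 2) + 6 * E y) / (1 - k) := by field_simp; ring
      rw [e, le_div_iff₀ h1k]
      simp only [HS]
      nlinarith [mul_nonneg hk0 h2, mul_le_mul_of_nonneg_left h1 (by linarith : 0 ≤ 6 - 2 * k),
        mul_nonneg (sq_nonneg (1 - k)) h3]
    have cB : Continuous (fun y => (6 / (1 - k)) * E y) := by fun_prop
    rw [integral_add (int_ball cA _ _) (int_ball cB _ _),
      integral_const_mul, integral_const_mul, integral_neg] at b1
    set J := ∫ y in ball x s, (hh v y ^ 2 - QQ v y) with hJ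
    set H := ∫ θ in (-π)..π, HS v (pt x s θ) with hH
    have f1 : (4 / (1-k)) * (-J) ≤ K * s * m s := by
      have : K * s * m s = (4 / (1-k)) * (π * s ^ 2 * H) := by
        simp only [hK, hm, hH]; ring
      rw [this]
      exact mul_le_mul_of_nonneg_left (by linarith) (by positivity)
    have f2 : (6 / (1 - k)) * ∫ y in ball x s, E y ≤ K * ε := by
      refine mul_le_mul ?_ hεs (nonneg_int hE0 _ _) hK0.le
      rw [hK]; gcongr; linarith
    linarith
  have hR : 0 < R := lt_of_lt_of_le hs hsR
  rw [hIe s hs.le, hIe R hR.le]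
  -- monotone quantity
  set Φ : ℝ → ℝ := fun t => (I t - K * ε) * t ^ (-(1 / K)) with hΦ
  have hmono : MonotoneOn Φ (Icc s R) := by
    refine monotoneOn_of_hasDerivWithinAt_nonneg (f' := fun t => m t * t ^ (-(1/K)) + (I t - K * ε) * (-(1/K) * t ^ (-(1/K) - 1))) (convex_Icc s R) ?_ ?_ ?_
    · intro t ht
      have ht0 : 0 < t := lt_of_lt_of_le hs ht.1
      exact (((hId t).sub_const _).continuousAt.mul
        (Real.continuousAt_rpow_const _ _ (Or.inl ht0.ne'))).continuousWithinAt
    · intro t ht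
      rw [interior_Icc] at ht
      have ht0 : 0 < t := lt_trans hs ht.1
      exact (((hId t).sub_const _).mul (Real.hasDerivAt_rpow_const (Or.inl ht0.ne'))).hasDerivWithinAt
    · intro t ht
      rw [interior_Icc] at ht
      have ht0 : 0 < t := lt_trans hs ht.1
      have hmt := main t ht0.le ht.2.le
      rw [Real.rpow_sub_one ht0.ne']
      have hpos : 0 < t ^ (-(1/K)) := Real.rpow_pos_of_pos ht0 _
      have : m t * t ^ (-(1/K)) + (I t - K * ε) * (-(1/K) * (t ^ (-(1/K)) / t))
        = t ^ (-(1/K)) * ((K * t * m t + K * ε - I t) / (K * t)) := by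
        field_simp; ring
      rw [this]
      have : 0 ≤ K * t * m t + K * ε - I t := by linarith
      positivity
  have hΦ1 := hmono (left_mem_Icc.2 hsR) (right_mem_Icc.2 hsR) hsR
  simp only [hΦ] at hΦ1
  have hsp : 0 < s ^ (1/K) := Real.rpow_pos_of_pos hs _
  have hRp : 0 < R ^ (1/K) := Real.rpow_pos_of_pos hR _
  rw [Real.rpow_neg hs.le, Real.rpow_neg hR.le, ← div_eq_mul_inv, ← div_eq_mul_inv, div_le_div_iff₀ hsp hRp] at hΦ1
  rw [Real.div_rpow hs.le hR.le]
  have : I s - K * ε ≤ (I R - K * ε) * (s ^ (1/K) / R ^ (1/K)) := by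
    rw [← mul_div_assoc, le_div_iff₀ hRp]; exact hΦ1
  have hq : 0 ≤ s ^ (1/K) / R ^ (1/K) := by positivity
  nlinarith [mul_nonneg (mul_nonneg hK0.le hε0) hq]


theorem div_zero0 {f : E2 → ℝ} (hf : Sm f) {x : E2} {R : ℝ} (hR : 0 ≤ R)
    (h0 : ∀ y ∈ sphere x R, f y = 0) (i : Fin 2) : ∫ y in ball x R, dd i f y = 0 := by
  have hpt : ∀ θ, f (pt x R θ) = 0 := fun θ => h0 _ (by
    rw [mem_sphere, dist_pt, abs_of_nonneg hR])
  fin_cases i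
  · have := jac_int hf (Sm.coord 1) x hR
    simpa [dd_coord, hpt] using this
  · have := jac_int hf (Sm.coord 0) x hR
    simpa [dd_coord, hpt, integral_neg] using this

theorem exists_cutoff {r R : ℝ} (hr : 0 < r) (hrR : r < R) : ∃ ζ : E2 → ℝ, Sm ζ ∧
    (∀ y, 0 ≤ ζ y) ∧ (∀ y, ζ y ≤ 1) ∧ (∀ y ∈ ball (0:E2) r, ζ y = 1) ∧
    (∀ y ∈ sphere (0:E2) R, ζ y = 0) ∧ ∃ L, 0 ≤ L ∧ ∀ i, ∀ y ∈ ball (0:E2) R, |dd i ζ y| ≤ L := by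
  let b : ContDiffBump (0:E2) := ⟨r, R, hr, hrR⟩
  have hb : Sm b := b.contDiff
  refine ⟨b, hb, fun y => b.nonneg, fun y => b.le_one,
    fun y hy => b.one_of_mem_closedBall (ball_subset_closedBall hy),
    fun y hy => b.zero_of_le_dist (by rw [mem_sphere] at hy; exact hy.ge), ?_⟩
  have hbd : ∀ i : Fin 2, ∃ L, ∀ y ∈ closedBall (0:E2) R, |dd i b y| ≤ L := fun i =>
    (isCompact_closedBall (0:E2) R).exists_bound_of_continuousOn (hb.dd i).continuous.continuousOn
  choose L hL using hbd
  refine ⟨|L 0| + |L 1|, by positivity, fun i y hy => ?_⟩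
  have h1 := hL i y (ball_subset_closedBall hy)
  fin_cases i
  · exact h1.trans (by have := le_abs_self (L 0); have := abs_nonneg (L 1); simp; linarith)
  · exact h1.trans (by have := le_abs_self (L 1); have := abs_nonneg (L 0); simp; linarith)

/-- pointwise algebra for the Caccioppoli estimate -/
theorem young4 {z L η p q A B C D zx zy : ℝ} (_hz0 : 0 ≤ z) (hL : 0 ≤ L) (hη : 0 < η)
    (hx : |zx| ≤ L) (hy : |zy| ≤ L) :
    -(2 * z ^ 3 * (A * zy * q + zx * p * D - B * zx * q - zy * p * C))
      ≤ η * z ^ 4 * (A ^ 2 + B ^ 2 + C ^ 2 + D ^ 2) + 2 * L ^ 2 / η * (z ^ 2 * (p ^ 2 + q ^ 2)) := by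
  have key : ∀ M w m : ℝ, |w| ≤ L → 2 * z ^ 3 * (M * w * m) ≤ η * z ^ 4 * M ^ 2 + L ^ 2 / η * (z ^ 2 * m ^ 2) := by
    intro M w m hw
    have hw2 : w ^ 2 ≤ L ^ 2 := sq_le_sq.2 (by rwa [abs_of_nonneg hL])
    have h1 : w ^ 2 / η * (z ^ 2 * m ^ 2) ≤ L ^ 2 / η * (z ^ 2 * m ^ 2) := by gcongr
    have h2 : η * z ^ 4 * M ^ 2 + w ^ 2 / η * (z ^ 2 * m ^ 2) - 2 * z ^ 3 * (M * w * m)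
      = z ^ 2 * (η * z * M - w * m) ^ 2 / η := by field_simp; ring
    have h3 : 0 ≤ z ^ 2 * (η * z * M - w * m) ^ 2 / η := by positivity
    linarith
  have k1 := key (-A) zy q hy
  have k2 := key (-D) zx p hx
  have k3 := key B zx q hx
  have k4 := key C zy p hy
  have e : 2 * L ^ 2 / η * (z ^ 2 * (p ^ 2 + q ^ 2)) = 2 * (L ^ 2 / η * (z ^ 2 * p ^ 2)) + 2 * (L ^ 2 / η * (z ^ 2 * q ^ 2)) := by ring
  rw [e]
  nlinarith

theorem young5 {z L τ p q v h zx zy : ℝ} (_hz0 : 0 ≤ z) (hL : 0 ≤ L) (hτ : 0 < τ)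
    (hx : |zx| ≤ L) (hy : |zy| ≤ L) :
    -(z ^ 2 * v * (2 * h) + 2 * z * v * (zx * p + zy * q))
      ≤ τ * z ^ 4 * h ^ 2 + (1 / τ + 4 * L ^ 2) * v ^ 2 + 1 / 2 * (z ^ 2 * (p ^ 2 + q ^ 2)) := by
  have hx2 : zx ^ 2 ≤ L ^ 2 := sq_le_sq.2 (by rwa [abs_of_nonneg hL])
  have hy2 : zy ^ 2 ≤ L ^ 2 := sq_le_sq.2 (by rwa [abs_of_nonneg hL])
  have h1 : τ * z ^ 4 * h ^ 2 + 1 / τ * v ^ 2 + z ^ 2 * v * (2 * h) = (τ * z ^ 2 * h + v) ^ 2 / τ := by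
    field_simp; ring
  have h2 : 0 ≤ (τ * z ^ 2 * h + v) ^ 2 / τ := by positivity
  have hv := sq_nonneg v
  nlinarith [sq_nonneg (z * p + 2 * v * zx), sq_nonneg (z * q + 2 * v * zy), mul_le_mul_of_nonneg_right hx2 hv,
    mul_le_mul_of_nonneg_right hy2 hv]

theorem int_lin3 {f g h : E2 → ℝ} (hf : Continuous f) (hg : Continuous g) (hh : Continuous h)
    (a b c : ℝ) (x : E2) (R : ℝ) :
    ∫ y in ball x R, (a * f y + b * g y + c * h y) = a * (∫ y in ball x R, f y) + b * (∫ y in ball x R, g y)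
      + c * (∫ y in ball x R, h y) := by
  rw [integral_add, integral_add, integral_const_mul, integral_const_mul, integral_const_mul]
  all_goals exact int_ball (by fun_prop) _ _

set_option maxHeartbeats 1600000 in
theorem cacc {r R k : ℝ} (hr : 0 < r) (hrR : r < R) (hk0 : 0 ≤ k) (hk : k < 1) :
    ∃ C, 0 < C ∧ ∀ v E : E2 → ℝ, Sm v → Continuous E → (∀ y, 0 ≤ E y) →
      (∀ y ∈ ball (0:E2) R, hh v y ^ 2 ≤ k * QQ v y + E y) →
      (∫ y in ball (0:E2) r, HS v y) ≤ C * ((∫ y in ball (0:E2) R, v y ^ 2) + ∫ y in ball (0:E2) R, E y) ∧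
      (∫ y in ball (0:E2) r, (dd 0 v y ^ 2 + dd 1 v y ^ 2)) ≤
        C * ((∫ y in ball (0:E2) R, v y ^ 2) + ∫ y in ball (0:E2) R, E y) := by
  obtain ⟨ζ, hζ, hζ0, hζ1, hζr, hζR, L, hL0, hL⟩ := exists_cutoff hr hrR
  have h1k : 0 < 1 - k := by linarith
  have hR : 0 ≤ R := by linarith
  set η := (1 - k) / 8 with hη
  have hη0 : 0 < η := by positivity
  set c := 4 * L ^ 2 / η / (1 - k) with hc
  have hc0 : 0 ≤ c := by positivity
  set a := 4 / (1 - k) with ha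
  have ha0 : 0 < a := by positivity
  set τ := 1 / (4 * (c + 1)) with hτ
  have hτ0 : 0 < τ := by positivity
  set b := 2 / τ + 8 * L ^ 2 with hb
  have hb0 : 0 < b := by positivity
  set CW := 2 * a + 1 + 2 * c * b with hCW
  refine ⟨4 * CW + 2 + b, by positivity, fun v E hv hE hE0 h => ?_⟩
  have cζ := hζ.continuous
  have cp := (hv.dd 0).continuous
  have cq := (hv.dd 1).continuous
  have cv := hv.continuous
  have cH := hv.HS.continuous
  have cQ := hv.QQ.continuous
  have ch := hv.hh.continuous
  have cpx := ((hv.dd 0).dd 0).continuous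
  have cpy := ((hv.dd 0).dd 1).continuous
  have cqx := ((hv.dd 1).dd 0).continuous
  have cqy := ((hv.dd 1).dd 1).continuous
  have czx := (hζ.dd 0).continuous
  have czy := (hζ.dd 1).continuous
  have cG : Continuous (fun y => ζ y ^ 2 * (dd 0 v y ^ 2 + dd 1 v y ^ 2)) := by fun_prop
  have cW : Continuous (fun y => ζ y ^ 4 * QQ v y) := by fun_prop
  set G := ∫ y in ball (0:E2) R, ζ y ^ 2 * (dd 0 v y ^ 2 + dd 1 v y ^ 2) with hG
  set W := ∫ y in ball (0:E2) R, ζ y ^ 4 * QQ v y with hW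
  set e := ∫ y in ball (0:E2) R, E y with he
  set V := ∫ y in ball (0:E2) R, v y ^ 2 with hV
  have he0 : 0 ≤ e := nonneg_int hE0 _ _
  have hV0 : 0 ≤ V := nonneg_int (fun y => sq_nonneg _) _ _
  have hW0 : 0 ≤ W := nonneg_int (fun y => by have := QQ_nonneg v y; positivity) _ _
  have hG0 : 0 ≤ G := nonneg_int (fun y => by positivity) _ _
  have hz4 : ∀ y, ζ y ^ 4 ≤ 1 := fun y => pow_le_one₀ (hζ0 y) (hζ1 y)
  -- first estimate
  have hA : W ≤ a * e + c * G := by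
    have hz2 : Sm (fun y => ζ y ^ 2) := hζ.pow 2
    have hj := jac_int (hz2.mul (hv.dd 0)) (hz2.mul (hv.dd 1)) 0 hR
    have rhs : ∀ θ, ζ (pt 0 R θ) = 0 := fun θ => hζR _ (by rw [mem_sphere, dist_pt, abs_of_nonneg hR])
    have hz2d : ∀ i y, dd i (fun y => ζ y ^ 2) y = 2 * ζ y * dd i ζ y := by
      intro i y
      have : (fun y => ζ y ^ 2) = fun y => ζ y * ζ y := by ext; ring
      rw [this, dd_mul hζ hζ]; ring
    simp only [dd_mul hz2 (hv.dd 0), dd_mul hz2 (hv.dd 1), hz2d, rhs] at hj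
    simp only [ne_eq, OfNat.ofNat_ne_zero, not_false_eq_true, zero_pow, zero_mul, intervalIntegral.integral_zero] at hj
    have est : ∫ y in ball (0:E2) R, (-1 : ℝ) * ((ζ y ^ 2 * dd 0 (dd 0 v) y + dd 0 v y * (2 * ζ y * dd 0 ζ y)) *
            (ζ y ^ 2 * dd 1 (dd 1 v) y + dd 1 v y * (2 * ζ y * dd 1 ζ y)) -
          (ζ y ^ 2 * dd 1 (dd 0 v) y + dd 0 v y * (2 * ζ y * dd 1 ζ y)) *
            (ζ y ^ 2 * dd 0 (dd 1 v) y + dd 1 v y * (2 * ζ y * dd 0 ζ y)))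
        ≥ ∫ y in ball (0:E2) R, ((1 - k) / 2 * (ζ y ^ 4 * QQ v y) + (-2) * E y
          + (- (2 * L ^ 2 / η)) * (ζ y ^ 2 * (dd 0 v y ^ 2 + dd 1 v y ^ 2))) := by
      refine mono_int (by fun_prop) (by fun_prop) _ _ (fun y hy => ?_)
      have y4 := young4 (p := dd 0 v y) (q := dd 1 v y) (A := -dd 0 (dd 0 v) y) (B := -dd 1 (dd 0 v) y)
        (C := -dd 0 (dd 1 v) y) (D := -dd 1 (dd 1 v) y) (hζ0 y) hL0 hη0 (hL 0 y hy) (hL 1 y hy)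
      have hd := det_eq hv y
      have hHS := HS_eq hv y
      have hy1 := h y hy
      have hQ := QQ_nonneg v y
      have hz := hz4 y
      have hz0 : 0 ≤ ζ y ^ 4 := by have := hζ0 y; positivity
      have hH2 : HS v y ≤ 4 * QQ v y + 2 * E y := by
        simp only [HS]; linarith [hE0 y, mul_le_of_le_one_left (QQ_nonneg v y) hk.le]
      have m1 : ζ y ^ 4 * ((1 - k) * QQ v y - E y) ≤ ζ y ^ 4 * (QQ v y - hh v y ^ 2) :=
        mul_le_mul_of_nonneg_left (by linarith) hz0
      have m2 : η * ζ y ^ 4 * HS v y ≤ η * ζ y ^ 4 * (4 * QQ v y + 2 * E y) :=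
        mul_le_mul_of_nonneg_left hH2 (by positivity)
      have m3 : ζ y ^ 4 * E y ≤ E y := mul_le_of_le_one_left (hE0 y) hz
      have m4 : η * (ζ y ^ 4 * E y) ≤ 1 / 4 * E y := by
        have : η ≤ 1 / 4 := by rw [hη]; linarith
        have h0 : 0 ≤ ζ y ^ 4 * E y := mul_nonneg hz0 (hE0 y)
        calc η * (ζ y ^ 4 * E y) ≤ 1 / 4 * (ζ y ^ 4 * E y) := by gcongr
          _ ≤ _ := by linarith
      have m5 : 4 * η * (ζ y ^ 4 * QQ v y) = (1 - k) / 2 * (ζ y ^ 4 * QQ v y) := by rw [hη]; ring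
      have y4' : 2 * ζ y ^ 3 * (dd 0 (dd 0 v) y * dd 1 ζ y * dd 1 v y + dd 0 ζ y * dd 0 v y * dd 1 (dd 1 v) y
           - dd 1 (dd 0 v) y * dd 0 ζ y * dd 1 v y - dd 1 ζ y * dd 0 v y * dd 0 (dd 1 v) y)
           ≤ η * ζ y ^ 4 * HS v y + 2 * L ^ 2 / η * (ζ y ^ 2 * (dd 0 v y ^ 2 + dd 1 v y ^ 2)) := by
        rw [hHS]
        refine le_trans (le_of_eq ?_) (le_trans y4 (le_of_eq ?_)) <;> ring
      have expand : (-1 : ℝ) * ((ζ y ^ 2 * dd 0 (dd 0 v) y + dd 0 v y * (2 * ζ y * dd 0 ζ y)) *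
            (ζ y ^ 2 * dd 1 (dd 1 v) y + dd 1 v y * (2 * ζ y * dd 1 ζ y)) -
          (ζ y ^ 2 * dd 1 (dd 0 v) y + dd 0 v y * (2 * ζ y * dd 1 ζ y)) *
            (ζ y ^ 2 * dd 0 (dd 1 v) y + dd 1 v y * (2 * ζ y * dd 0 ζ y)))
          = ζ y ^ 4 * (QQ v y - hh v y ^ 2) - 2 * ζ y ^ 3 * (dd 0 (dd 0 v) y * dd 1 ζ y * dd 1 v y + dd 0 ζ y * dd 0 v y * dd 1 (dd 1 v) y
           - dd 1 (dd 0 v) y * dd 0 ζ y * dd 1 v y - dd 1 ζ y * dd 0 v y * dd 0 (dd 1 v) y) := by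
        linear_combination (- ζ y ^ 4) * hd
      rw [expand]
      linarith [hE0 y]
    rw [integral_const_mul, hj, int_lin3 cW hE cG] at est
    have est2 : (1 - k) / 2 * W ≤ 2 * e + 2 * L ^ 2 / η * G := by linarith
    have : W = (2 / (1 - k)) * ((1 - k) / 2 * W) := by field_simp
    rw [this]
    calc _ ≤ (2 / (1 - k)) * (2 * e + 2 * L ^ 2 / η * G) := by gcongr
      _ = a * e + c * G := by rw [ha, hc]; ring
  -- second estimate
  have hB : G ≤ 2 * τ * (W + e) + b * V := by
    have hz2 : Sm (fun y => ζ y ^ 2) := hζ.pow 2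
    have hz2d : ∀ i y, dd i (fun y => ζ y ^ 2) y = 2 * ζ y * dd i ζ y := by
      intro i y
      have : (fun y => ζ y ^ 2) = fun y => ζ y * ζ y := by ext; ring
      rw [this, dd_mul hζ hζ]; ring
    have hf : ∀ i, Sm (fun y => ζ y ^ 2 * v y * dd i v y) := fun i => (hz2.mul hv).mul (hv.dd i)
    have hfd : ∀ i, dd i (fun y => ζ y ^ 2 * v y * dd i v y) = fun y =>
        ζ y ^ 2 * v y * dd i (dd i v) y + dd i v y * (ζ y ^ 2 * dd i v y + v y * (2 * ζ y * dd i ζ y)) := by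
      intro i
      rw [dd_mul (hz2.mul hv) (hv.dd i), dd_mul hz2 hv]
      simp only [hz2d]
    have hi : ∀ i, ∫ y in ball (0:E2) R, (ζ y ^ 2 * v y * dd i (dd i v) y + dd i v y * (ζ y ^ 2 * dd i v y + v y * (2 * ζ y * dd i ζ y))) = 0 := by
      intro i
      have := div_zero0 (hf i) (x := 0) hR (fun y hy => by simp [hζR y hy]) i
      rwa [hfd i] at this
    have hsum := congrArg₂ (· + ·) (hi 0) (hi 1)
    rw [← integral_add (int_ball (by fun_prop) _ _) (int_ball (by fun_prop) _ _), add_zero] at hsum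
    have est : ∫ y in ball (0:E2) R, (ζ y ^ 2 * (dd 0 v y ^ 2 + dd 1 v y ^ 2)) ≤
        ∫ y in ball (0:E2) R, (1 * ((ζ y ^ 2 * v y * dd 0 (dd 0 v) y + dd 0 v y * (ζ y ^ 2 * dd 0 v y + v y * (2 * ζ y * dd 0 ζ y)))
         + (ζ y ^ 2 * v y * dd 1 (dd 1 v) y + dd 1 v y * (ζ y ^ 2 * dd 1 v y + v y * (2 * ζ y * dd 1 ζ y))))
         + 1 * (τ * (ζ y ^ 4 * QQ v y) + τ * E y + (1 / τ + 4 * L ^ 2) * v y ^ 2) + 1 / 2 * (ζ y ^ 2 * (dd 0 v y ^ 2 + dd 1 v y ^ 2))) := by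
      refine mono_int (by fun_prop) (by fun_prop) _ _ (fun y hy => ?_)
      have y5 := young5 (p := dd 0 v y) (q := dd 1 v y) (v := v y) (h := hh v y) (hζ0 y) hL0 hτ0 (hL 0 y hy) (hL 1 y hy)
      have hhd : 2 * hh v y = dd 0 (dd 0 v) y + dd 1 (dd 1 v) y := by simp only [hh]; ring
      have hy1 := h y hy
      have hQ := QQ_nonneg v y
      have hz := hz4 y
      have hz0 : 0 ≤ ζ y ^ 4 := by have := hζ0 y; positivity
      have hh1 : hh v y ^ 2 ≤ QQ v y + E y := by linarith [mul_le_of_le_one_left (QQ_nonneg v y) hk.le]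
      have m1 : τ * ζ y ^ 4 * hh v y ^ 2 ≤ τ * ζ y ^ 4 * (QQ v y + E y) :=
        mul_le_mul_of_nonneg_left hh1 (by positivity)
      have m3 : τ * (ζ y ^ 4 * E y) ≤ τ * E y :=
        mul_le_mul_of_nonneg_left (mul_le_of_le_one_left (hE0 y) hz) hτ0.le
      rw [hhd] at y5
      linarith
    rw [int_lin3 (by fun_prop) (by fun_prop) (by fun_prop), hsum, int_lin3 cW hE (by fun_prop)] at est
    have : G ≤ τ * W + τ * e + (1 / τ + 4 * L ^ 2) * V + 1 / 2 * G := by linarith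
    have hb' : b = 2 * (1 / τ + 4 * L ^ 2) := by rw [hb]; ring
    rw [hb']; linarith
  have hτc : 2 * τ * c ≤ 1 / 2 := by
    rw [hτ]; rw [show 2 * (1 / (4 * (c + 1))) * c = c / (2 * (c + 1)) by field_simp; ring,
      div_le_iff₀ (by positivity)]; linarith
  have hτ1 : 2 * τ ≤ 1 / 2 := by
    rw [hτ]; rw [show 2 * (1 / (4 * (c + 1))) = 1 / (2 * (c + 1)) by field_simp; ring,
      div_le_iff₀ (by positivity)]; linarith
  have hWb : W ≤ CW * (V + e) := by
    have h1 : c * G ≤ c * (2 * τ * (W + e) + b * V) := mul_le_mul_of_nonneg_left hB hc0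
    have h2 : (2 * τ * c) * (W + e) ≤ 1 / 2 * (W + e) := mul_le_mul_of_nonneg_right hτc (by positivity)
    have h3 : W ≤ (2 * a + 1) * e + 2 * c * b * V := by nlinarith
    have h4 : 0 ≤ 2 * c * b * e := by positivity
    have h5 : 0 ≤ (2 * a + 1) * V := by positivity
    rw [hCW]; nlinarith
  have hGb : G ≤ (CW + 1 + b) * (V + e) := by
    have h2 : (2 * τ) * (W + e) ≤ 1 / 2 * (W + e) := mul_le_mul_of_nonneg_right hτ1 (by positivity)
    have h4 : 0 ≤ b * e := by positivity
    nlinarith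
  have hCW0 : 0 < CW := by positivity
  have hVe : 0 ≤ V + e := by positivity
  have sub : ball (0:E2) r ⊆ ball (0:E2) R := ball_subset_ball hrR.le
  constructor
  · have h1 : ∫ y in ball (0:E2) r, HS v y ≤ ∫ y in ball (0:E2) r, (4 * (ζ y ^ 4 * QQ v y) + 2 * E y) := by
      refine mono_int (by fun_prop) (by fun_prop) _ _ (fun y hy => ?_)
      rw [hζr y hy]
      have := h y (sub hy)
      have := QQ_nonneg v y
      simp only [HS]; linarith [hE0 y, mul_le_of_le_one_left (QQ_nonneg v y) hk.le]
    have h2 : ∫ y in ball (0:E2) r, (4 * (ζ y ^ 4 * QQ v y) + 2 * E y) ≤ ∫ y in ball (0:E2) R, (4 * (ζ y ^ 4 * QQ v y) + 2 * E y) :=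
      mono_ball (by fun_prop) (fun y => by have := QQ_nonneg v y; have := hE0 y; positivity) sub
    have h3 : ∫ y in ball (0:E2) R, (4 * (ζ y ^ 4 * QQ v y) + 2 * E y) = 4 * W + 2 * e := by
      rw [integral_add (int_ball (by fun_prop) _ _) (int_ball (by fun_prop) _ _), integral_const_mul, integral_const_mul]
    rw [h3] at h2
    have : 0 ≤ b * (V + e) := by positivity
    nlinarith
  · have h1 : ∫ y in ball (0:E2) r, (dd 0 v y ^ 2 + dd 1 v y ^ 2) ≤ ∫ y in ball (0:E2) r, ζ y ^ 2 * (dd 0 v y ^ 2 + dd 1 v y ^ 2) := by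
      refine mono_int (by fun_prop) (by fun_prop) _ _ (fun y hy => ?_)
      rw [hζr y hy]; linarith
    have h2 : ∫ y in ball (0:E2) r, ζ y ^ 2 * (dd 0 v y ^ 2 + dd 1 v y ^ 2) ≤ G :=
      mono_ball cG (fun y => by positivity) sub
    have : 0 ≤ (3 * CW + 1) * (V + e) := by positivity
    nlinarith


/-- structure function: `H` is Lipschitz with squared constant `k` -/
def LipH (k : ℝ) (H : ℝ → ℝ → ℝ) : Prop :=
  H 0 0 = 0 ∧ ∀ a b a' b', (H a b - H a' b') ^ 2 ≤ k * ((a - a') ^ 2 + (b - b') ^ 2)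

theorem LipH.continuous {k : ℝ} {H : ℝ → ℝ → ℝ} (h : LipH k H) (hk : k < 1) :
    Continuous (fun p : ℝ × ℝ => H p.1 p.2) := by
  have : LipschitzWith 2 (fun p : ℝ × ℝ => H p.1 p.2) := by
    refine LipschitzWith.of_dist_le_mul fun p q => ?_
    have h1 := h.2 p.1 p.2 q.1 q.2
    rw [Prod.dist_eq, Real.dist_eq, Real.dist_eq, Real.dist_eq]
    set m := max |p.1 - q.1| |p.2 - q.2|
    have h2 : |p.1 - q.1| ≤ m := le_max_left _ _
    have h3 : |p.2 - q.2| ≤ m := le_max_right _ _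
    have h4 : (p.1 - q.1) ^ 2 ≤ m ^ 2 := by rw [← sq_abs]; gcongr
    have h5 : (p.2 - q.2) ^ 2 ≤ m ^ 2 := by rw [← sq_abs (p.2 - q.2)]; gcongr
    have hm : 0 ≤ m := (abs_nonneg _).trans h2
    refine abs_le_of_sq_le_sq ?_ (by simpa using hm)
    simp only [NNReal.coe_ofNat]
    have : k * ((p.1 - q.1) ^ 2 + (p.2 - q.2) ^ 2) ≤ (p.1 - q.1) ^ 2 + (p.2 - q.2) ^ 2 :=
      mul_le_of_le_one_left (by positivity) hk.le
    nlinarith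
  exact this.continuous

def res (H : ℝ → ℝ → ℝ) (u : E2 → ℝ) (x : E2) : ℝ := hh u x - H (aa u x) (bb u x)

theorem cont_res {k : ℝ} {H : ℝ → ℝ → ℝ} (h : LipH k H) (hk : k < 1) {u : E2 → ℝ} (hu : Sm u) :
    Continuous (res H u) :=
  hu.hh.continuous.sub ((h.continuous hk).comp (hu.aa.continuous.prodMk hu.bb.continuous))

theorem lip_alg {k : ℝ} {H : ℝ → ℝ → ℝ} (hH : LipH k H) (hk0 : 0 ≤ k) (hk : k < 1) (h a b h' a' b' : ℝ) :
    (h - h') ^ 2 ≤ (1 + k) / 2 * ((a - a') ^ 2 + (b - b') ^ 2)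
      + 6 / (1 - k) * ((h - H a b) ^ 2 + (h' - H a' b') ^ 2) := by
  have h1k : 0 < 1 - k := by linarith
  have hL := hH.2 a b a' b'
  set Q := (a - a') ^ 2 + (b - b') ^ 2 with hQ
  have hQ0 : 0 ≤ Q := by positivity
  set X := H a b - H a' b' with hX
  set p := h - H a b with hp
  set q := h' - H a' b' with hq
  have e : h - h' = X + (p - q) := by rw [hX, hp, hq]; ring
  rw [e]
  set δ := (1 - k) / 2 with hδ
  have hδ0 : 0 < δ := by positivity
  have h1 : (X + (p - q)) ^ 2 ≤ (1 + δ) * X ^ 2 + (1 + 1 / δ) * (p - q) ^ 2 := by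
    have : (1 + δ) * X ^ 2 + (1 + 1 / δ) * (p - q) ^ 2 - (X + (p - q)) ^ 2 = (δ * X - (p - q)) ^ 2 / δ := by
      field_simp; ring
    have h0 : 0 ≤ (δ * X - (p - q)) ^ 2 / δ := by positivity
    linarith
  have h2 : (1 + δ) * X ^ 2 ≤ (1 + k) / 2 * Q := by
    calc (1 + δ) * X ^ 2 ≤ (1 + δ) * (k * Q) := by gcongr
      _ = ((1 + δ) * k) * Q := by ring
      _ ≤ (1 + k) / 2 * Q := by
        refine mul_le_mul_of_nonneg_right ?_ hQ0
        rw [hδ]; nlinarith [sq_nonneg (1 - k)]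
  have h3 : (1 + 1 / δ) * (p - q) ^ 2 ≤ 6 / (1 - k) * (p ^ 2 + q ^ 2) := by
    have e2 : 1 + 1 / δ ≤ 3 / (1 - k) := by
      rw [hδ, le_div_iff₀ h1k]
      have : (1 + 1 / ((1 - k) / 2)) * (1 - k) = (1 - k) + 2 := by field_simp
      rw [this]; linarith
    calc _ ≤ 3 / (1 - k) * (p - q) ^ 2 := by gcongr
      _ ≤ 3 / (1 - k) * (2 * (p ^ 2 + q ^ 2)) := by
        gcongr; nlinarith [sq_nonneg (p + q)]
      _ = _ := by ring
  linarith

theorem hh_sub {u v : E2 → ℝ} (hu : Sm u) (hv : Sm v) (x : E2) : hh (fun y => u y - v y) x = hh u x - hh v x := by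
  simp only [hh, dd_sub hu hv, dd_sub (hu.dd 0) (hv.dd 0), dd_sub (hu.dd 1) (hv.dd 1)]; ring
theorem aa_sub {u v : E2 → ℝ} (hu : Sm u) (hv : Sm v) (x : E2) : aa (fun y => u y - v y) x = aa u x - aa v x := by
  simp only [aa, dd_sub hu hv, dd_sub (hu.dd 0) (hv.dd 0), dd_sub (hu.dd 1) (hv.dd 1)]; ring
theorem bb_sub {u v : E2 → ℝ} (hu : Sm u) (hv : Sm v) (x : E2) : bb (fun y => u y - v y) x = bb u x - bb v x := by
  simp only [bb, dd_sub hu hv, dd_sub (hu.dd 1) (hv.dd 1)]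
theorem hh_shift (u : E2 → ℝ) (h x : E2) : hh (fun y => u (y + h)) x = hh u (x + h) := by
  simp only [hh, dd_shift]
theorem aa_shift (u : E2 → ℝ) (h x : E2) : aa (fun y => u (y + h)) x = aa u (x + h) := by
  simp only [aa, dd_shift]
theorem bb_shift (u : E2 → ℝ) (h x : E2) : bb (fun y => u (y + h)) x = bb u (x + h) := by
  simp only [bb, dd_shift]
theorem res_shift (H : ℝ → ℝ → ℝ) (u : E2 → ℝ) (h x : E2) : res H (fun y => u (y + h)) x = res H u (x + h) := by
  simp only [res, hh_shift, aa_shift, bb_shift]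
theorem res_zero {k : ℝ} {H : ℝ → ℝ → ℝ} (hH : LipH k H) (x : E2) : res H (fun _ => 0) x = 0 := by
  simp [res, hh, aa, bb, dd_const, hH.1]

/-- the error function -/
def EE (k : ℝ) (H : ℝ → ℝ → ℝ) (u v : E2 → ℝ) (y : E2) : ℝ := 6 / (1 - k) * (res H u y ^ 2 + res H v y ^ 2)

theorem diff_ineq {k : ℝ} {H : ℝ → ℝ → ℝ} (hH : LipH k H) (hk0 : 0 ≤ k) (hk : k < 1) {u v : E2 → ℝ}
    (hu : Sm u) (hv : Sm v) (y : E2) :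
    hh (fun y => u y - v y) y ^ 2 ≤ (1 + k) / 2 * QQ (fun y => u y - v y) y + EE k H u v y := by
  simp only [QQ, hh_sub hu hv, aa_sub hu hv, bb_sub hu hv]
  exact lip_alg hH hk0 hk _ _ _ _ _ _

theorem EE_nonneg {k : ℝ} (hk : k < 1) (H : ℝ → ℝ → ℝ) (u v : E2 → ℝ) (y : E2) : 0 ≤ EE k H u v y := by
  have h1k : 0 < 1 - k := by linarith
  unfold EE; positivity

theorem cont_EE {k : ℝ} {H : ℝ → ℝ → ℝ} (h : LipH k H) (hk : k < 1) {u v : E2 → ℝ} (hu : Sm u) (hv : Sm v) :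
    Continuous (EE k H u v) := by
  have := cont_res h hk hu
  have := cont_res h hk hv
  unfold EE; fun_prop

theorem int_EE {k : ℝ} {H : ℝ → ℝ → ℝ} (h : LipH k H) (hk : k < 1) {u v : E2 → ℝ} (hu : Sm u) (hv : Sm v)
    (x : E2) (R : ℝ) : ∫ y in ball x R, EE k H u v y =
      6 / (1 - k) * ((∫ y in ball x R, res H u y ^ 2) + ∫ y in ball x R, res H v y ^ 2) := by
  have := cont_res h hk hu
  have := cont_res h hk hv
  unfold EE
  rw [integral_const_mul, integral_add]
  all_goals exact int_ball (by fun_prop) _ _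

theorem int_shift (f : E2 → ℝ) (x h : E2) (R : ℝ) :
    ∫ y in ball x R, f (y + h) = ∫ y in ball (x + h) R, f y := by
  rw [← integral_indicator measurableSet_ball, ← integral_indicator measurableSet_ball]
  rw [← integral_add_right_eq_self ((ball (x + h) R).indicator f) h]
  congr 1; ext y
  simp only [indicator, mem_ball, dist_add_right]

theorem cont_ball_int {X : Type*} [TopologicalSpace X] [FirstCountableTopology X] [LocallyCompactSpace X]
    {g : X → E2 → ℝ}
    (hg : Continuous (fun p : X × E2 => g p.1 p.2)) (c : E2) {R : ℝ} (hR : 0 < R) :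
    Continuous (fun x => ∫ y in ball c R, g x y) := by
  have h1 := continuous_parametric_integral_of_continuous (μ := (volume : Measure E2)) (f := g) hg (isCompact_closedBall c R)
  have h2 : ∀ x, ∫ y in closedBall c R, g x y = ∫ y in ball c R, g x y := by
    intro x
    refine setIntegral_congr_set ?_
    refine (ae_eq_of_subset_of_measure_ge ball_subset_closedBall ?_ measurableSet_ball.nullMeasurableSet measure_closedBall_lt_top.ne).symm
    exact (Measure.addHaar_closedBall_eq_addHaar_ball (volume : Measure E2) c R).le
  simpa only [h2] using h1

theorem fub_ball {g : E2 → ℝ → ℝ} (hg : Continuous (fun p : E2 × ℝ => g p.1 p.2)) (x : E2) (R : ℝ) {a b : ℝ} (hab : a ≤ b) :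
    ∫ y in ball x R, ∫ t in a..b, g y t = ∫ t in a..b, ∫ y in ball x R, g y t := by
  simp only [intervalIntegral.integral_of_le hab]
  refine integral_integral_swap ?_
  rw [Measure.prod_restrict, ← Measure.volume_eq_prod]
  exact (hg.continuousOn.integrableOn_compact ((isCompact_closedBall x R).prod isCompact_Icc)).mono_set
      (Set.prod_mono ball_subset_closedBall Ioc_subset_Icc_self)

theorem fub_ball2 {g : E2 → E2 → ℝ} (hg : Continuous (fun p : E2 × E2 => g p.1 p.2)) (x x' : E2) (R R' : ℝ) :
    ∫ y in ball x R, ∫ z in ball x' R', g y z = ∫ z in ball x' R', ∫ y in ball x R, g y z := by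
  refine integral_integral_swap ?_
  rw [Measure.prod_restrict, ← Measure.volume_eq_prod]
  exact (hg.continuousOn.integrableOn_compact ((isCompact_closedBall x R).prod (isCompact_closedBall x' R'))).mono_set
      (Set.prod_mono ball_subset_closedBall ball_subset_closedBall)

theorem norm_sq_E2 (h : E2) : ‖h‖ ^ 2 = h 0 ^ 2 + h 1 ^ 2 := by
  rw [EuclideanSpace.norm_eq, Real.sq_sqrt (by positivity)]; simp [Fin.sum_univ_two]

theorem transl {u : E2 → ℝ} (hu : Sm u) (h : E2) {r R : ℝ} (hr : 0 < r) (hR : r + ‖h‖ ≤ R) :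
    ∫ y in ball (0:E2) r, (u (y + h) - u y) ^ 2 ≤ ‖h‖ ^ 2 * ∫ y in ball (0:E2) R, (dd 0 u y ^ 2 + dd 1 u y ^ 2) := by
  set g : E2 → ℝ := fun y => dd 0 u y ^ 2 + dd 1 u y ^ 2 with hg
  have c0 := (hu.dd 0).continuous
  have c1 := (hu.dd 1).continuous
  have cu := hu.continuous
  have cg : Continuous g := by fun_prop
  have cgt : Continuous (fun p : E2 × ℝ => g (p.1 + p.2 • h)) := by fun_prop
  have pw : ∀ y, (u (y + h) - u y) ^ 2 ≤ ∫ t in (0:ℝ)..1, ‖h‖ ^ 2 * g (y + t • h) := by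
    intro y
    have hd : ∀ t : ℝ, HasDerivAt (fun t : ℝ => u (y + t • h)) (h 0 * dd 0 u (y + t • h) + h 1 * dd 1 u (y + t • h)) t := by
      intro t
      have h1 : HasDerivAt (fun t : ℝ => y + t • h) h t := by
        simpa using ((hasDerivAt_id t).smul_const h).const_add y
      have h2 := (hu.differentiable (y + t • h)).hasFDerivAt.comp_hasDerivAt t h1
      rw [dd_eval] at h2
      exact h2
    have cd : Continuous (fun t : ℝ => h 0 * dd 0 u (y + t • h) + h 1 * dd 1 u (y + t • h)) := by fun_prop
    have ftc := intervalIntegral.integral_eq_sub_of_hasDerivAt (a := 0) (b := 1) (fun t _ => hd t) (ii_cont cd _ _)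
    simp only [one_smul, zero_smul, add_zero] at ftc
    rw [← ftc]
    refine (cs_interval cd zero_le_one).trans ?_
    rw [sub_zero, one_mul]
    refine intervalIntegral.integral_mono_on zero_le_one (ii_cont (by fun_prop) _ _) (ii_cont (by fun_prop) _ _) (fun t _ => ?_)
    rw [norm_sq_E2]; simp only [hg]
    nlinarith [sq_nonneg (h 0 * dd 1 u (y + t • h) - h 1 * dd 0 u (y + t • h))]
  have cI : Continuous (fun y => ∫ t in (0:ℝ)..1, ‖h‖ ^ 2 * g (y + t • h)) :=
    intervalIntegral.continuous_parametric_intervalIntegral_of_continuous' (by fun_prop) 0 1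
  calc _ ≤ ∫ y in ball (0:E2) r, ∫ t in (0:ℝ)..1, ‖h‖ ^ 2 * g (y + t • h) :=
        mono_int (by fun_prop) cI _ _ (fun y _ => pw y)
    _ = ∫ t in (0:ℝ)..1, ∫ y in ball (0:E2) r, ‖h‖ ^ 2 * g (y + t • h) :=
        fub_ball (g := fun y t => ‖h‖ ^ 2 * g (y + t • h)) (by fun_prop) _ _ zero_le_one
    _ ≤ ∫ t in (0:ℝ)..1, ‖h‖ ^ 2 * ∫ y in ball (0:E2) R, g y := by
        refine intervalIntegral.integral_mono_on zero_le_one ?_ (ii_cont (by fun_prop) _ _) (fun t ht => ?_)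
        · exact ii_cont (cont_ball_int (g := fun (t:ℝ) y => ‖h‖ ^ 2 * g (y + t • h)) (by fun_prop) _ hr) _ _
        · rw [integral_const_mul, int_shift]
          refine mul_le_mul_of_nonneg_left (mono_ball cg (fun y => by positivity) ?_) (sq_nonneg _)
          refine ball_subset_ball' ?_
          rw [dist_zero_right, zero_add, norm_smul, Real.norm_of_nonneg ht.1]
          nlinarith [ht.2, norm_nonneg h]
    _ = _ := by simp


/-- decay exponent -/
def bet (k : ℝ) : ℝ := (1 - (1 + k) / 2) / (4 * π)

theorem bet_pos {k : ℝ} (hk : k < 1) : 0 < bet k := by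
  unfold bet
  have := pi_pos
  have : 0 < 1 - (1 + k) / 2 := by linarith
  positivity

theorem bet_lt {k : ℝ} (hk0 : 0 ≤ k) : bet k < 1 := by
  unfold bet
  have := pi_gt_three
  rw [div_lt_one (by positivity)]; linarith

theorem subs_ball {x : E2} {r s R : ℝ} (hx : x ∈ closedBall (0:E2) r) (h : r + s ≤ R) : ball x s ⊆ ball 0 R := by
  refine ball_subset_ball' ?_
  rw [mem_closedBall] at hx; linarith

theorem shift_int {f : E2 → ℝ} (hf : Continuous f) (h0 : ∀ y, 0 ≤ f y) {h : E2} {ρ : ℝ} (hh : ρ + ‖h‖ ≤ 1) :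
    ∫ y in ball (0:E2) ρ, f (y + h) ≤ ∫ y in ball (0:E2) 1, f y := by
  rw [int_shift]
  refine mono_ball hf h0 (ball_subset_ball' ?_)
  rw [zero_add, dist_zero_right]; exact hh

set_option maxHeartbeats 1000000 in
theorem camp1 {r k : ℝ} (hr : 0 < r) (hr1 : r < 1) (hk0 : 0 ≤ k) (hk : k < 1) :
    ∃ C, 0 < C ∧ ∀ (H : ℝ → ℝ → ℝ) (u : E2 → ℝ) (x : E2) (s : ℝ) (h : E2), LipH k H → Sm u →
      x ∈ closedBall (0:E2) r → 0 < s → s ≤ (1 - r) / 16 → ‖h‖ ≤ 2 * s →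
      ∫ y in ball x s, HS (fun y => u (y + h) - u y) y ≤
        C * (s ^ 2 * s ^ bet k * (∫ y in ball (0:E2) 1, u y ^ 2) + ∫ y in ball (0:E2) 1, res H u y ^ 2) := by
  set d := (1 - r) / 16 with hd
  have hd0 : 0 < d := by rw [hd]; linarith
  have hd1 : r + 16 * d = 1 := by rw [hd]; ring
  have h1k : 0 < 1 - k := by linarith
  have hk1 : (1 + k) / 2 < 1 := by linarith
  have hk10 : 0 ≤ (1 + k) / 2 := by linarith
  have hp := pi_pos
  obtain ⟨C1, hC1, c1⟩ := cacc (r := r + 6 * d) (R := 1) (by linarith) (by linarith) hk10 hk1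
  obtain ⟨C2, hC2, c2⟩ := cacc (r := r + 2 * d) (R := r + 4 * d) (by linarith) (by linarith) hk10 hk1
  set c := 6 / (1 - k) with hc
  have hc0 : 0 < c := by positivity
  set D := 4 * π / (1 - (1 + k) / 2) with hD
  have hD0 : 0 < D := by
    have : 0 < 1 - (1 + k) / 2 := by linarith
    positivity
  have hdb : 0 < d ^ bet k := rpow_pos_of_pos hd0 _
  set K1 := 4 * C1 * C2 / d ^ bet k with hK1
  set K2 := C2 * (4 * C1 * c + 2 * c) + D * (2 * c) with hK2
  have hK10 : 0 < K1 := by positivity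
  have hK20 : 0 < K2 := by positivity
  refine ⟨K1 + K2, by positivity, ?_⟩
  intro H u x s h hH hu hx hs hsd hhs
  have cr := cont_res hH hk hu
  have cu := hu.continuous
  set U := ∫ y in ball (0:E2) 1, u y ^ 2 with hU
  set W := ∫ y in ball (0:E2) 1, res H u y ^ 2 with hW
  have hU0 : 0 ≤ U := nonneg_int (fun y => sq_nonneg _) _ _
  have hW0 : 0 ≤ W := nonneg_int (fun y => sq_nonneg _) _ _
  -- step 1
  have hu' : Sm (fun y => u (y + h)) := hu.shift h
  have hz : Sm (fun _ : E2 => (0:ℝ)) := Sm.const 0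
  have s1 := (c1 (fun y => u y - 0) (EE k H u (fun _ => 0)) (hu.sub hz) (cont_EE hH hk hu hz) (EE_nonneg hk _ _ _)
    (fun y _ => diff_ineq hH hk0 hk hu hz y)).2
  rw [int_EE hH hk hu hz] at s1
  simp only [sub_zero, res_zero hH, ne_eq, OfNat.ofNat_ne_zero, not_false_eq_true, zero_pow, integral_zero, add_zero] at s1
  rw [← hU, ← hW, ← hc] at s1
  -- step 2
  have s2 := transl hu h (r := r + 4 * d) (R := r + 6 * d) (by linarith) (by linarith)
  -- step 3
  have hv : Sm (fun y => u (y + h) - u y) := hu'.sub hu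
  have s3 := (c2 (fun y => u (y + h) - u y) (EE k H (fun y => u (y + h)) u) hv (cont_EE hH hk hu' hu) (EE_nonneg hk _ _ _)
    (fun y _ => diff_ineq hH hk0 hk hu' hu y)).1
  have eb : ∀ ρ ≤ r + 4 * d, ∫ y in ball (0:E2) ρ, EE k H (fun y => u (y + h)) u y ≤ 2 * c * W := by
    intro ρ hρ
    rw [int_EE hH hk hu' hu]
    simp only [res_shift]
    have a1 := shift_int (f := fun y => res H u y ^ 2) (h := h) (ρ := ρ) (by fun_prop) (fun y => sq_nonneg _) (by linarith)
    have a2 : ∫ y in ball (0:E2) ρ, res H u y ^ 2 ≤ W :=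
      mono_ball (by fun_prop) (fun y => sq_nonneg _) (ball_subset_ball (by linarith))
    have : c * ((∫ y in ball (0:E2) ρ, res H u (y + h) ^ 2) + ∫ y in ball (0:E2) ρ, res H u y ^ 2) ≤ c * (W + W) :=
      mul_le_mul_of_nonneg_left (add_le_add a1 a2) hc0.le
    linarith
  -- step 4
  have s4 := decay hv (cont_EE hH hk hu' hu) (EE_nonneg hk H (fun y => u (y + h)) u) hk10 hk1 x hs hsd
    (fun y _ => diff_ineq hH hk0 hk hu' hu y)
  have e4 : ∫ y in ball x d, EE k H (fun y => u (y + h)) u y ≤ 2 * c * W :=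
    (mono_ball (cont_EE hH hk hu' hu) (EE_nonneg hk _ _ _) (subs_ball hx (R := r + 4 * d) (by linarith))).trans (eb _ le_rfl)
  have f4 : ∫ y in ball x d, HS (fun y => u (y + h) - u y) y ≤ ∫ y in ball (0:E2) (r + 2 * d), HS (fun y => u (y + h) - u y) y :=
    mono_ball hv.HS.continuous (HS_nonneg _) (subs_ball hx (by linarith))
  have e3 := eb _ le_rfl
  have hh2 : ‖h‖ ^ 2 ≤ 4 * s ^ 2 := by nlinarith [norm_nonneg h]
  have hs1 : s ^ 2 ≤ 1 := by nlinarith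
  have g2 : ∫ y in ball (0:E2) (r + 4 * d), (u (y + h) - u y) ^ 2 ≤ 4 * s ^ 2 * (C1 * (U + c * W)) :=
    s2.trans (mul_le_mul hh2 s1 (nonneg_int (fun y => by positivity) _ _) (by positivity))
  have g3 : ∫ y in ball x d, HS (fun y => u (y + h) - u y) y ≤ C2 * (4 * s ^ 2 * (C1 * (U + c * W)) + 2 * c * W) :=
    f4.trans (s3.trans (mul_le_mul_of_nonneg_left (add_le_add g2 e3) hC2.le))
  change _ ≤ (s / d) ^ bet k * _ + D * _ at s4
  set q := (s / d) ^ bet k with hq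
  have hq0 : 0 ≤ q := rpow_nonneg (by positivity) _
  have hq1 : q ≤ 1 := rpow_le_one (by positivity) ((div_le_one hd0).2 hsd) (bet_pos hk).le
  have hqe : q = s ^ bet k / d ^ bet k := div_rpow hs.le hd0.le _
  have g4 : q * (∫ y in ball x d, HS (fun y => u (y + h) - u y) y) ≤ K1 * (s ^ 2 * s ^ bet k * U) + C2 * (4 * C1 * c + 2 * c) * W := by
    calc _ ≤ q * (C2 * (4 * s ^ 2 * (C1 * (U + c * W)) + 2 * c * W)) := mul_le_mul_of_nonneg_left g3 hq0
      _ = q * (4 * C1 * C2 * s ^ 2 * U) + q * s ^ 2 * (C2 * (4 * C1 * c) * W) + q * (C2 * (2 * c) * W) := by ring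
      _ ≤ K1 * (s ^ 2 * s ^ bet k * U) + 1 * (C2 * (4 * C1 * c) * W) + 1 * (C2 * (2 * c) * W) := by
        have : q * (4 * C1 * C2 * s ^ 2 * U) = K1 * (s ^ 2 * s ^ bet k * U) := by rw [hqe, hK1]; ring
        rw [this]
        have : q * s ^ 2 ≤ 1 := mul_le_one₀ hq1 (by positivity) hs1
        gcongr
      _ = _ := by ring
  have g5 : D * (∫ y in ball x d, EE k H (fun y => u (y + h)) u y) ≤ D * (2 * c * W) := mul_le_mul_of_nonneg_left e4 hD0.le
  have hX : 0 ≤ s ^ 2 * s ^ bet k * U := by positivity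
  calc _ ≤ _ := s4
    _ ≤ K1 * (s ^ 2 * s ^ bet k * U) + C2 * (4 * C1 * c + 2 * c) * W + D * (2 * c * W) := add_le_add g4 g5
    _ = K1 * (s ^ 2 * s ^ bet k * U) + K2 * W := by rw [hK2]; ring
    _ ≤ (K1 + K2) * (s ^ 2 * s ^ bet k * U) + (K1 + K2) * W := by gcongr <;> linarith
    _ = _ := by ring

theorem camp2 {r k : ℝ} (hr : 0 < r) (hr1 : r < 1) (hk0 : 0 ≤ k) (hk : k < 1) :
    ∃ C, 0 < C ∧ ∀ (H : ℝ → ℝ → ℝ) (u v : E2 → ℝ), LipH k H → Sm u → Sm v →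
      ∫ y in ball (0:E2) r, HS (fun y => u y - v y) y ≤
        C * ((∫ y in ball (0:E2) 1, (u y - v y) ^ 2) + (∫ y in ball (0:E2) 1, res H u y ^ 2) + ∫ y in ball (0:E2) 1, res H v y ^ 2) := by
  have h1k : 0 < 1 - k := by linarith
  obtain ⟨C1, hC1, c1⟩ := cacc (k := (1 + k) / 2) hr hr1 (by linarith) (by linarith)
  refine ⟨C1 * (1 + 6 / (1 - k)), by positivity, ?_⟩
  intro H u v hH hu hv
  have s1 := (c1 (fun y => u y - v y) (EE k H u v) (hu.sub hv) (cont_EE hH hk hu hv) (EE_nonneg hk _ _ _)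
    (fun y _ => diff_ineq hH hk0 hk hu hv y)).1
  rw [int_EE hH hk hu hv] at s1
  refine s1.trans ?_
  rw [mul_assoc]
  refine mul_le_mul_of_nonneg_left ?_ hC1.le
  have a1 : 0 ≤ ∫ y in ball (0:E2) 1, (u y - v y) ^ 2 := nonneg_int (fun y => sq_nonneg _) _ _
  have a2 : 0 ≤ ∫ y in ball (0:E2) 1, res H u y ^ 2 := nonneg_int (fun y => sq_nonneg _) _ _
  have a3 : 0 ≤ ∫ y in ball (0:E2) 1, res H v y ^ 2 := nonneg_int (fun y => sq_nonneg _) _ _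
  have c0 : 0 ≤ 6 / (1 - k) := by positivity
  have := mul_nonneg c0 a1
  rw [add_mul, one_mul, mul_add, mul_add, mul_add]
  linarith


def av (f : E2 → ℝ) (x : E2) (s : ℝ) : ℝ := (π * s ^ 2)⁻¹ * ∫ y in ball x s, f y

theorem av_sub_const {f : E2 → ℝ} (hf : Continuous f) (x : E2) {s : ℝ} (hs : 0 < s) (c : ℝ) :
    av f x s - c = (π * s ^ 2)⁻¹ * ∫ y in ball x s, (f y - c) := by
  have hp := pi_pos
  rw [integral_sub (int_ball hf _ _) (int_ball continuous_const _ _), setIntegral_const, smul_eq_mul,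
    Measure.real, vol_ball x hs.le, av]
  have : π * s ^ 2 ≠ 0 := by positivity
  field_simp

theorem av_sq {f : E2 → ℝ} (hf : Continuous f) (x : E2) {s : ℝ} (hs : 0 < s) (c : ℝ) :
    (av f x s - c) ^ 2 ≤ (π * s ^ 2)⁻¹ * ∫ y in ball x s, (f y - c) ^ 2 := by
  have hp := pi_pos
  rw [av_sub_const hf x hs, mul_pow]
  have := cs_ball (f := fun y => f y - c) (by fun_prop) x hs.le
  have h0 : 0 < π * s ^ 2 := by positivity
  calc _ ≤ ((π * s ^ 2)⁻¹) ^ 2 * (π * s ^ 2 * ∫ y in ball x s, (f y - c) ^ 2) := by gcongr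
    _ = _ := by field_simp

theorem av_sub {f g : E2 → ℝ} (hf : Continuous f) (hg : Continuous g) (x : E2) (s : ℝ) :
    av (fun y => f y - g y) x s = av f x s - av g x s := by
  unfold av
  rw [integral_sub (int_ball hf _ _) (int_ball hg _ _)]; ring

theorem av_add {f g : E2 → ℝ} (hf : Continuous f) (hg : Continuous g) (x : E2) (s : ℝ) :
    av (fun y => f y + g y) x s = av f x s + av g x s := by
  unfold av
  rw [integral_add (int_ball hf _ _) (int_ball hg _ _)]; ring

theorem av_div {f : E2 → ℝ} (c : ℝ) (x : E2) (s : ℝ) :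
    av (fun y => f y / c) x s = av f x s / c := by
  unfold av
  rw [integral_div]; ring

theorem osc1 {f : E2 → ℝ} (hf : Continuous f) (x : E2) {s D : ℝ} (hs : 0 < s)
    (h : ∀ h : E2, ‖h‖ ≤ 2 * s → ∫ y in ball x s, (f (y + h) - f y) ^ 2 ≤ D) :
    ∫ y in ball x s, (f y - av f x s) ^ 2 ≤ 4 * D := by
  have hp := pi_pos
  have cz : Continuous (fun y => ∫ z in ball x s, (f z - f y) ^ 2) :=
    cont_ball_int (g := fun y z => (f z - f y) ^ 2) (by fun_prop) x hs
  have c0 : Continuous (fun y => ∫ h in ball (0:E2) (2 * s), (f (h + y) - f y) ^ 2) :=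
    cont_ball_int (g := fun y h => (f (h + y) - f y) ^ 2) (by fun_prop) 0 (by positivity)
  have ch : Continuous (fun h => ∫ y in ball x s, (f (h + y) - f y) ^ 2) :=
    cont_ball_int (g := fun h y => (f (h + y) - f y) ^ 2) (by fun_prop) x hs
  have pw : ∀ y, (f y - av f x s) ^ 2 ≤ (π * s ^ 2)⁻¹ * ∫ z in ball x s, (f z - f y) ^ 2 := by
    intro y
    have := av_sq hf x hs (f y)
    rwa [show (av f x s - f y) ^ 2 = (f y - av f x s) ^ 2 by ring] at this
  have pw2 : ∀ y ∈ ball x s, ∫ z in ball x s, (f z - f y) ^ 2 ≤ ∫ h in ball (0:E2) (2 * s), (f (h + y) - f y) ^ 2 := by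
    intro y hy
    rw [int_shift (fun z => (f z - f y) ^ 2) 0 y (2 * s), zero_add]
    refine mono_ball (by fun_prop) (fun _ => sq_nonneg _) (ball_subset_ball' ?_)
    rw [dist_comm]; rw [mem_ball] at hy; linarith
  have h4 : ∫ y in ball x s, ∫ h in ball (0:E2) (2 * s), (f (h + y) - f y) ^ 2 ≤ π * (2 * s) ^ 2 * D := by
    rw [fub_ball2 (g := fun y h => (f (h + y) - f y) ^ 2) (by fun_prop)]
    calc _ ≤ ∫ h in ball (0:E2) (2 * s), D := by
          refine mono_int ch continuous_const _ _ (fun z hz => ?_)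
          rw [mem_ball_zero_iff] at hz
          have := h z hz.le
          simpa only [add_comm z] using this
      _ = _ := by rw [setIntegral_const, smul_eq_mul, Measure.real, vol_ball _ (by positivity)]
  have h5 : ∫ y in ball x s, ∫ z in ball x s, (f z - f y) ^ 2 ≤ π * (2 * s) ^ 2 * D := (mono_int cz c0 _ _ pw2).trans h4
  calc _ ≤ ∫ y in ball x s, (π * s ^ 2)⁻¹ * ∫ z in ball x s, (f z - f y) ^ 2 :=
        mono_int (by fun_prop) (by fun_prop) _ _ (fun y _ => pw y)
    _ = (π * s ^ 2)⁻¹ * ∫ y in ball x s, ∫ z in ball x s, (f z - f y) ^ 2 := integral_const_mul _ _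
    _ ≤ (π * s ^ 2)⁻¹ * (π * (2 * s) ^ 2 * D) := by gcongr
    _ = _ := by field_simp; ring

theorem osc2 {f : E2 → ℝ} (hf : Continuous f) {x x' : E2} {s s' D : ℝ} (hs : 0 < s) (hs' : 0 < s')
    (hb : ball x' s' ⊆ ball x s) (h : ∫ y in ball x s, (f y - av f x s) ^ 2 ≤ D) :
    (av f x' s' - av f x s) ^ 2 ≤ (π * s' ^ 2)⁻¹ * D := by
  have hp := pi_pos
  refine (av_sq hf x' hs' _).trans ?_
  have : ∫ y in ball x' s', (f y - av f x s) ^ 2 ≤ D := (mono_ball (by fun_prop) (fun _ => sq_nonneg _) hb).trans h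
  gcongr

/-- translation invariant second order operators bounded by the Hessian -/
structure Op (T : (E2 → ℝ) → E2 → ℝ) : Prop where
  sm : ∀ u, Sm u → Sm (T u)
  sub : ∀ u v, Sm u → Sm v → ∀ x, T (fun y => u y - v y) x = T u x - T v x
  shift : ∀ u h x, T (fun y => u (y + h)) x = T u (x + h)
  sq : ∀ u, Sm u → ∀ x, T u x ^ 2 ≤ HS u x

theorem Op_hh : Op hh := ⟨fun _ h => h.hh, fun _ _ h1 h2 => hh_sub h1 h2, hh_shift, fun u _ x => by
  unfold HS QQ; nlinarith [sq_nonneg (hh u x), sq_nonneg (aa u x), sq_nonneg (bb u x)]⟩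
theorem Op_aa : Op aa := ⟨fun _ h => h.aa, fun _ _ h1 h2 => aa_sub h1 h2, aa_shift, fun u _ x => by
  unfold HS QQ; nlinarith [sq_nonneg (hh u x), sq_nonneg (aa u x), sq_nonneg (bb u x)]⟩
theorem Op_bb : Op bb := ⟨fun _ h => h.bb, fun _ _ h1 h2 => bb_sub h1 h2, bb_shift, fun u _ x => by
  unfold HS QQ; nlinarith [sq_nonneg (hh u x), sq_nonneg (aa u x), sq_nonneg (bb u x)]⟩

theorem Op_dd (i j : Fin 2) : Op (fun u => dd i (dd j u)) where
  sm := fun u h => (h.dd j).dd i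
  sub := fun u v hu hv x => by simp only [dd_sub hu hv, dd_sub (hu.dd j) (hv.dd j)]
  shift := fun u h x => by simp only [dd_shift]
  sq := fun u hu x => by
    rw [HS_eq hu]
    have := sq_nonneg (dd 0 (dd 0 u) x)
    have := sq_nonneg (dd 1 (dd 0 u) x)
    have := sq_nonneg (dd 0 (dd 1 u) x)
    have := sq_nonneg (dd 1 (dd 1 u) x)
    fin_cases i <;> fin_cases j <;> simp <;> linarith

set_option maxHeartbeats 1000000 in
theorem camp_all {r k : ℝ} (hr : 0 < r) (hr1 : r < 1) (hk0 : 0 ≤ k) (hk : k < 1) :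
    ∃ C, 0 < C ∧ ∀ (H : ℝ → ℝ → ℝ) (u : E2 → ℝ), LipH k H → Sm u →
      (∀ T, Op T → ∀ x x' s s', x ∈ closedBall (0:E2) r → 0 < s → s ≤ (1 - r) / 16 → 0 < s' → ball x' s' ⊆ ball x s →
        (av (T u) x' s' - av (T u) x s) ^ 2 ≤ C / s' ^ 2 *
          (s ^ 2 * s ^ bet k * (∫ y in ball (0:E2) 1, u y ^ 2) + ∫ y in ball (0:E2) 1, res H u y ^ 2)) ∧
      (∀ T, Op T → ∀ v x s, Sm v → x ∈ closedBall (0:E2) r → 0 < s → s ≤ (1 - r) / 16 →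
        (av (T u) x s - av (T v) x s) ^ 2 ≤ C / s ^ 2 *
          ((∫ y in ball (0:E2) 1, (u y - v y) ^ 2) + (∫ y in ball (0:E2) 1, res H u y ^ 2) + ∫ y in ball (0:E2) 1, res H v y ^ 2)) ∧
      (∀ x s, x ∈ closedBall (0:E2) r → 0 < s → s ≤ (1 - r) / 16 →
        (av (hh u) x s - H (av (aa u) x s) (av (bb u) x s)) ^ 2 ≤ C / s ^ 2 *
          (s ^ 2 * s ^ bet k * (∫ y in ball (0:E2) 1, u y ^ 2) + ∫ y in ball (0:E2) 1, res H u y ^ 2)) := by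
  have hp := pi_pos
  obtain ⟨C1, hC1, c1⟩ := camp1 hr hr1 hk0 hk
  obtain ⟨C2, hC2, c2⟩ := camp2 (r := r + (1 - r) / 16) (by linarith) (by linarith) hk0 hk
  set C := 16 * C1 / π + C2 / π + 2 / π with hC
  refine ⟨C, by positivity, ?_⟩
  intro H u hH hu
  have cr := cont_res hH hk hu
  set U := ∫ y in ball (0:E2) 1, u y ^ 2 with hU
  set W := ∫ y in ball (0:E2) 1, res H u y ^ 2 with hW
  have hU0 : 0 ≤ U := nonneg_int (fun y => sq_nonneg _) _ _
  have hW0 : 0 ≤ W := nonneg_int (fun y => sq_nonneg _) _ _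
  have os : ∀ T, Op T → ∀ x s, x ∈ closedBall (0:E2) r → 0 < s → s ≤ (1 - r) / 16 →
      ∫ y in ball x s, (T u y - av (T u) x s) ^ 2 ≤ 4 * (C1 * (s ^ 2 * s ^ bet k * U + W)) := by
    intro T hT x s hx hs hsd
    refine osc1 (hT.sm u hu).continuous x hs (fun h hh => ?_)
    refine le_trans ?_ (c1 H u x s h hH hu hx hs hsd hh)
    have hv := (hu.shift h).sub hu
    have cT := (hT.sm u hu).continuous
    refine mono_int (by fun_prop) hv.HS.continuous _ _ (fun y _ => ?_)
    have := hT.sq _ hv y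
    rwa [hT.sub _ _ (hu.shift h) hu, hT.shift] at this
  refine ⟨?_, ?_, ?_⟩
  · intro T hT x x' s s' hx hs hsd hs' hb
    refine (osc2 (hT.sm u hu).continuous hs hs' hb (os T hT x s hx hs hsd)).trans ?_
    have hX : 0 ≤ s ^ 2 * s ^ bet k * U + W := by positivity
    rw [show (π * s' ^ 2)⁻¹ * (4 * (C1 * (s ^ 2 * s ^ bet k * U + W))) = (4 * C1 / π) / s' ^ 2 * (s ^ 2 * s ^ bet k * U + W) by
      field_simp]
    have : 4 * C1 / π ≤ C := by
      have h1 : 4 * C1 / π ≤ 16 * C1 / π := by gcongr; norm_num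
      have : 0 < C2 / π := by positivity
      have : 0 < 2 / π := by positivity
      linarith
    gcongr
  · intro T hT v x s hv hx hs hsd
    have cT := (hT.sm u hu).continuous
    have cTv := (hT.sm v hv).continuous
    rw [← av_sub cT cTv]
    have h1 := av_sq (f := fun y => T u y - T v y) (by fun_prop) x hs 0
    simp only [sub_zero] at h1
    refine h1.trans ?_
    have h2 := c2 H u v hH hu hv
    have h3 : ∫ y in ball x s, (T u y - T v y) ^ 2 ≤ ∫ y in ball (0:E2) (r + (1 - r) / 16), HS (fun y => u y - v y) y := by
      refine le_trans (b := ∫ y in ball x s, HS (fun y => u y - v y) y) ?_ (mono_ball (hu.sub hv).HS.continuous (HS_nonneg _) (subs_ball (s := s) hx (by linarith)))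
      refine mono_int (by fun_prop) (hu.sub hv).HS.continuous _ _ (fun y _ => ?_)
      have := hT.sq _ (hu.sub hv) y
      rwa [hT.sub _ _ hu hv] at this
    have a1 : 0 ≤ ∫ y in ball (0:E2) 1, (u y - v y) ^ 2 := nonneg_int (fun y => sq_nonneg _) _ _
    have a3 : 0 ≤ ∫ y in ball (0:E2) 1, res H v y ^ 2 := nonneg_int (fun y => sq_nonneg _) _ _
    set X := (∫ y in ball (0:E2) 1, (u y - v y) ^ 2) + W + ∫ y in ball (0:E2) 1, res H v y ^ 2 with hX
    have hX0 : 0 ≤ X := by positivity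
    calc _ ≤ (π * s ^ 2)⁻¹ * (C2 * X) := by have := h3.trans h2; gcongr
      _ = (C2 / π) / s ^ 2 * X := by field_simp
      _ ≤ C / s ^ 2 * X := by
        have : C2 / π ≤ C := by
          have : 0 < 16 * C1 / π := by positivity
          have : 0 < 2 / π := by positivity
          linarith
        gcongr
  · intro x s hx hs hsd
    set p := av (aa u) x s with hp
    set q := av (bb u) x s with hq
    have o1 := os aa Op_aa x s hx hs hsd
    have o2 := os bb Op_bb x s hx hs hsd
    have h1 := av_sq hu.hh.continuous x hs (H p q)
    refine h1.trans ?_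
    have ca := hu.aa.continuous
    have cb := hu.bb.continuous
    have ch := hu.hh.continuous
    have h2 : ∫ y in ball x s, (hh u y - H p q) ^ 2 ≤ ∫ y in ball x s, (2 * res H u y ^ 2 + 2 * ((aa u y - p) ^ 2 + (bb u y - q) ^ 2)) := by
      refine mono_int (by fun_prop) (by fun_prop) _ _ (fun y _ => ?_)
      have h3 := hH.2 (aa u y) (bb u y) p q
      have h4 : k * ((aa u y - p) ^ 2 + (bb u y - q) ^ 2) ≤ (aa u y - p) ^ 2 + (bb u y - q) ^ 2 :=
        mul_le_of_le_one_left (by positivity) hk.le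
      have e : hh u y - H p q = res H u y + (H (aa u y) (bb u y) - H p q) := by unfold res; ring
      rw [e]
      set X := H (aa u y) (bb u y) - H p q
      nlinarith [sq_nonneg (res H u y - X)]
    have h3 : ∫ y in ball x s, (2 * res H u y ^ 2 + 2 * ((aa u y - p) ^ 2 + (bb u y - q) ^ 2)) =
        2 * (∫ y in ball x s, res H u y ^ 2) + 2 * ((∫ y in ball x s, (aa u y - p) ^ 2) + ∫ y in ball x s, (bb u y - q) ^ 2) := by
      rw [integral_add (int_ball (by fun_prop) _ _) (int_ball (by fun_prop) _ _), integral_const_mul, integral_const_mul, integral_add (int_ball (by fun_prop) _ _) (int_ball (by fun_prop) _ _)]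
    have h4 : ∫ y in ball x s, res H u y ^ 2 ≤ W := mono_ball (f := fun y => res H u y ^ 2) (by fun_prop) (fun _ => sq_nonneg _) (subs_ball hx (by linarith))
    have hX0 : 0 ≤ s ^ 2 * s ^ bet k * U := by positivity
    have h5 : ∫ y in ball x s, (hh u y - H p q) ^ 2 ≤ (16 * C1 + 2) * (s ^ 2 * s ^ bet k * U + W) := by
      rw [add_mul]; linarith
    calc _ ≤ (π * s ^ 2)⁻¹ * ((16 * C1 + 2) * (s ^ 2 * s ^ bet k * U + W)) := by gcongr
      _ = ((16 * C1 + 2) / π) / s ^ 2 * (s ^ 2 * s ^ bet k * U + W) := by field_simp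
      _ ≤ C / s ^ 2 * (s ^ 2 * s ^ bet k * U + W) := by
        have : (16 * C1 + 2) / π ≤ C := by
          rw [add_div, hC]
          have : 0 < C2 / π := by positivity
          linarith
        gcongr


theorem int_sq_le {f : E2 → ℝ} (hf : Continuous f) {m : ℝ} (h : ∀ x ∈ closedBall (0:E2) 1, |f x| ≤ m) :
    ∫ y in ball (0:E2) 1, f y ^ 2 ≤ π * m ^ 2 := by
  calc _ ≤ ∫ y in ball (0:E2) 1, m ^ 2 := by
        refine mono_int (by fun_prop) continuous_const _ _ (fun y hy => ?_)
        have := h y (ball_subset_closedBall hy)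
        rw [← sq_abs]; gcongr
    _ = _ := by rw [setIntegral_const, smul_eq_mul, Measure.real, vol_ball _ zero_le_one]; ring

structure Appr (H : ℝ → ℝ → ℝ) (u : E2 → ℝ) (M : ℝ) (un : ℕ → E2 → ℝ) (e : ℕ → ℝ) : Prop where
  sm : ∀ n, Sm (un n)
  e0 : ∀ n, 0 ≤ e n
  lim : Tendsto e atTop (𝓝 0)
  unif : ∀ n, ∀ x ∈ closedBall (0:E2) 1, |un n x - u x| ≤ e n
  res : ∀ n, ∫ y in ball (0:E2) 1, res H (un n) y ^ 2 ≤ e n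
  bd : ∀ x ∈ closedBall (0:E2) 1, |u x| ≤ M

theorem Appr.M0 {H : ℝ → ℝ → ℝ} {u : E2 → ℝ} {M : ℝ} {un : ℕ → E2 → ℝ} {e : ℕ → ℝ} (h : Appr H u M un e) : 0 ≤ M :=
  (abs_nonneg _).trans (h.bd 0 (by simp))

set_option maxHeartbeats 1000000 in
theorem lim1 {r k : ℝ} (hr : 0 < r) (hr1 : r < 1) (hk0 : 0 ≤ k) (hk : k < 1) :
    ∃ C, 0 < C ∧ ∀ (H : ℝ → ℝ → ℝ) (u : E2 → ℝ) (M : ℝ) (un : ℕ → E2 → ℝ) (e : ℕ → ℝ), LipH k H → Appr H u M un e →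
    ∃ A : ((E2 → ℝ) → E2 → ℝ) → E2 → ℝ → ℝ,
      (∀ T, Op T → ∀ n x s, x ∈ closedBall (0:E2) r → 0 < s → s ≤ (1 - r) / 16 →
        (av (T (un n)) x s - A T x s) ^ 2 ≤ C / s ^ 2 * (e n ^ 2 + e n)) ∧
      (∀ T, Op T → ∀ x x' s s', x ∈ closedBall (0:E2) r → x' ∈ closedBall (0:E2) r →
        0 < s → s ≤ (1 - r) / 16 → 0 < s' → s' ≤ (1 - r) / 16 → ball x' s' ⊆ ball x s →
        (A T x' s' - A T x s) ^ 2 ≤ C / s' ^ 2 * (s ^ 2 * s ^ bet k * M ^ 2)) ∧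
      (∀ T, Op T → ∀ x s, x ∈ closedBall (0:E2) r → 0 < s → s ≤ (1 - r) / 16 →
        (A T x s) ^ 2 ≤ C / s ^ 2 * M ^ 2) ∧
      (∀ x s, x ∈ closedBall (0:E2) r → 0 < s → s ≤ (1 - r) / 16 →
        (A hh x s - H (A aa x s) (A bb x s)) ^ 2 ≤ C / s ^ 2 * (s ^ 2 * s ^ bet k * M ^ 2)) ∧
      (∀ T, Op T → ∀ x s, x ∈ closedBall (0:E2) r → 0 < s → s ≤ (1 - r) / 16 →
        Tendsto (fun n => av (T (un n)) x s) atTop (𝓝 (A T x s))) := by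
  have hp := pi_gt_three
  obtain ⟨C, hC, c⟩ := camp_all hr hr1 hk0 hk
  refine ⟨C * π, by positivity, ?_⟩
  intro H u M un e hH ha
  have hM := ha.M0
  have bd1 : ∀ n, ∫ y in ball (0:E2) 1, un n y ^ 2 ≤ π * (M + e n) ^ 2 := by
    intro n
    refine int_sq_le (ha.sm n).continuous (fun x hx => ?_)
    have h1 := ha.unif n x hx
    have h2 := ha.bd x hx
    rw [abs_le] at *; constructor <;> linarith
  have bd2 : ∀ n m, ∫ y in ball (0:E2) 1, (un n y - un m y) ^ 2 ≤ π * (e n + e m) ^ 2 := by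
    intro n m
    refine int_sq_le (f := fun x => un n x - un m x) ((ha.sm n).continuous.sub (ha.sm m).continuous) (fun x hx => ?_)
    have h1 := ha.unif n x hx
    have h2 := ha.unif m x hx
    rw [abs_le] at *; constructor <;> linarith
  -- basic Cauchy estimate
  have ce : ∀ T, Op T → ∀ x s, x ∈ closedBall (0:E2) r → 0 < s → s ≤ (1 - r) / 16 → ∀ n m,
      (av (T (un n)) x s - av (T (un m)) x s) ^ 2 ≤ C / s ^ 2 * (π * (e n + e m) ^ 2 + e n + e m) := by
    intro T hT x s hx hs hsd n m
    have h1 := (c H (un n) hH (ha.sm n)).2.1 T hT (un m) x s (ha.sm m) hx hs hsd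
    refine h1.trans ?_
    have := bd2 n m
    have := ha.res n
    have := ha.res m
    gcongr
  have key : ∀ T x s, ∃ a, Op T → x ∈ closedBall (0:E2) r → 0 < s → s ≤ (1 - r) / 16 →
      Tendsto (fun n => av (T (un n)) x s) atTop (𝓝 a) := by
    intro T x s
    by_cases h : Op T ∧ x ∈ closedBall (0:E2) r ∧ 0 < s ∧ s ≤ (1 - r) / 16
    · obtain ⟨hT, hx, hs, hsd⟩ := h
      have hc : CauchySeq (fun n => av (T (un n)) x s) := by
        rw [Metric.cauchySeq_iff]
        intro ε hε
        have hlim : Tendsto (fun p : ℕ × ℕ => C / s ^ 2 * (π * (e p.1 + e p.2) ^ 2 + e p.1 + e p.2)) atTop (𝓝 (C / s ^ 2 * (π * (0 + 0) ^ 2 + 0 + 0))) := by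
          have h1 : Tendsto (fun p : ℕ × ℕ => e p.1) atTop (𝓝 0) := by
            rw [← prod_atTop_atTop_eq]; exact ha.lim.comp tendsto_fst
          have h2 : Tendsto (fun p : ℕ × ℕ => e p.2) atTop (𝓝 0) := by
            rw [← prod_atTop_atTop_eq]; exact ha.lim.comp tendsto_snd
          exact (((((h1.add h2).pow 2).const_mul π).add h1).add h2).const_mul _
        have h0 : C / s ^ 2 * (π * (0 + 0) ^ 2 + 0 + 0) < ε ^ 2 := by simp; positivity
        obtain ⟨⟨N1, N2⟩, hN⟩ := (hlim.eventually_lt_const h0).exists_forall_of_atTop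
        refine ⟨max N1 N2, fun m hm n hn => ?_⟩
        have h3 := hN (m, n) (Prod.mk_le_mk.2 ⟨(le_max_left _ _).trans hm, (le_max_right _ _).trans hn⟩)
        have h4 := (ce T hT x s hx hs hsd m n).trans_lt h3
        rw [Real.dist_eq]
        exact abs_lt_of_sq_lt_sq h4 hε.le
      obtain ⟨a, hA⟩ := cauchySeq_tendsto_of_complete hc
      exact ⟨a, fun _ _ _ _ => hA⟩
    · exact ⟨0, fun h1 h2 h3 h4 => absurd ⟨h1, h2, h3, h4⟩ h⟩
  choose A hA using key
  have lim2 : ∀ q : ℝ, Tendsto (fun n => q * (π * (M + e n) ^ 2) + e n) atTop (𝓝 (q * (π * (M + 0) ^ 2) + 0)) := by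
    intro q
    exact (((((ha.lim.const_add M).pow 2).const_mul π).const_mul q).add ha.lim)
  refine ⟨A, ?_, ?_, ?_, ?_, fun T hT x s hx hs hsd => hA T x s hT hx hs hsd⟩
  · intro T hT n x s hx hs hsd
    have t1 : Tendsto (fun m => (av (T (un n)) x s - av (T (un m)) x s) ^ 2) atTop (𝓝 ((av (T (un n)) x s - A T x s) ^ 2)) :=
      ((hA T x s hT hx hs hsd).const_sub _).pow 2
    have t2 : Tendsto (fun m => C / s ^ 2 * (π * (e n + e m) ^ 2 + e n + e m)) atTop (𝓝 (C / s ^ 2 * (π * (e n + 0) ^ 2 + e n + 0))) :=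
      (((((ha.lim.const_add _).pow 2).const_mul π).add_const _).add ha.lim).const_mul _
    refine (le_of_tendsto_of_tendsto' t1 t2 (fun m => ce T hT x s hx hs hsd n m)).trans ?_
    have := ha.e0 n
    calc _ = C / s ^ 2 * (π * e n ^ 2 + 1 * e n) := by ring
      _ ≤ C / s ^ 2 * (π * e n ^ 2 + π * e n) := by gcongr; linarith
      _ = _ := by ring
  · intro T hT x x' s s' hx hx' hs hsd hs' hsd' hb
    have t1 : Tendsto (fun n => (av (T (un n)) x' s' - av (T (un n)) x s) ^ 2) atTop (𝓝 ((A T x' s' - A T x s) ^ 2)) :=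
      ((hA T x' s' hT hx' hs' hsd').sub (hA T x s hT hx hs hsd)).pow 2
    have t2 := (lim2 (s ^ 2 * s ^ bet k)).const_mul (C / s' ^ 2)
    refine (le_of_tendsto_of_tendsto' t1 t2 (fun n => ?_)).trans (le_of_eq (by ring))
    refine ((c H (un n) hH (ha.sm n)).1 T hT x x' s s' hx hs hsd hs' hb).trans ?_
    have := bd1 n
    have := ha.res n
    gcongr
  · intro T hT x s hx hs hsd
    have t1 : Tendsto (fun n => (av (T (un n)) x s) ^ 2) atTop (𝓝 ((A T x s) ^ 2)) :=
      (hA T x s hT hx hs hsd).pow 2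
    have t2 := (lim2 1).const_mul (C / s ^ 2)
    refine (le_of_tendsto_of_tendsto' t1 t2 (fun n => ?_)).trans (le_of_eq (by ring))
    have h1 := (c H (un n) hH (ha.sm n)).2.1 T hT (fun _ => 0) x s (Sm.const 0) hx hs hsd
    have h0 : T (fun _ => 0) = fun _ => 0 := by
      ext z
      have := hT.sub (fun _ => 0) (fun _ => 0) (Sm.const 0) (Sm.const 0) z
      simpa using this
    have h2 : av (T (fun _ => 0)) x s = 0 := by rw [h0]; simp [av]
    rw [h2] at h1
    simp only [sub_zero, res_zero hH, ne_eq, OfNat.ofNat_ne_zero, not_false_eq_true, zero_pow, integral_zero, add_zero] at h1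
    refine h1.trans ?_
    have := bd1 n
    have := ha.res n
    rw [one_mul]
    gcongr
  · intro x s hx hs hsd
    have hHc := hH.continuous hk
    have t3 := (hHc.tendsto (A aa x s, A bb x s)).comp ((hA aa x s Op_aa hx hs hsd).prodMk_nhds (hA bb x s Op_bb hx hs hsd))
    have t1 := ((hA hh x s Op_hh hx hs hsd).sub t3).pow 2
    have t2 := (lim2 (s ^ 2 * s ^ bet k)).const_mul (C / s ^ 2)
    refine (le_of_tendsto_of_tendsto' t1 t2 (fun n => ?_)).trans (le_of_eq (by ring))
    refine ((c H (un n) hH (ha.sm n)).2.2 x s hx hs hsd).trans ?_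
    have := bd1 n
    have := ha.res n
    gcongr


theorem half_pow (b : ℝ) (j : ℕ) : ((1/2:ℝ) ^ j) ^ b = ((1/2:ℝ) ^ b) ^ j := by
  rw [← rpow_natCast, ← rpow_natCast, ← rpow_mul (by norm_num), ← rpow_mul (by norm_num), mul_comm]

set_option maxHeartbeats 1000000 in
theorem lim2 {r k : ℝ} (hr : 0 < r) (hr1 : r < 1) (hk0 : 0 ≤ k) (hk : k < 1) :
    ∃ C, 0 < C ∧ ∀ (H : ℝ → ℝ → ℝ) (u : E2 → ℝ) (M : ℝ) (un : ℕ → E2 → ℝ) (e : ℕ → ℝ), LipH k H → Appr H u M un e →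
    ∃ G : ((E2 → ℝ) → E2 → ℝ) → E2 → ℝ,
      (∀ T, Op T → ∀ x ∈ closedBall (0:E2) r, |G T x| ≤ C * M) ∧
      (∀ T, Op T → ∀ x ∈ closedBall (0:E2) r, ∀ x' ∈ closedBall (0:E2) r,
        |G T x - G T x'| ≤ C * M * ‖x - x'‖ ^ (bet k / 2)) ∧
      (∀ x ∈ closedBall (0:E2) r, G hh x = H (G aa x) (G bb x)) ∧
      (∀ ε > 0, ∃ n s, 0 < s ∧ s ≤ ε ∧ s ≤ (1 - r) / 16 ∧ e n ≤ ε ∧ ∀ T, Op T → ∀ x ∈ closedBall (0:E2) r,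
        |av (T (un n)) x s - G T x| ≤ ε) := by
  obtain ⟨C0, hC0, c⟩ := lim1 hr hr1 hk0 hk
  set d := (1 - r) / 16 with hd
  have hd0 : 0 < d := by rw [hd]; linarith
  have hd1 : d ≤ 1 := by rw [hd]; linarith
  have hβ := bet_pos hk
  set α := bet k / 2 with hα
  have hα0 : 0 < α := by positivity
  set q := (1/2:ℝ) ^ α with hq
  have hq0 : 0 < q := rpow_pos_of_pos (by norm_num) _
  have hq1 : q < 1 := rpow_lt_one (by norm_num) (by norm_num) hα0
  set c0 := √C0 with hc0
  have hc00 : 0 < c0 := sqrt_pos.2 hC0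
  have hc0s : c0 ^ 2 = C0 := sq_sqrt hC0.le
  set K := 2 * c0 / (1 - q) with hK
  have h1q : 0 < 1 - q := by linarith
  have hK0 : 0 < K := by positivity
  set L := c0 / d + K with hL
  have hL0 : 0 < L := by positivity
  set Z := (2 * L + 2 * c0 + 2 * K) * (4 / d) ^ α with hZ
  have hZ0 : 0 < Z := by positivity
  refine ⟨L + Z, by positivity, ?_⟩
  intro H u M un e hH ha
  have hM := ha.M0
  obtain ⟨A, a1, a2, a3, a4, a5⟩ := c H u M un e hH ha
  set S : ℕ → ℝ := fun j => d * (1/2) ^ j with hS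
  have hS0 : ∀ j, 0 < S j := fun j => by simp only [hS]; positivity
  have hSd : ∀ j, S j ≤ d := fun j => mul_le_of_le_one_right hd0.le (pow_le_one₀ (by norm_num) (by norm_num))
  have hS1 : ∀ j, S (j + 1) = S j / 2 := fun j => by simp only [hS, pow_succ]; ring
  have hSb : ∀ j, S j ^ bet k ≤ (q ^ j) ^ 2 := by
    intro j
    have e1 : ((1/2:ℝ) ^ j) ^ bet k = (q ^ j) ^ 2 := by
      rw [half_pow, ← pow_mul, mul_comm j 2, pow_mul, hq, ← rpow_natCast ((1/2:ℝ) ^ α), ← rpow_mul (by norm_num), hα]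
      congr 2; push_cast; ring
    rw [← e1]
    refine rpow_le_rpow (hS0 j).le ?_ hβ.le
    exact mul_le_of_le_one_left (by positivity) hd1
  -- step estimate, general
  have st : ∀ T, Op T → ∀ x ∈ closedBall (0:E2) r, ∀ x' ∈ closedBall (0:E2) r, ∀ j, ‖x - x'‖ ≤ S j / 2 →
      |A T x' (S (j + 1)) - A T x (S j)| ≤ 2 * c0 * M * q ^ j := by
    intro T hT x hx x' hx' j hj
    have hb : ball x' (S (j + 1)) ⊆ ball x (S j) := by
      refine ball_subset_ball' ?_
      rw [hS1, dist_comm, dist_eq_norm]; linarith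
    have h1 := a2 T hT x x' (S j) (S (j + 1)) hx hx' (hS0 j) (hSd j) (hS0 _) (hSd _) hb
    refine abs_le_of_sq_le_sq (h1.trans ?_) (by positivity)
    have hs := hS0 j
    calc C0 / S (j + 1) ^ 2 * (S j ^ 2 * S j ^ bet k * M ^ 2) = 4 * C0 * S j ^ bet k * M ^ 2 := by
          rw [hS1]; field_simp; ring
      _ ≤ 4 * C0 * (q ^ j) ^ 2 * M ^ 2 := by have := hSb j; gcongr
      _ = _ := by rw [← hc0s]; ring
  have ex : ∀ T x, ∃ g, Op T → x ∈ closedBall (0:E2) r → Tendsto (fun j => A T x (S j)) atTop (𝓝 g) := by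
    intro T x
    by_cases h : Op T ∧ x ∈ closedBall (0:E2) r
    · have hc : CauchySeq (fun j => A T x (S j)) := by
        refine cauchySeq_of_le_geometric q (2 * c0 * M) hq1 (fun j => ?_)
        rw [dist_comm, Real.dist_eq]
        exact st T h.1 x h.2 x h.2 j (by simpa using (half_pos (hS0 j)).le)
      obtain ⟨a, hA⟩ := cauchySeq_tendsto_of_complete hc
      exact ⟨a, fun _ _ => hA⟩
    · exact ⟨0, fun h1 h2 => absurd ⟨h1, h2⟩ h⟩
  choose G hG using ex
  have r0 : ∀ T, Op T → ∀ x ∈ closedBall (0:E2) r, ∀ j, |A T x (S j) - G T x| ≤ K * M * q ^ j := by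
    intro T hT x hx j
    have := dist_le_of_le_geometric_of_tendsto q (2 * c0 * M) hq1 (f := fun j => A T x (S j)) (fun j => by
      rw [dist_comm, Real.dist_eq]
      exact st T hT x hx x hx j (by simpa using (half_pos (hS0 j)).le)) (hG T x hT hx) j
    rw [Real.dist_eq] at this
    refine this.trans (le_of_eq ?_)
    rw [hK]; ring
  have r1 : ∀ T, Op T → ∀ x ∈ closedBall (0:E2) r, |G T x| ≤ L * M := by
    intro T hT x hx
    have h1 := r0 T hT x hx 0
    have hS00 : S 0 = d := by simp [hS]
    rw [hS00, pow_zero, mul_one] at h1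
    have h2 : |A T x d| ≤ c0 / d * M := by
      refine abs_le_of_sq_le_sq ((a3 T hT x d hx hd0 le_rfl).trans (le_of_eq ?_)) (by positivity)
      rw [← hc0s]; field_simp
    have h3 : |G T x| ≤ |A T x d| + |A T x d - G T x| := by
      have := abs_sub_abs_le_abs_sub (G T x) (A T x d)
      rw [abs_sub_comm] at this; linarith
    rw [hL, add_mul]; linarith
  refine ⟨G, ?_, ?_, ?_, ?_⟩
  · intro T hT x hx
    refine (r1 T hT x hx).trans ?_
    gcongr; linarith
  · intro T hT x hx x' hx'
    set t := ‖x - x'‖ with ht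
    suffices |G T x - G T x'| ≤ (2 * L + 2 * c0 + 2 * K) * M * ((4 / d) ^ α * t ^ α) by
      refine this.trans ?_
      have h0 : 0 ≤ L * M * t ^ α := by positivity
      calc _ = Z * M * t ^ α := by rw [hZ]; ring
        _ ≤ _ := by rw [add_mul, add_mul]; linarith
    rw [← mul_rpow (by positivity) (by positivity)]
    rcases (norm_nonneg (x - x')).eq_or_lt with h0 | h0
    · have hxx : x = x' := by rw [← sub_eq_zero, ← norm_eq_zero]; exact h0.symm
      rw [hxx]; simp; positivity
    rcases le_or_gt t (d / 2) with htd | htd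
    · obtain ⟨j, hj1, hj2⟩ := exists_nat_pow_near_of_lt_one (x := 2 * t / d) (y := (1/2:ℝ)) (by positivity)
        (by rw [div_le_one hd0]; linarith) (by norm_num) (by norm_num)
      have e1 : t ≤ S j / 2 := by
        rw [div_le_iff₀ hd0] at hj2
        simp only [hS]; linarith
      have e2 : (1/2:ℝ) ^ j ≤ 4 / d * t := by
        rw [pow_succ] at hj1
        have : 4 / d * t = 2 * (2 * t / d) := by ring
        rw [this]; linarith
      have e3 : q ^ j ≤ (4 / d * t) ^ α := by
        rw [hq, ← half_pow]; exact rpow_le_rpow (by positivity) e2 hα0.le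
      have h1 := r0 T hT x hx j
      have h2 := r0 T hT x' hx' (j + 1)
      have h3 := st T hT x hx x' hx' j e1
      have h4 : K * M * q ^ (j + 1) ≤ K * M * q ^ j := by
        have := pow_le_pow_of_le_one hq0.le hq1.le (Nat.le_succ j)
        exact mul_le_mul_of_nonneg_left this (by positivity)
      have h5 : |G T x - G T x'| ≤ (2 * c0 + 2 * K) * M * q ^ j := by
        have : (2 * c0 + 2 * K) * M * q ^ j = 2 * c0 * M * q ^ j + 2 * (K * M * q ^ j) := by ring
        rw [this]
        rw [abs_le] at *
        constructor <;> linarith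
      calc _ ≤ _ := h5
        _ ≤ (2 * L + 2 * c0 + 2 * K) * M * (4 / d * t) ^ α := by gcongr; linarith
    · have h1 := r1 T hT x hx
      have h2 := r1 T hT x' hx'
      have h3 : |G T x - G T x'| ≤ 2 * L * M * 1 := by
        have := abs_sub (G T x) (G T x')
        linarith
      have h4 : 1 ≤ (4 / d * t) ^ α := by
        refine one_le_rpow ?_ hα0.le
        have : 4 / d * t = (4 * t) / d := by ring
        rw [this, one_le_div hd0]; linarith
      refine h3.trans ?_
      gcongr; linarith
  · intro x hx
    have hHc := hH.continuous hk
    have t3 := (hHc.tendsto (G aa x, G bb x)).comp ((hG aa x Op_aa hx).prodMk_nhds (hG bb x Op_bb hx))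
    have t1 := ((hG hh x Op_hh hx).sub t3).pow 2
    have hb : ∀ j, (A hh x (S j) - H (A aa x (S j)) (A bb x (S j))) ^ 2 ≤ C0 * M ^ 2 * (q ^ j) ^ 2 := by
      intro j
      refine (a4 x (S j) hx (hS0 j) (hSd j)).trans ?_
      have hs := hS0 j
      calc _ = C0 * M ^ 2 * S j ^ bet k := by field_simp
        _ ≤ _ := by have := hSb j; gcongr
    have t2 : Tendsto (fun j : ℕ => C0 * M ^ 2 * (q ^ j) ^ 2) atTop (𝓝 (C0 * M ^ 2 * 0 ^ 2)) :=
      ((tendsto_pow_atTop_nhds_zero_of_lt_one hq0.le hq1).pow 2).const_mul _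
    have := le_of_tendsto_of_tendsto' t1 t2 hb
    simp only [ne_eq, OfNat.ofNat_ne_zero, not_false_eq_true, zero_pow, mul_zero] at this
    have := pow_eq_zero_iff (two_ne_zero) |>.1 (le_antisymm this (sq_nonneg _))
    linarith
  · intro ε hε
    have t1 : Tendsto (fun j : ℕ => K * M * q ^ j) atTop (𝓝 (K * M * 0)) :=
      (tendsto_pow_atTop_nhds_zero_of_lt_one hq0.le hq1).const_mul _
    have t2 : Tendsto (fun j : ℕ => S j) atTop (𝓝 (d * 0)) :=
      (tendsto_pow_atTop_nhds_zero_of_lt_one (by norm_num) (by norm_num)).const_mul _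
    rw [mul_zero] at t1 t2
    obtain ⟨j, hj1, hj2⟩ := ((t1.eventually_lt_const (half_pos hε)).and (t2.eventually_lt_const hε)).exists
    have t3 : Tendsto (fun n => C0 / S j ^ 2 * (e n ^ 2 + e n)) atTop (𝓝 (C0 / S j ^ 2 * (0 ^ 2 + 0))) :=
      ((ha.lim.pow 2).add ha.lim).const_mul _
    have h0 : C0 / S j ^ 2 * (0 ^ 2 + 0) < (ε / 2) ^ 2 := by simp; positivity
    obtain ⟨n, hn1, hn2⟩ := ((t3.eventually_lt_const h0).and (ha.lim.eventually_lt_const hε)).exists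
    refine ⟨n, S j, hS0 j, hj2.le, hSd j, hn2.le, ?_⟩
    intro T hT x hx
    have h1 := r0 T hT x hx j
    have h2 : |av (T (un n)) x (S j) - A T x (S j)| ≤ ε / 2 :=
      abs_le_of_sq_le_sq ((a1 T hT n x (S j) hx (hS0 j) (hSd j)).trans hn1.le) (by positivity)
    rw [abs_le] at *
    constructor <;> linarith


/-- the linear functional with coefficients `a, b` -/
def lin (a b : ℝ) : E2 →L[ℝ] ℝ :=
  a • (EuclideanSpace.proj 0 : E2 →L[ℝ] ℝ) + b • (EuclideanSpace.proj 1 : E2 →L[ℝ] ℝ)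

theorem lin_apply (a b : ℝ) (v : E2) : lin a b v = v 0 * a + v 1 * b := by
  simp [lin]; ring

theorem abs_coord_le (v : E2) (i : Fin 2) : |v i| ≤ ‖v‖ := by
  simpa using PiLp.norm_apply_le v i

theorem lin_norm (a b : ℝ) : ‖lin a b‖ ≤ |a| + |b| := by
  refine ContinuousLinearMap.opNorm_le_bound _ (by positivity) (fun v => ?_)
  rw [lin_apply, Real.norm_eq_abs]
  calc _ ≤ |v 0| * |a| + |v 1| * |b| := by rw [← abs_mul, ← abs_mul]; exact abs_add_le _ _
    _ ≤ ‖v‖ * |a| + ‖v‖ * |b| := by have := abs_coord_le v 0; have := abs_coord_le v 1; gcongr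
    _ = _ := by ring

theorem lin_sub (a b a' b' : ℝ) : lin a b - lin a' b' = lin (a - a') (b - b') := by
  ext v; simp [lin_apply]; ring

theorem av_shift (f : E2 → ℝ) (x : E2) (s : ℝ) : av f x s = (π * s ^ 2)⁻¹ * ∫ y in ball (0:E2) s, f (y + x) := by
  rw [int_shift, zero_add, av]

theorem av_hasFDeriv {f : E2 → ℝ} (hf : Sm f) (s : ℝ) (x : E2) :
    HasFDerivAt (fun x => av f x s) (lin (av (dd 0 f) x s) (av (dd 1 f) x s)) x := by
  have c1 : Continuous (fderiv ℝ f) := (hf.contDiff 1).continuous_fderiv (by norm_num)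
  obtain ⟨B, hB⟩ := (isCompact_closedBall (0:E2) (|s| + ‖x‖ + 1)).exists_bound_of_continuousOn c1.continuousOn
  have h1 : HasFDerivAt (fun x => ∫ y in ball (0:E2) s, f (y + x)) (∫ y in ball (0:E2) s, fderiv ℝ f (y + x)) x := by
    refine hasFDerivAt_integral_of_dominated_of_fderiv_le (F' := fun x y => fderiv ℝ f (y + x)) (bound := fun _ => B)
      (ball_mem_nhds x one_pos) ?_ ?_ ?_ ?_ ?_ ?_
    · refine Eventually.of_forall fun z => ?_
      exact (hf.continuous.comp (continuous_id.add continuous_const)).aestronglyMeasurable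
    · exact int_ball (hf.continuous.comp (continuous_id.add continuous_const)) _ _
    · exact (c1.comp (continuous_id.add continuous_const)).aestronglyMeasurable
    · refine (ae_restrict_iff' measurableSet_ball).2 (Eventually.of_forall fun y hy z hz => hB _ ?_)
      rw [mem_closedBall_zero_iff]
      rw [mem_ball_zero_iff] at hy
      rw [mem_ball, dist_eq_norm] at hz
      have h1 := norm_add_le y z
      have h2 : ‖z‖ ≤ ‖z - x‖ + ‖x‖ := by simpa using norm_add_le (z - x) x
      have := le_abs_self s
      linarith
    · exact int_ball (f := fun _ => B) continuous_const _ _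
    · refine Eventually.of_forall fun y z _ => ?_
      have := (hf.differentiable (y + z)).hasFDerivAt.comp z ((hasFDerivAt_id z).const_add y)
      simpa [Function.comp_def] using this
  have h2 := h1.const_mul ((π * s ^ 2)⁻¹)
  have e1 : (fun x => av f x s) = fun x => (π * s ^ 2)⁻¹ * ∫ y in ball (0:E2) s, f (y + x) := by
    ext z; exact av_shift f z s
  rw [e1]
  have e2 : lin (av (dd 0 f) x s) (av (dd 1 f) x s) = (π * s ^ 2)⁻¹ • ∫ y in ball (0:E2) s, fderiv ℝ f (y + x) := by
    ext v
    rw [lin_apply]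
    have ci : IntegrableOn (fun y => fderiv ℝ f (y + x)) (ball (0:E2) s) :=
      ((c1.comp (continuous_id.add continuous_const)).continuousOn.integrableOn_compact (isCompact_closedBall 0 s)).mono_set ball_subset_closedBall
    rw [ContinuousLinearMap.smul_apply, ContinuousLinearMap.integral_apply ci, av_shift, av_shift]
    have c0 := (hf.dd 0).continuous
    have c1 := (hf.dd 1).continuous
    simp only [dd_eval]
    rw [integral_add (int_ball (by fun_prop) _ _) (int_ball (by fun_prop) _ _), integral_const_mul, integral_const_mul, smul_eq_mul]
    ring
  rw [e2]; exact h2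

/-- interpolation -/
theorem interp {W P Q : E2 → ℝ} {b0 b1 c0 c1 : E2 → ℝ} {A B ρ : ℝ} (hρ : 0 < ρ) (i : Fin 2) (x : E2)
    (h1 : ∀ y ∈ closedBall x ρ, HasFDerivAt W (lin (b0 y) (b1 y)) y)
    (h2 : ∀ y ∈ closedBall x ρ, HasFDerivAt P (lin (c0 y) (c1 y)) y)
    (hP : P = ![b0, b1] i) (hQ : Q = ![c0, c1] i)
    (hA : ∀ y ∈ closedBall x ρ, |W y| ≤ A) (hB : ∀ y ∈ closedBall x ρ, |Q y| ≤ B) :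
    |P x| ≤ 2 * A / ρ + B * ρ := by
  set v : E2 := EuclideanSpace.single i 1 with hv
  have hvn : ‖v‖ = 1 := by simp [hv]
  have hl : ∀ p q : E2 → ℝ, ∀ y, lin (p y) (q y) v = (![p, q] i) y := by
    intro p q y
    rw [lin_apply, hv]; fin_cases i <;> simp
  have hm : ∀ t ∈ Icc (0:ℝ) ρ, x + t • v ∈ closedBall x ρ := by
    intro t ht
    simp [norm_smul, hvn, abs_of_nonneg ht.1, ht.2]
  have hl1 : ∀ t : ℝ, HasDerivAt (fun t : ℝ => x + t • v) v t := by
    intro t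
    simpa using ((hasDerivAt_id t).smul_const v).const_add x
  have d1 : ∀ t ∈ Icc (0:ℝ) ρ, HasDerivAt (fun t : ℝ => W (x + t • v)) (P (x + t • v)) t := by
    intro t ht
    have := (h1 _ (hm t ht)).comp_hasDerivAt t (hl1 t)
    rwa [hl b0 b1, ← hP] at this
  have d2 : ∀ t ∈ Icc (0:ℝ) ρ, HasDerivAt (fun t : ℝ => P (x + t • v)) (Q (x + t • v)) t := by
    intro t ht
    have := (h2 _ (hm t ht)).comp_hasDerivAt t (hl1 t)
    rwa [hl c0 c1, ← hQ] at this
  obtain ⟨ξ, hξ, e1⟩ := exists_hasDerivAt_eq_slope _ _ hρ (fun t ht => (d1 t ht).continuousAt.continuousWithinAt)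
    (fun t ht => d1 t (Ioo_subset_Icc_self ht))
  have hξ' : ∀ t ∈ Icc (0:ℝ) ξ, t ∈ Icc (0:ℝ) ρ := fun t ht => ⟨ht.1, ht.2.trans hξ.2.le⟩
  obtain ⟨η, hη, e2⟩ := exists_hasDerivAt_eq_slope _ _ hξ.1 (fun t ht => (d2 t (hξ' t ht)).continuousAt.continuousWithinAt)
    (fun t ht => d2 t (hξ' t (Ioo_subset_Icc_self ht)))
  simp only [zero_smul, add_zero, sub_zero] at e1 e2
  have b1 : |P (x + ξ • v)| ≤ 2 * A / ρ := by
    rw [e1, abs_div, abs_of_pos hρ]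
    have h3 := hA _ (hm ρ ⟨hρ.le, le_rfl⟩)
    have h4 := hA x (mem_closedBall_self hρ.le)
    have := abs_sub (W (x + ρ • v)) (W x)
    gcongr; linarith
  have b2 : |P (x + ξ • v) - P x| ≤ B * ρ := by
    have hξ0 := hξ.1
    have e3 : P (x + ξ • v) - P x = Q (x + η • v) * ξ := by rw [e2]; field_simp
    rw [e3, abs_mul, abs_of_pos hξ0]
    have h5 := hB _ (hm η (hξ' η (Ioo_subset_Icc_self hη)))
    have : 0 ≤ B := (abs_nonneg _).trans h5
    have := hξ.2.le
    gcongr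
  rw [abs_le] at *
  constructor <;> linarith

theorem ucs_lim {F : ℕ → E2 → ℝ} {s : Set E2} (h : ∀ ε > 0, ∃ N, ∀ m ≥ N, ∀ n ≥ N, ∀ x ∈ s, |F m x - F n x| ≤ ε) :
    ∃ f : E2 → ℝ, TendstoUniformlyOn F f atTop s := by
  have hu : UniformCauchySeqOn F atTop s := by
    rw [Metric.uniformCauchySeqOn_iff]
    intro ε hε
    obtain ⟨N, hN⟩ := h (ε / 2) (half_pos hε)
    exact ⟨N, fun m hm n hn x hx => by rw [Real.dist_eq]; exact (hN m hm n hn x hx).trans_lt (half_lt_self hε)⟩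
  have : ∀ x, ∃ a, x ∈ s → Tendsto (fun n => F n x) atTop (𝓝 a) := by
    intro x
    by_cases hx : x ∈ s
    · obtain ⟨a, ha⟩ := cauchySeq_tendsto_of_complete (hu.cauchySeq hx)
      exact ⟨a, fun _ => ha⟩
    · exact ⟨0, fun h => absurd h hx⟩
  choose f hf using this
  exact ⟨f, hu.tendstoUniformlyOn_of_tendsto (fun x hx => hf x hx)⟩

theorem lin_unif {a b : ℕ → E2 → ℝ} {a' b' : E2 → ℝ} {s : Set E2} (ha : TendstoUniformlyOn a a' atTop s)
    (hb : TendstoUniformlyOn b b' atTop s) :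
    TendstoUniformlyOn (fun n x => lin (a n x) (b n x)) (fun x => lin (a' x) (b' x)) atTop s := by
  rw [Metric.tendstoUniformlyOn_iff] at *
  intro ε hε
  filter_upwards [ha (ε / 2) (half_pos hε), hb (ε / 2) (half_pos hε)] with n h1 h2 x hx
  rw [dist_eq_norm, lin_sub]
  refine (lin_norm _ _).trans_lt ?_
  have h3 := h1 x hx
  have h4 := h2 x hx
  rw [Real.dist_eq] at h3 h4
  linarith

theorem Appr.cont {H : ℝ → ℝ → ℝ} {u : E2 → ℝ} {M : ℝ} {un : ℕ → E2 → ℝ} {e : ℕ → ℝ} (h : Appr H u M un e) :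
    ContinuousOn u (closedBall (0:E2) 1) := by
  have : TendstoUniformlyOn un u atTop (closedBall (0:E2) 1) := by
    rw [Metric.tendstoUniformlyOn_iff]
    intro ε hε
    filter_upwards [h.lim.eventually_lt_const hε] with n hn x hx
    rw [dist_comm, Real.dist_eq]
    exact (h.unif n x hx).trans_lt hn
  exact this.continuousOn (Frequently.of_forall fun n => (h.sm n).continuous.continuousOn)

theorem av_close {f : E2 → ℝ} (hf : Continuous f) (x : E2) {s c η : ℝ} (hs : 0 < s) (hη : 0 ≤ η)
    (h : ∀ y ∈ ball x s, |f y - c| ≤ η) : |av f x s - c| ≤ η := by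
  have hp := pi_pos
  refine abs_le_of_sq_le_sq ((av_sq hf x hs c).trans ?_) hη
  have : ∫ y in ball x s, (f y - c) ^ 2 ≤ ∫ y in ball x s, η ^ 2 := by
    refine mono_int (by fun_prop) continuous_const _ _ (fun y hy => ?_)
    rw [← sq_abs]; have := h y hy; gcongr
  rw [setIntegral_const, smul_eq_mul, Measure.real, vol_ball _ hs.le] at this
  calc _ ≤ (π * s ^ 2)⁻¹ * (π * s ^ 2 * η ^ 2) := by gcongr
    _ = _ := by field_simp

theorem Appr.avlim {H : ℝ → ℝ → ℝ} {u : E2 → ℝ} {M : ℝ} {un : ℕ → E2 → ℝ} {e : ℕ → ℝ} (h : Appr H u M un e)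
    {R : ℝ} (hR : R < 1) {η : ℝ} (hη : 0 < η) : ∃ ε > 0, ∀ n s, 0 < s → s ≤ ε → s ≤ (1 - R) / 16 → e n ≤ ε →
      ∀ x ∈ closedBall (0:E2) R, |av (un n) x s - u x| ≤ η := by
  have uc := (isCompact_closedBall (0:E2) 1).uniformContinuousOn_of_continuous h.cont
  rw [Metric.uniformContinuousOn_iff] at uc
  obtain ⟨δ, hδ, hu⟩ := uc (η / 2) (half_pos hη)
  refine ⟨min δ (η / 2), by positivity, ?_⟩
  intro n s hs hs1 hs2 hn x hx
  refine av_close (h.sm n).continuous x hs hη.le (fun y hy => ?_)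
  have hx1 : x ∈ closedBall (0:E2) 1 := closedBall_subset_closedBall hR.le hx
  have hy1 : y ∈ closedBall (0:E2) 1 := ball_subset_closedBall (subs_ball hx (R := 1) (by linarith) hy)
  have h1 := h.unif n y hy1
  have h2 := hu y hy1 x hx1 (lt_of_lt_of_le hy (hs1.trans (min_le_left _ _)))
  rw [Real.dist_eq] at h2
  have h3 := hn.trans (min_le_right _ _)
  rw [abs_le] at *
  rw [abs_lt] at h2
  constructor <;> linarith


theorem contDiffAt_lin {a b : E2 → ℝ} {x : E2} {n : WithTop ℕ∞} (ha : ContDiffAt ℝ n a x) (hb : ContDiffAt ℝ n b x) :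
    ContDiffAt ℝ n (fun y => lin (a y) (b y)) x := by
  unfold lin
  exact (ha.smul contDiffAt_const).add (hb.smul contDiffAt_const)

theorem av_hh {u : E2 → ℝ} (hu : Sm u) (x : E2) (s : ℝ) :
    av (hh u) x s = (av (dd 0 (dd 0 u)) x s + av (dd 1 (dd 1 u)) x s) / 2 := by
  rw [← av_add ((hu.dd 0).dd 0).continuous ((hu.dd 1).dd 1).continuous, ← av_div]; rfl
theorem av_aa {u : E2 → ℝ} (hu : Sm u) (x : E2) (s : ℝ) :
    av (aa u) x s = (av (dd 0 (dd 0 u)) x s - av (dd 1 (dd 1 u)) x s) / 2 := by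
  rw [← av_sub ((hu.dd 0).dd 0).continuous ((hu.dd 1).dd 1).continuous, ← av_div]; rfl

set_option maxHeartbeats 1000000 in
theorem reg {r R k : ℝ} (hr : 0 < r) (hrR : r < R) (hR1 : R < 1) (hk0 : 0 ≤ k) (hk : k < 1) :
    ∃ C, 0 < C ∧ ∀ (H : ℝ → ℝ → ℝ) (u : E2 → ℝ) (M : ℝ) (un : ℕ → E2 → ℝ) (e : ℕ → ℝ), LipH k H → Appr H u M un e →
      (∀ x ∈ ball (0:E2) r, ContDiffAt ℝ 2 u x ∧ ‖fderiv ℝ u x‖ ≤ C * M ∧ (∀ i j, |hess u x i j| ≤ C * M) ∧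
        hh u x = H (aa u x) (bb u x)) ∧
      (∀ x ∈ ball (0:E2) r, ∀ x' ∈ ball (0:E2) r, ∀ i j,
        |hess u x i j - hess u x' i j| ≤ C * M * ‖x - x'‖ ^ (bet k / 2)) := by
  obtain ⟨C, hC, c⟩ := lim2 (r := R) (by linarith) hR1 hk0 hk
  set ρ := R - r with hρ
  have hρ0 : 0 < ρ := by rw [hρ]; linarith
  refine ⟨C + 2 * (2 / ρ + C * ρ), by positivity, ?_⟩
  intro H u M un e hH ha
  have hM := ha.M0
  obtain ⟨G, g1, g2, g3, g4⟩ := c H u M un e hH ha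
  have hα : 0 < bet k / 2 := half_pos (bet_pos hk)
  choose N S hS0 hS1 hS2 hN hT using fun j : ℕ => g4 (1 / ((j:ℝ) + 1)) (by positivity)
  set g : Fin 2 → Fin 2 → E2 → ℝ := fun i j => G (fun u => dd i (dd j u)) with hg
  set W : ℕ → E2 → ℝ := fun j x => av (un (N j)) x (S j) with hW
  set P : Fin 2 → ℕ → E2 → ℝ := fun i j x => av (dd i (un (N j))) x (S j) with hP
  set Q : Fin 2 → Fin 2 → ℕ → E2 → ℝ := fun i l j x => av (dd i (dd l (un (N j)))) x (S j) with hQ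
  have eps : Tendsto (fun j : ℕ => 1 / ((j:ℝ) + 1)) atTop (𝓝 0) := tendsto_one_div_add_atTop_nhds_zero_nat
  have dW : ∀ j x, HasFDerivAt (W j) (lin (P 0 j x) (P 1 j x)) x := fun j x => av_hasFDeriv (ha.sm _) _ x
  have dP : ∀ i j x, HasFDerivAt (P i j) (lin (Q 0 i j x) (Q 1 i j x)) x := fun i j x => av_hasFDeriv ((ha.sm _).dd i) _ x
  have Qc : ∀ i l j, ∀ x ∈ closedBall (0:E2) R, |Q i l j x - g i l x| ≤ 1 / ((j:ℝ) + 1) :=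
    fun i l j x hx => hT j _ (Op_dd i l) x hx
  have Wc : ∀ η > 0, ∃ n0, ∀ j ≥ n0, ∀ x ∈ closedBall (0:E2) R, |W j x - u x| ≤ η := by
    intro η hη
    obtain ⟨ε, hε, h⟩ := ha.avlim hR1 hη
    obtain ⟨n0, h0⟩ := (eps.eventually_lt_const hε).exists_forall_of_atTop
    exact ⟨n0, fun j hj x hx => h (N j) (S j) (hS0 j) ((hS1 j).trans (h0 j hj).le) (hS2 j) ((hN j).trans (h0 j hj).le) x hx⟩
  have sub : ∀ x ∈ ball (0:E2) r, closedBall x ρ ⊆ closedBall (0:E2) R := by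
    intro x hx
    refine closedBall_subset_closedBall' ?_
    rw [mem_ball] at hx; linarith
  have sub2 : ball (0:E2) r ⊆ closedBall (0:E2) R := fun x hx => sub x hx (mem_closedBall_self hρ0.le)
  -- gradients converge
  have Pc : ∀ i, ∃ p : E2 → ℝ, TendstoUniformlyOn (P i) p atTop (ball (0:E2) r) := by
    intro i
    refine ucs_lim fun ε hε => ?_
    set η := ε * ρ / 8 with hη
    obtain ⟨n0, h0⟩ := Wc η (by positivity)
    obtain ⟨n1, h1⟩ := (eps.eventually_lt_const (show 0 < ε / (4 * ρ) by positivity)).exists_forall_of_atTop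
    refine ⟨max n0 n1, fun m hm n hn x hx => ?_⟩
    have key := interp (W := fun y => W m y - W n y) (P := fun y => P i m y - P i n y) (Q := fun y => Q i i m y - Q i i n y)
      (b0 := fun y => P 0 m y - P 0 n y) (b1 := fun y => P 1 m y - P 1 n y)
      (c0 := fun y => Q 0 i m y - Q 0 i n y) (c1 := fun y => Q 1 i m y - Q 1 i n y)
      (A := 2 * η) (B := 2 * (ε / (4 * ρ))) hρ0 i x
      (fun y _ => by have := (dW m y).sub (dW n y); rwa [lin_sub] at this)
      (fun y _ => by have := (dP i m y).sub (dP i n y); rwa [lin_sub] at this)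
      (by fin_cases i <;> rfl) (by fin_cases i <;> rfl)
      (fun y hy => by
        have a1 := h0 m ((le_max_left _ _).trans hm) y (sub x hx hy)
        have a2 := h0 n ((le_max_left _ _).trans hn) y (sub x hx hy)
        rw [abs_le] at *; constructor <;> linarith)
      (fun y hy => by
        have a1 := Qc i i m y (sub x hx hy)
        have a2 := Qc i i n y (sub x hx hy)
        have b1 := h1 m ((le_max_right _ _).trans hm)
        have b2 := h1 n ((le_max_right _ _).trans hn)
        rw [abs_le] at *; constructor <;> linarith)
    refine key.trans (le_of_eq ?_)
    rw [hη]; field_simp; ring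
  choose p hp using Pc
  have Qt : ∀ i l, TendstoUniformlyOn (Q i l) (g i l) atTop (ball (0:E2) r) := by
    intro i l
    rw [Metric.tendstoUniformlyOn_iff]
    intro ε hε
    filter_upwards [eps.eventually_lt_const hε] with j hj x hx
    rw [dist_comm, Real.dist_eq]
    exact (Qc i l j x (sub2 hx)).trans_lt hj
  have Wt : ∀ x ∈ ball (0:E2) r, Tendsto (fun j => W j x) atTop (𝓝 (u x)) := by
    intro x hx
    rw [Metric.tendsto_atTop]
    intro ε hε
    obtain ⟨n0, h0⟩ := Wc (ε / 2) (half_pos hε)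
    exact ⟨n0, fun n hn => by rw [Real.dist_eq]; exact (h0 n hn x (sub2 hx)).trans_lt (half_lt_self hε)⟩
  have du : ∀ x ∈ ball (0:E2) r, HasFDerivAt u (lin (p 0 x) (p 1 x)) x := fun x hx =>
    hasFDerivAt_of_tendstoUniformlyOn isOpen_ball (lin_unif (hp 0) (hp 1)) (fun j y _ => dW j y) Wt hx
  have dp : ∀ i, ∀ x ∈ ball (0:E2) r, HasFDerivAt (p i) (lin (g 0 i x) (g 1 i x)) x := fun i x hx =>
    hasFDerivAt_of_tendstoUniformlyOn isOpen_ball (lin_unif (Qt 0 i) (Qt 1 i)) (fun j y _ => dP i j y)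
      (fun y hy => (hp i).tendsto_at hy) hx
  have gH : ∀ i l, ∀ x ∈ ball (0:E2) r, ∀ x' ∈ ball (0:E2) r, |g i l x - g i l x'| ≤ C * M * ‖x - x'‖ ^ (bet k / 2) :=
    fun i l x hx x' hx' => g2 _ (Op_dd i l) x (sub2 hx) x' (sub2 hx')
  have gB : ∀ i l, ∀ x ∈ ball (0:E2) r, |g i l x| ≤ C * M := fun i l x hx => g1 _ (Op_dd i l) x (sub2 hx)
  have gc : ∀ i l, ContinuousOn (g i l) (ball (0:E2) r) := by
    intro i l x hx
    have t1 : Tendsto (fun y : E2 => C * M * ‖y - x‖ ^ (bet k / 2)) (𝓝[ball (0:E2) r] x) (𝓝 (C * M * ‖x - x‖ ^ (bet k / 2))) := by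
      have : Continuous (fun y : E2 => C * M * ‖y - x‖ ^ (bet k / 2)) :=
        continuous_const.mul ((continuous_id.sub continuous_const).norm.rpow_const (fun _ => Or.inr hα.le))
      exact this.continuousWithinAt
    rw [sub_self, norm_zero, zero_rpow hα.ne', mul_zero] at t1
    refine tendsto_iff_dist_tendsto_zero.2 (squeeze_zero' (Eventually.of_forall fun _ => dist_nonneg) ?_ t1)
    filter_upwards [self_mem_nhdsWithin] with y hy
    rw [Real.dist_eq]; exact gH i l y hy x hx
  have cd : ∀ x ∈ ball (0:E2) r, ContDiffAt ℝ 2 u x := by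
    intro x hx
    have hn : ball (0:E2) r ∈ 𝓝 x := isOpen_ball.mem_nhds hx
    have g0 : ∀ i l, ContDiffAt ℝ ((0:ℕ):WithTop ℕ∞) (g i l) x := by
      intro i l
      exact contDiffAt_zero.2 ⟨ball (0:E2) r, hn, gc i l⟩
    have p1 : ∀ i, ContDiffAt ℝ ((1:ℕ):WithTop ℕ∞) (p i) x := by
      intro i
      have := (contDiffAt_succ_iff_hasFDerivAt (𝕜 := ℝ) (n := 0) (f := p i) (x := x)).2
        ⟨fun y => lin (g 0 i y) (g 1 i y), ⟨ball (0:E2) r, hn, fun y hy => dp i y hy⟩, contDiffAt_lin (g0 0 i) (g0 1 i)⟩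
      simpa using this
    have := (contDiffAt_succ_iff_hasFDerivAt (𝕜 := ℝ) (n := 1) (f := u) (x := x)).2
        ⟨fun y => lin (p 0 y) (p 1 y), ⟨ball (0:E2) r, hn, fun y hy => du y hy⟩, contDiffAt_lin (p1 0) (p1 1)⟩
    have e2 : (((1:ℕ):WithTop ℕ∞) + 1) = 2 := by norm_num
    rwa [e2] at this
  have ddu : ∀ j, ∀ x ∈ ball (0:E2) r, dd j u x = p j x := by
    intro j x hx
    unfold dd; rw [(du x hx).fderiv, lin_apply]
    fin_cases j <;> simp
  have he : ∀ i j, ∀ x ∈ ball (0:E2) r, hess u x i j = g i j x := by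
    intro i j x hx
    rw [hess_apply]
    have hn : ball (0:E2) r ∈ 𝓝 x := isOpen_ball.mem_nhds hx
    have : HasFDerivAt (dd j u) (lin (g 0 j x) (g 1 j x)) x :=
      (dp j x hx).congr_of_eventuallyEq (by filter_upwards [hn] with y hy using ddu j y hy)
    change fderiv ℝ (dd j u) x _ = _
    rw [this.fderiv, lin_apply]
    fin_cases i <;> simp
  have pB : ∀ i, ∀ x ∈ ball (0:E2) r, |p i x| ≤ 2 * M / ρ + C * M * ρ := by
    intro i x hx
    have t1 : Tendsto (fun j => |P i j x|) atTop (𝓝 |p i x|) := ((hp i).tendsto_at hx).abs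
    refine le_of_forall_pos_le_add fun η hη => ?_
    refine le_of_tendsto t1 ?_
    set η' := η / (2 / ρ + ρ) with hη'
    have hη'0 : 0 < η' := by positivity
    obtain ⟨n0, h0⟩ := Wc η' hη'0
    filter_upwards [eventually_ge_atTop n0, eps.eventually_lt_const hη'0] with j hj hj2
    have key := interp (W := W j) (P := P i j) (Q := Q i i j)
      (b0 := P 0 j) (b1 := P 1 j)
      (c0 := Q 0 i j) (c1 := Q 1 i j)
      (A := M + η') (B := C * M + η') hρ0 i x
      (fun y _ => dW j y)
      (fun y _ => dP i j y)
      (by fin_cases i <;> rfl) (by fin_cases i <;> rfl)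
      (fun y hy => by
        have a1 := h0 j hj y (sub x hx hy)
        have a2 := ha.bd y (closedBall_subset_closedBall hR1.le (sub x hx hy))
        rw [abs_le] at *; constructor <;> linarith)
      (fun y hy => by
        have a1 := Qc i i j y (sub x hx hy)
        have a2 := g1 _ (Op_dd i i) y (sub x hx hy)
        change |g i i y| ≤ _ at a2
        rw [abs_le] at *; constructor <;> linarith)
    refine key.trans (le_of_eq ?_)
    have : 2 * (M + η') / ρ + (C * M + η') * ρ = 2 * M / ρ + C * M * ρ + η' * (2 / ρ + ρ) := by ring
    rw [this, hη', div_mul_cancel₀]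
    positivity
  have Ghh : ∀ x ∈ ball (0:E2) r, G hh x = (g 0 0 x + g 1 1 x) / 2 ∧ G aa x = (g 0 0 x - g 1 1 x) / 2 := by
    intro x hx
    have t0 : Tendsto (fun j => av (hh (un (N j))) x (S j)) atTop (𝓝 (G hh x)) := by
      rw [tendsto_iff_dist_tendsto_zero]
      exact squeeze_zero (fun _ => dist_nonneg) (fun j => hT j hh Op_hh x (sub2 hx)) eps
    have t1 : Tendsto (fun j => av (aa (un (N j))) x (S j)) atTop (𝓝 (G aa x)) := by
      rw [tendsto_iff_dist_tendsto_zero]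
      exact squeeze_zero (fun _ => dist_nonneg) (fun j => hT j aa Op_aa x (sub2 hx)) eps
    have s0 := (Qt 0 0).tendsto_at hx
    have s1 := (Qt 1 1).tendsto_at hx
    have t0' : Tendsto (fun j => av (hh (un (N j))) x (S j)) atTop (𝓝 ((g 0 0 x + g 1 1 x) / 2)) := by
      simp only [av_hh (ha.sm _)]
      exact (s0.add s1).div_const 2
    have t1' : Tendsto (fun j => av (aa (un (N j))) x (S j)) atTop (𝓝 ((g 0 0 x - g 1 1 x) / 2)) := by
      simp only [av_aa (ha.sm _)]
      exact (s0.sub s1).div_const 2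
    exact ⟨tendsto_nhds_unique t0 t0', tendsto_nhds_unique t1 t1'⟩
  have hpos : 0 ≤ 2 * (2 / ρ + C * ρ) * M := by positivity
  refine ⟨fun x hx => ⟨cd x hx, ?_, ?_, ?_⟩, ?_⟩
  · rw [(du x hx).fderiv]
    refine (lin_norm _ _).trans ?_
    have h0 := pB 0 x hx
    have h1 := pB 1 x hx
    have : (C + 2 * (2 / ρ + C * ρ)) * M = C * M + 2 * (2 * M / ρ + C * M * ρ) := by ring
    rw [this]
    have : 0 ≤ C * M := by positivity
    linarith
  · intro i j
    rw [he i j x hx, add_mul]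
    have := gB i j x hx
    linarith
  · have e3 := g3 x (sub2 hx)
    rw [(Ghh x hx).1, (Ghh x hx).2] at e3
    have e4 : bb u x = g 0 1 x := he 0 1 x hx
    have e5 : dd 0 (dd 0 u) x = g 0 0 x := he 0 0 x hx
    have e6 : dd 1 (dd 1 u) x = g 1 1 x := he 1 1 x hx
    rw [e4]; unfold hh aa
    rw [e5, e6]; exact e3
  · intro x hx x' hx' i j
    rw [he i j x hx, he i j x' hx']
    refine (gH i j x hx x' hx').trans ?_
    have : 0 ≤ ‖x - x'‖ ^ (bet k / 2) := by positivity
    gcongr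
    have : 0 < 2 * (2 / ρ + C * ρ) := by positivity
    linarith


/-! ### Stone–Weierstrass and solvability of the Poisson problem for polynomials -/

def r2 (x : E2) : ℝ := x 0 * x 0 + x 1 * x 1
theorem Sm_r2 : Sm r2 := ((Sm.coord 0).mul (Sm.coord 0)).add ((Sm.coord 1).mul (Sm.coord 1))
theorem dd_r2 (i : Fin 2) : dd i r2 = fun x => 2 * x i := by
  have : r2 = fun x : E2 => (fun x : E2 => x 0 * x 0) x + (fun x : E2 => x 1 * x 1) x := rfl
  rw [this, dd_add ((Sm.coord 0).mul (Sm.coord 0)) ((Sm.coord 1).mul (Sm.coord 1)),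
    dd_mul (Sm.coord 0) (Sm.coord 0), dd_mul (Sm.coord 1) (Sm.coord 1), dd_coord, dd_coord]
  funext x
  fin_cases i <;> simp <;> ring

/-- Pairs `(Re zⁿ, Im zⁿ)`. -/
def zp : ℕ → (E2 → ℝ) × (E2 → ℝ)
  | 0 => (fun _ => 1, fun _ => 0)
  | n + 1 => (fun x => x 0 * (zp n).1 x - x 1 * (zp n).2 x, fun x => x 0 * (zp n).2 x + x 1 * (zp n).1 x)

structure CR (n : ℕ) (p : (E2 → ℝ) × (E2 → ℝ)) : Prop where
  s1 : Sm p.1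
  s2 : Sm p.2
  cr1 : ∀ x, dd 0 p.1 x = dd 1 p.2 x
  cr2 : ∀ x, dd 1 p.1 x = - dd 0 p.2 x
  e1 : ∀ x : E2, x 0 * dd 0 p.1 x + x 1 * dd 1 p.1 x = n * p.1 x
  e2 : ∀ x : E2, x 0 * dd 0 p.2 x + x 1 * dd 1 p.2 x = n * p.2 x

theorem dd_re {a b : E2 → ℝ} (ha : Sm a) (hb : Sm b) (i : Fin 2) (x : E2) :
    dd i (fun x => x 0 * a x - x 1 * b x) x
      = (x 0 * dd i a x + a x * (if (0 : Fin 2) = i then 1 else 0)) - (x 1 * dd i b x + b x * (if (1 : Fin 2) = i then 1 else 0)) := by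
  rw [dd_sub ((Sm.coord 0).mul ha) ((Sm.coord 1).mul hb),
    dd_mul (Sm.coord 0) ha, dd_mul (Sm.coord 1) hb, dd_coord, dd_coord]
theorem dd_im {a b : E2 → ℝ} (ha : Sm a) (hb : Sm b) (i : Fin 2) (x : E2) :
    dd i (fun x => x 0 * a x + x 1 * b x) x
      = (x 0 * dd i a x + a x * (if (0 : Fin 2) = i then 1 else 0)) + (x 1 * dd i b x + b x * (if (1 : Fin 2) = i then 1 else 0)) := by
  rw [dd_add ((Sm.coord 0).mul ha) ((Sm.coord 1).mul hb),
    dd_mul (Sm.coord 0) ha, dd_mul (Sm.coord 1) hb, dd_coord, dd_coord]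

theorem CR_zp (n : ℕ) : CR n (zp n) := by
  induction n with
  | zero => 
    constructor <;> simp [zp, dd_const, Sm.const]
  | succ n ih =>
    obtain ⟨s1, s2, c1, c2, e1, e2⟩ := ih
    constructor
    · exact ((Sm.coord 0).mul s1).sub ((Sm.coord 1).mul s2)
    · exact ((Sm.coord 0).mul s2).add ((Sm.coord 1).mul s1)
    · intro x
      simp only [zp, dd_re s1 s2, dd_im s2 s1, c1, c2]; simp; ring
    · intro x
      simp only [zp, dd_re s1 s2, dd_im s2 s1, c1, c2]; simp; ring
    · intro x
      simp only [zp, dd_re s1 s2]; simp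
      linear_combination x 0 * e1 x - x 1 * e2 x
    · intro x
      simp only [zp, dd_im s2 s1]; simp
      linear_combination x 0 * e2 x + x 1 * e1 x

structure Eu (d : ℕ) (f : E2 → ℝ) : Prop where
  s : Sm f
  e : ∀ x : E2, x 0 * dd 0 f x + x 1 * dd 1 f x = d * f x

theorem dd_r2mul {f : E2 → ℝ} (hf : Sm f) (i : Fin 2) :
    dd i (fun x => r2 x * f x) = fun x => r2 x * dd i f x + f x * (2 * x i) := by
  rw [dd_mul Sm_r2 hf, dd_r2]

theorem Eu.mul {d : ℕ} {f : E2 → ℝ} (h : Eu d f) : Eu (d + 2) (fun x => r2 x * f x) := by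
  refine ⟨Sm_r2.mul h.s, fun x => ?_⟩
  rw [dd_r2mul h.s, dd_r2mul h.s]
  push_cast
  have := h.e x
  simp only [r2]
  linear_combination (x 0 * x 0 + x 1 * x 1) * this

theorem dd2_r2mul {f : E2 → ℝ} (hf : Sm f) (i : Fin 2) (x : E2) :
    dd i (dd i (fun x => r2 x * f x)) x
      = r2 x * dd i (dd i f) x + 4 * x i * dd i f x + 2 * f x := by
  rw [dd_r2mul hf, dd_add (f := fun x => r2 x * dd i f x) (g := fun x => f x * (2 * x i))
    (Sm_r2.mul (hf.dd i)) (hf.mul ((Sm.const 2).mul (Sm.coord i))),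
    dd_r2mul (hf.dd i), dd_mul (g := fun x : E2 => 2 * x i) hf ((Sm.const 2).mul (Sm.coord i)),
    dd_mul (f := fun x : E2 => (2:ℝ)) (Sm.const 2) (Sm.coord i), dd_const, dd_coord]
  simp; ring

theorem hh_r2mul {d : ℕ} {f : E2 → ℝ} (h : Eu d f) (x : E2) :
    hh (fun x => r2 x * f x) x = r2 x * hh f x + (2 * d + 2) * f x := by
  simp only [hh, dd2_r2mul h.s]
  linear_combination 2 * h.e x

theorem Eu.rpow {d : ℕ} {f : E2 → ℝ} (h : Eu d f) (m : ℕ) : Eu (d + 2 * m) (fun x => r2 x ^ m * f x) := by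
  induction m with
  | zero => simpa using h
  | succ m ih => 
    have := ih.mul
    have e : (fun x => r2 x ^ (m+1) * f x) = fun x => r2 x * (r2 x ^ m * f x) := by funext x; ring
    rw [e]; exact this

theorem hh_rpow {d : ℕ} {f : E2 → ℝ} (h : Eu d f) (h0 : ∀ x, hh f x = 0) (m : ℕ) (x : E2) :
    hh (fun x => r2 x ^ (m + 1) * f x) x = 2 * (m + 1) * (m + 1 + d) * (r2 x ^ m * f x) := by
  induction m with
  | zero => 
    have := hh_r2mul h x
    simp only [zero_add, pow_one, this, h0]; push_cast; ring
  | succ m ih =>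
    have e : (fun x => r2 x ^ (m+1+1) * f x) = fun x => r2 x * (r2 x ^ (m+1) * f x) := by funext x; ring
    rw [e, hh_r2mul (h.rpow (m+1)), ih]
    push_cast; ring

def Solv (f : E2 → ℝ) : Prop := ∃ v, Sm v ∧ (∀ x ∈ sphere (0:E2) 1, v x = 0) ∧ ∀ x, hh v x = f x

theorem hh_add {u v : E2 → ℝ} (hu : Sm u) (hv : Sm v) (x : E2) :
    hh (fun y => u y + v y) x = hh u x + hh v x := by
  simp only [hh]
  rw [dd_add hu hv, dd_add hu hv, dd_add (hu.dd 0) (hv.dd 0), dd_add (hu.dd 1) (hv.dd 1)]; ring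

theorem hh_smul {u : E2 → ℝ} (hu : Sm u) (c : ℝ) (x : E2) :
    hh (fun y => c * u y) x = c * hh u x := by
  simp only [hh]
  have h : ∀ i {u : E2 → ℝ}, Sm u → dd i (fun y => c * u y) = fun y => c * dd i u y := by
    intro i u hu
    rw [dd_mul (f := fun _ => c) (Sm.const c) hu, dd_const]; funext y; ring
  rw [h _ hu, h _ hu, h _ (hu.dd 0), h _ (hu.dd 1)]; ring

theorem solv_mono {d : ℕ} {f : E2 → ℝ} (h : Eu d f) (h0 : ∀ x, hh f x = 0) (m : ℕ) :
    Solv (fun x => r2 x ^ m * f x) := by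
  have hne : (2 * ((m:ℝ) + 1) * (m + 1 + d)) ≠ 0 := by positivity
  refine ⟨fun x => (2 * ((m:ℝ) + 1) * (m + 1 + d))⁻¹ * (r2 x ^ (m+1) * f x - f x), ?_, ?_, ?_⟩
  · exact (Sm.const _).mul ((h.rpow (m+1)).s.sub h.s)
  · intro x hx
    have : r2 x = 1 := by
      have : ‖x‖ ^ 2 = 1 := by rw [mem_sphere_zero_iff_norm] at hx; rw [hx]; norm_num
      rw [norm_sq_E2] at this; simp only [r2]; linarith
    simp [this]
  · intro x
    rw [hh_smul ((h.rpow (m+1)).s.sub h.s), hh_sub (h.rpow (m+1)).s h.s, hh_rpow h h0, h0]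
    field_simp; ring

theorem CR.harm {n : ℕ} {p} (h : CR n p) : (∀ x, hh p.1 x = 0) ∧ (∀ x, hh p.2 x = 0) := by
  have a1 : dd 0 p.1 = dd 1 p.2 := funext h.cr1
  have n1 : ∀ i x, dd i (fun y => - dd 0 p.2 y) x = - dd i (dd 0 p.2) x := by
    intro i x
    have := congrFun (dd_sub (Sm.const 0) (h.s2.dd 0) i) x
    simpa [dd_const] using this
  have a2 : dd 1 p.1 = fun x => - dd 0 p.2 x := funext h.cr2
  have n2 : ∀ i x, dd i (fun y => - dd 1 p.1 y) x = - dd i (dd 1 p.1) x := by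
    intro i x
    have := congrFun (dd_sub (Sm.const 0) (h.s1.dd 1) i) x
    simpa [dd_const] using this
  have a3 : dd 0 p.2 = fun x => - dd 1 p.1 x := by funext x; rw [h.cr2]; ring
  constructor
  · intro x; simp only [hh]; rw [a1, a2, n1, dd_comm h.s2]; ring
  · intro x; simp only [hh]; rw [← a1, a3, n2, dd_comm h.s1]; ring

def Tsp : Submodule ℝ (E2 → ℝ) :=
  Submodule.span ℝ {f | ∃ m n : ℕ, f = (fun x => r2 x ^ m * (zp n).1 x) ∨ f = (fun x => r2 x ^ m * (zp n).2 x)}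

theorem solv_Tsp {f : E2 → ℝ} (hf : f ∈ Tsp) : Solv f := by
  induction hf using Submodule.span_induction with
  | mem f hf =>
    obtain ⟨m, n, rfl | rfl⟩ := hf
    · exact solv_mono ⟨(CR_zp n).s1, (CR_zp n).e1⟩ (CR_zp n).harm.1 m
    · exact solv_mono ⟨(CR_zp n).s2, (CR_zp n).e2⟩ (CR_zp n).harm.2 m
  | zero => 
    refine ⟨fun _ => 0, Sm.const 0, by simp, fun x => ?_⟩
    simp [hh, dd_const]
  | add f g _ _ hf hg =>
    obtain ⟨v, a, b, c⟩ := hf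
    obtain ⟨w, a', b', c'⟩ := hg
    refine ⟨fun x => v x + w x, a.add a', fun x hx => by simp [b x hx, b' x hx], fun x => ?_⟩
    rw [hh_add a a', c, c']; rfl
  | smul t f _ hf =>
    obtain ⟨v, a, b, c⟩ := hf
    refine ⟨fun x => t * v x, (Sm.const t).mul a, fun x hx => by simp [b x hx], fun x => ?_⟩
    rw [hh_smul a, c]; rfl

def PX : E2 → ℝ := fun x => x 0
def PY : E2 → ℝ := fun x => x 1

theorem Tsp_a (m n : ℕ) : (fun x => r2 x ^ m * (zp n).1 x) ∈ Tsp := Submodule.subset_span ⟨m, n, Or.inl rfl⟩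
theorem Tsp_b (m n : ℕ) : (fun x => r2 x ^ m * (zp n).2 x) ∈ Tsp := Submodule.subset_span ⟨m, n, Or.inr rfl⟩

theorem Tsp_gen (s : E2 → ℝ) (hs : s = PX ∨ s = PY) {t : E2 → ℝ} (ht : t ∈ Tsp) : s * t ∈ Tsp := by
  induction ht using Submodule.span_induction with
  | zero => simp
  | add f g _ _ hf hg => rw [mul_add]; exact Tsp.add_mem hf hg
  | smul c f _ hf => rw [mul_smul_comm]; exact Tsp.smul_mem c hf
  | mem f hf =>
    obtain ⟨m, n, hf⟩ := hf
    cases n with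
    | zero =>
      rcases hf with rfl | rfl <;> rcases hs with rfl | rfl
      · convert Tsp_a m 1 using 1
        funext x; simp [PX, zp]; ring
      · convert Tsp_b m 1 using 1
        funext x; simp [PY, zp]; ring
      · convert Tsp.zero_mem using 1
        funext x; simp [zp]
      · convert Tsp.zero_mem using 1
        funext x; simp [zp]
    | succ n =>
      rcases hf with rfl | rfl <;> rcases hs with rfl | rfl
      · convert Tsp.smul_mem (1/2) (Tsp.add_mem (Tsp_a m (n+2)) (Tsp_a (m+1) n)) using 1
        funext x; simp [PX, zp, pow_succ]; simp only [r2]; ring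
      · convert Tsp.smul_mem (1/2) (Tsp.sub_mem (Tsp_b m (n+2)) (Tsp_b (m+1) n)) using 1
        funext x; simp [PY, zp, pow_succ]; simp only [r2]; ring
      · convert Tsp.smul_mem (1/2) (Tsp.add_mem (Tsp_b m (n+2)) (Tsp_b (m+1) n)) using 1
        funext x; simp [PX, zp, pow_succ]; simp only [r2]; ring
      · convert Tsp.smul_mem (1/2) (Tsp.sub_mem (Tsp_a (m+1) n) (Tsp_a m (n+2))) using 1
        funext x; simp [PY, zp, pow_succ]; simp only [r2]; ring

def Pol : Subalgebra ℝ (E2 → ℝ) := Algebra.adjoin ℝ {PX, PY}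

theorem Pol_mul {p : E2 → ℝ} (hp : p ∈ Pol) : ∀ t ∈ Tsp, p * t ∈ Tsp := by
  induction hp using Algebra.adjoin_induction with
  | mem s hs => exact fun t ht => Tsp_gen s (by simpa using hs) ht
  | algebraMap c => intro t ht; rw [← Algebra.smul_def]; exact Tsp.smul_mem c ht
  | add p q _ _ hp hq => intro t ht; rw [add_mul]; exact Tsp.add_mem (hp t ht) (hq t ht)
  | mul p q _ _ hp hq => intro t ht; rw [mul_assoc]; exact hp _ (hq t ht)

theorem Pol_solv {p : E2 → ℝ} (hp : p ∈ Pol) : Solv p := by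
  have h1 : (1 : E2 → ℝ) ∈ Tsp := by
    convert Tsp_a 0 0 using 1
    funext x; simp [zp]
  have := Pol_mul hp 1 h1
  rw [mul_one] at this
  exact solv_Tsp this

theorem Pol_sm {p : E2 → ℝ} (hp : p ∈ Pol) : Sm p := by
  induction hp using Algebra.adjoin_induction with
  | mem s hs => 
    rcases (by simpa using hs : s = PX ∨ s = PY) with rfl | rfl
    · exact Sm.coord 0
    · exact Sm.coord 1
  | algebraMap c => exact Sm.const c
  | add p q _ _ hp hq => exact hp.add hq
  | mul p q _ _ hp hq => exact hp.mul hq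

theorem stone {K : Set E2} (hK : IsCompact K) {φ : E2 → ℝ} (hφ : ContinuousOn φ K) {ε : ℝ} (hε : 0 < ε) :
    ∃ p ∈ Pol, ∀ x ∈ K, |p x - φ x| < ε := by
  have : CompactSpace K := isCompact_iff_compactSpace.mp hK
  let A : Subalgebra ℝ C(K, ℝ) :=
    { carrier := {f | ∃ p ∈ Pol, ∀ x : K, f x = p x}
      mul_mem' := by
        rintro f g ⟨p, hp, h⟩ ⟨q, hq, h'⟩
        exact ⟨p * q, Pol.mul_mem hp hq, fun x => by simp [h, h']⟩
      add_mem' := by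
        rintro f g ⟨p, hp, h⟩ ⟨q, hq, h'⟩
        exact ⟨p + q, Pol.add_mem hp hq, fun x => by simp [h, h']⟩
      algebraMap_mem' := fun c => ⟨algebraMap ℝ _ c, Pol.algebraMap_mem c, fun x => rfl⟩ }
  have hsep : A.SeparatesPoints := by
    intro x y hxy
    by_contra hcon
    push Not at hcon
    apply hxy
    have h0 := hcon (fun z : K => (z : E2) 0) ⟨⟨fun z : K => (z : E2) 0, by fun_prop⟩, ⟨PX, Algebra.subset_adjoin (by simp), fun x => rfl⟩, rfl⟩
    have h1 := hcon (fun z : K => (z : E2) 1) ⟨⟨fun z : K => (z : E2) 1, by fun_prop⟩, ⟨PY, Algebra.subset_adjoin (by simp), fun x => rfl⟩, rfl⟩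
    ext i; fin_cases i
    · exact h0
    · exact h1
  obtain ⟨⟨f, p, hp, h⟩, hf⟩ := ContinuousMap.exists_mem_subalgebra_near_continuousMap_of_separatesPoints A hsep
    ⟨K.domRestrict φ, hφ.domRestrict⟩ ε hε
  refine ⟨p, hp, fun x hx => ?_⟩
  have := (ContinuousMap.norm_coe_le_norm _ (⟨x, hx⟩ : K)).trans_lt hf
  have h2 : ‖f ⟨x, hx⟩ - φ x‖ < ε := this
  rw [h, Real.norm_eq_abs] at h2
  exact h2


/-! ### Approximate solutions with smooth boundary data -/

theorem poisson {φ : E2 → ℝ} (hφ : Continuous φ) {δ : ℝ} (hδ : 0 < δ) :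
    ∃ v, Sm v ∧ (∀ x ∈ sphere (0:E2) 1, v x = 0) ∧ ∀ x ∈ closedBall (0:E2) 1, |hh v x - φ x| ≤ δ := by
  obtain ⟨p, hp, h⟩ := stone (isCompact_closedBall (0:E2) 1) hφ.continuousOn hδ
  obtain ⟨v, a, b, c⟩ := Pol_solv hp
  exact ⟨v, a, b, fun x hx => by rw [c]; exact (h x hx).le⟩

theorem young {s : ℝ} (hs : 0 < s) (a b : ℝ) : (a + b) ^ 2 ≤ (1 + s) * a ^ 2 + (1 + 1 / s) * b ^ 2 := by
  have : (1 + s) * a ^ 2 + (1 + 1 / s) * b ^ 2 - (a + b) ^ 2 = (s * a - b) ^ 2 / s := by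
    field_simp; ring
  have h2 : 0 ≤ (s * a - b) ^ 2 / s := by positivity
  linarith

theorem contr_step {k s : ℝ} (hk0 : 0 ≤ k) (hk : k < 1) (hs : 0 < s) {H : ℝ → ℝ → ℝ} (hH : LipH k H)
    {p u : E2 → ℝ} (hp : Sm p) (hu : Sm u) (hup : ∀ x ∈ sphere (0:E2) 1, u x = p x) {η : ℝ} (hη : 0 < η) :
    ∃ w, Sm w ∧ (∀ x ∈ sphere (0:E2) 1, w x = p x) ∧
      ∫ y in ball (0:E2) 1, res H w y ^ 2 ≤ (1 + s) ^ 2 * k * (∫ y in ball (0:E2) 1, res H u y ^ 2) + η := by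
  set B := (1 + s) * k * (1 + 1 / s) + (1 + 1 / s) with hB
  have hB0 : 0 < B := by positivity
  set δ := √(η / (B * π)) with hδ
  have hδ0 : 0 < δ := Real.sqrt_pos.mpr (by positivity)
  have hδ2 : B * (π * δ ^ 2) = η := by
    rw [hδ, Real.sq_sqrt (by positivity)]; field_simp
  have hcH : Continuous (fun y => H (aa u y) (bb u y)) :=
    (hH.continuous hk).comp (hu.aa.continuous.prodMk hu.bb.continuous)
  have hch := hp.hh.continuous
  obtain ⟨v, hv, hv0, hvb⟩ := poisson (φ := fun y => H (aa u y) (bb u y) - hh p y) (hcH.sub hch) hδ0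
  have hw := hp.add hv
  have hws : ∀ x ∈ sphere (0:E2) 1, (fun y => p y + v y) x = p x := fun x hx => by simp [hv0 x hx]
  refine ⟨fun y => p y + v y, hw, hws, ?_⟩
  set w := fun y => p y + v y with hwdef
  set f : E2 → ℝ := fun y => hh w y - H (aa u y) (bb u y) with hf
  have hcw := hw.hh.continuous
  have hcf : Continuous f := hcw.sub hcH
  have hfb : ∀ x ∈ closedBall (0:E2) 1, |f x| ≤ δ := by
    intro x hx
    have := hvb x hx
    rw [hf]; simp only [hwdef]; rw [hh_add hp hv]
    convert this using 2; ring
  have hI := int_sq_le hcf hfb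
  have hd := hw.sub hu
  have htal := talenti hd (fun x hx => by rw [hws x hx, hup x hx]; ring)
  have cru := cont_res hH hk hu
  have crw := cont_res hH hk hw
  have cq := hd.QQ.continuous
  have chd := hd.hh.continuous
  have h1 : ∫ y in ball (0:E2) 1, hh (fun y => w y - u y) y ^ 2
      ≤ (1 + s) * (∫ y in ball (0:E2) 1, res H u y ^ 2) + (1 + 1 / s) * ∫ y in ball (0:E2) 1, f y ^ 2 := by
    rw [← integral_const_mul, ← integral_const_mul,
      ← integral_add (int_ball (by fun_prop) _ _) (int_ball (by fun_prop) _ _)]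
    refine setIntegral_mono (int_ball (by fun_prop) _ _) (int_ball (by fun_prop) _ _) fun y => ?_
    have := young hs (- res H u y) (f y)
    rw [hh_sub hw hu]
    have e : hh w y - hh u y = - res H u y + f y := by simp only [hf, res]; ring
    rw [e]; simpa using this
  have h2 : ∫ y in ball (0:E2) 1, res H w y ^ 2
      ≤ (1 + s) * k * (∫ y in ball (0:E2) 1, QQ (fun y => w y - u y) y)
        + (1 + 1 / s) * ∫ y in ball (0:E2) 1, f y ^ 2 := by
    rw [← integral_const_mul, ← integral_const_mul,
      ← integral_add (int_ball (by fun_prop) _ _) (int_ball (by fun_prop) _ _)]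
    refine setIntegral_mono (int_ball (by fun_prop) _ _) (int_ball (by fun_prop) _ _) fun y => ?_
    have := young hs (H (aa u y) (bb u y) - H (aa w y) (bb w y)) (f y)
    have e : res H w y = (H (aa u y) (bb u y) - H (aa w y) (bb w y)) + f y := by simp only [hf, res]; ring
    have hl := hH.2 (aa u y) (bb u y) (aa w y) (bb w y)
    have e2 : QQ (fun y => w y - u y) y = (aa u y - aa w y) ^ 2 + (bb u y - bb w y) ^ 2 := by
      simp only [QQ, aa_sub hw hu, bb_sub hw hu]; ring
    simp only [e, e2]
    have := mul_le_mul_of_nonneg_left hl (by positivity : 0 ≤ 1 + s)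
    linarith
  have h3 := mul_le_mul_of_nonneg_left (htal.trans h1) (by positivity : 0 ≤ (1 + s) * k)
  have h4 := mul_le_mul_of_nonneg_left hI hB0.le
  rw [hδ2] at h4
  calc _ ≤ _ := h2
    _ ≤ (1 + s) ^ 2 * k * (∫ y in ball (0:E2) 1, res H u y ^ 2) + B * ∫ y in ball (0:E2) 1, f y ^ 2 := by
      rw [hB]; linarith
    _ ≤ _ := by linarith

theorem approx_exist {k : ℝ} (hk0 : 0 ≤ k) (hk : k < 1) {H : ℝ → ℝ → ℝ} (hH : LipH k H)
    {p : E2 → ℝ} (hp : Sm p) {ε : ℝ} (hε : 0 < ε) :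
    ∃ w, Sm w ∧ (∀ x ∈ sphere (0:E2) 1, w x = p x) ∧ ∫ y in ball (0:E2) 1, res H w y ^ 2 ≤ ε := by
  set s := (1 - k) / 4 with hs
  have hs0 : 0 < s := by rw [hs]; linarith
  set θ := (1 + s) ^ 2 * k with hθ
  have hθ0 : 0 ≤ θ := by positivity
  have hθ1 : θ < 1 := by rw [hθ, hs]; nlinarith [mul_nonneg hk0 (by linarith : 0 ≤ 1 - k), mul_nonneg (mul_nonneg hk0 hk0) (by linarith : 0 ≤ 1 - k)]
  set R0 := ∫ y in ball (0:E2) 1, res H p y ^ 2 with hR0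
  have key : ∀ n : ℕ, ∀ ε > 0, ∃ w, Sm w ∧ (∀ x ∈ sphere (0:E2) 1, w x = p x) ∧
      ∫ y in ball (0:E2) 1, res H w y ^ 2 ≤ θ ^ n * R0 + ε := by
    intro n
    induction n with
    | zero => intro ε hε; exact ⟨p, hp, fun _ _ => rfl, by simp [← hR0, hε.le]⟩
    | succ n ih =>
      intro ε hε
      obtain ⟨u, a, b, c⟩ := ih (ε/2) (by positivity)
      obtain ⟨w, a', b', c'⟩ := contr_step hk0 hk hs0 hH hp a b (half_pos hε)
      refine ⟨w, a', b', c'.trans ?_⟩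
      rw [← hθ]
      have := mul_le_mul_of_nonneg_left c hθ0
      rw [pow_succ]
      nlinarith
  have ht : Tendsto (fun n : ℕ => θ ^ n * R0) atTop (𝓝 0) := by
    simpa using (tendsto_pow_atTop_nhds_zero_of_lt_one hθ0 hθ1).mul_const R0
  obtain ⟨n, hn⟩ := (ht.eventually (gt_mem_nhds (half_pos hε))).exists
  obtain ⟨w, a, b, c⟩ := key n (ε/2) (half_pos hε)
  exact ⟨w, a, b, c.trans (by linarith)⟩

/-- Stability of approximate solutions with the same boundary data. -/
theorem stab {k : ℝ} (hk0 : 0 ≤ k) (hk : k < 1) : ∃ C, 0 < C ∧ ∀ {H : ℝ → ℝ → ℝ}, LipH k H →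
    ∀ {u v : E2 → ℝ}, Sm u → Sm v → (∀ x ∈ sphere (0:E2) 1, u x = v x) → ∀ x ∈ closedBall (0:E2) 1,
    (u x - v x) ^ 2 ≤ C * ((∫ y in ball (0:E2) 1, res H u y ^ 2) + ∫ y in ball (0:E2) 1, res H v y ^ 2) := by
  have h1k : 0 < 1 - k := by linarith
  refine ⟨10 * π * (2 / (1 - k) * (6 / (1 - k))), by positivity, fun {H} hH {u v} hu hv huv x hx => ?_⟩
  have hd := hu.sub hv
  have h0 : ∀ x ∈ sphere (0:E2) 1, (fun y => u y - v y) x = 0 := fun x hx => by simp [huv x hx]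
  have hs := supbound hd h0 hx
  have ht := talenti hd h0
  have cru := cont_res hH hk hu
  have crv := cont_res hH hk hv
  have cq := hd.QQ.continuous
  have chd := hd.hh.continuous
  have h1 : ∫ y in ball (0:E2) 1, hh (fun y => u y - v y) y ^ 2
      ≤ (1 + k) / 2 * (∫ y in ball (0:E2) 1, QQ (fun y => u y - v y) y) +
        6 / (1 - k) * ((∫ y in ball (0:E2) 1, res H u y ^ 2) + ∫ y in ball (0:E2) 1, res H v y ^ 2) := by
    rw [← integral_add (int_ball (by fun_prop) _ _) (int_ball (by fun_prop) _ _), ← integral_const_mul,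
      ← integral_const_mul, ← integral_add (int_ball (by fun_prop) _ _) (int_ball (by fun_prop) _ _)]
    refine setIntegral_mono (int_ball (by fun_prop) _ _) (int_ball (by fun_prop) _ _) fun y => ?_
    exact diff_ineq hH hk0 hk hu hv y
  set I := ∫ y in ball (0:E2) 1, hh (fun y => u y - v y) y ^ 2
  set S := (∫ y in ball (0:E2) 1, res H u y ^ 2) + ∫ y in ball (0:E2) 1, res H v y ^ 2
  have h2 : I ≤ 2 / (1 - k) * (6 / (1 - k)) * S := by
    have : (1 - k) / 2 * I ≤ 6 / (1 - k) * S := by nlinarith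
    calc I = 2 / (1 - k) * ((1 - k) / 2 * I) := by field_simp
      _ ≤ 2 / (1 - k) * (6 / (1 - k) * S) := by gcongr
      _ = _ := by ring
  calc (u x - v x) ^ 2 ≤ 10 * π * I := hs
    _ ≤ 10 * π * (2 / (1 - k) * (6 / (1 - k)) * S) := by gcongr
    _ = _ := by ring


/-! ### Algebraic structure of uniformly elliptic operators in two dimensions -/

def mk2 (h a b : ℝ) : Mat2 := !![h + a, b; b, h - a]

theorem mk2_herm (h a b : ℝ) : (mk2 h a b).IsHermitian := by
  ext i j; fin_cases i <;> fin_cases j <;> simp [mk2]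

theorem mk2_sub (h a b h' a' b' : ℝ) : mk2 h a b - mk2 h' a' b' = mk2 (h - h') (a - a') (b - b') := by
  ext i j; fin_cases i <;> fin_cases j <;> simp [mk2] <;> ring

theorem mk2_zero : mk2 0 0 0 = 0 := by
  ext i j; fin_cases i <;> fin_cases j <;> simp [mk2]

theorem mk2_eig (h a b : ℝ) (f : ℝ → ℝ) :
    ∑ i, f ((mk2_herm h a b).eigenvalues i) = f (h + √(a ^ 2 + b ^ 2)) + f (h - √(a ^ 2 + b ^ 2)) := by
  have ht := (mk2_herm h a b).trace_eq_sum_eigenvalues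
  have hd := (mk2_herm h a b).det_eq_prod_eigenvalues
  rw [Fin.sum_univ_two] at ht ⊢
  rw [Fin.prod_univ_two] at hd
  set e0 := (mk2_herm h a b).eigenvalues 0
  set e1 := (mk2_herm h a b).eigenvalues 1
  simp [mk2, Matrix.trace_fin_two, Matrix.det_fin_two] at ht hd
  have hρ : √(a ^ 2 + b ^ 2) ^ 2 = a ^ 2 + b ^ 2 := Real.sq_sqrt (by positivity)
  set ρ := √(a ^ 2 + b ^ 2)
  have he1 : e1 = 2 * h - e0 := by linarith
  have : (e0 - h - ρ) * (e0 - h + ρ) = 0 := by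
    rw [he1] at hd; nlinarith
  rcases mul_eq_zero.mp this with h1 | h1
  · have a0 : e0 = h + ρ := by linarith
    have a1 : e1 = h - ρ := by linarith
    rw [a0, a1]
  · have a0 : e0 = h - ρ := by linarith
    have a1 : e1 = h + ρ := by linarith
    rw [a0, a1, add_comm]

theorem posNorm_mk2 (h a b : ℝ) :
    posNorm (mk2 h a b) = max (h + √(a ^ 2 + b ^ 2)) 0 + max (h - √(a ^ 2 + b ^ 2)) 0 := by
  rw [posNorm, dif_pos (mk2_herm h a b)]
  exact mk2_eig h a b (fun t => max t 0)
theorem negNorm_mk2 (h a b : ℝ) :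
    negNorm (mk2 h a b) = max (-(h + √(a ^ 2 + b ^ 2))) 0 + max (-(h - √(a ^ 2 + b ^ 2))) 0 := by
  rw [negNorm, dif_pos (mk2_herm h a b)]
  exact mk2_eig h a b (fun t => max (-t) 0)

/-- strict monotonicity in the trace direction -/
theorem ell_mono {lam Lam : ℝ} {F : Mat2 → ℝ} (hF : UniformlyElliptic lam Lam F) (h a b : ℝ) {t : ℝ} (ht : 0 ≤ t) :
    F (mk2 h a b) + 2 * lam * t ≤ F (mk2 (h + t) a b) := by
  have := hF (mk2 h a b) (mk2 (h + t) a b) (mk2_herm _ _ _) (mk2_herm _ _ _)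
  rw [mk2_sub, posNorm_mk2, negNorm_mk2] at this
  simp [ht] at this
  linarith

theorem lip_case {lam Lam h ρ : ℝ} (hlam : 0 < lam) (hLam : lam ≤ Lam) (hρ : 0 ≤ ρ)
    (h1 : 0 ≤ Lam * (max (h + ρ) 0 + max (h - ρ) 0) - lam * (max (-(h + ρ)) 0 + max (-(h - ρ)) 0))
    (h2 : 0 ≤ Lam * (max (-h + ρ) 0 + max (-h - ρ) 0) - lam * (max (-(-h + ρ)) 0 + max (-(-h - ρ)) 0)) :
    |h| ≤ (Lam - lam) / (Lam + lam) * ρ := by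
  have hs : 0 < Lam + lam := by linarith
  have k0 : 0 ≤ (Lam - lam) / (Lam + lam) * ρ := mul_nonneg (div_nonneg (by linarith) hs.le) hρ
  rcases lt_or_ge ρ h with c | c
  · rw [max_eq_right (by linarith : -h + ρ ≤ 0), max_eq_right (by linarith : -h - ρ ≤ 0),
      max_eq_left (by linarith : 0 ≤ -(-h + ρ)), max_eq_left (by linarith : 0 ≤ -(-h - ρ))] at h2
    nlinarith
  rcases lt_or_ge h (-ρ) with c' | c'
  · rw [max_eq_right (by linarith : h + ρ ≤ 0), max_eq_right (by linarith : h - ρ ≤ 0),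
      max_eq_left (by linarith : 0 ≤ -(h + ρ)), max_eq_left (by linarith : 0 ≤ -(h - ρ))] at h1
    nlinarith
  rw [max_eq_left (by linarith : 0 ≤ h + ρ), max_eq_right (by linarith : h - ρ ≤ 0),
      max_eq_right (by linarith : -(h + ρ) ≤ 0), max_eq_left (by linarith : 0 ≤ -(h - ρ))] at h1
  rw [max_eq_left (by linarith : 0 ≤ -h + ρ), max_eq_right (by linarith : -h - ρ ≤ 0),
      max_eq_right (by linarith : -(-h + ρ) ≤ 0), max_eq_left (by linarith : 0 ≤ -(-h - ρ))] at h2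
  rw [abs_le, div_mul_eq_mul_div, le_div_iff₀ hs, ← neg_div, div_le_iff₀ hs]
  constructor <;> nlinarith

theorem struct_H {lam Lam : ℝ} (hlam : 0 < lam) (hLam : lam ≤ Lam) {F : Mat2 → ℝ}
    (hc : Continuous (fun A : Fin 2 → Fin 2 → ℝ => F (Matrix.of A)))
    (hF : UniformlyElliptic lam Lam F) (h0 : F 0 = 0) :
    ∃ H, LipH (((Lam - lam) / (Lam + lam)) ^ 2) H ∧ ∀ h a b, F (mk2 h a b) = 0 ↔ h = H a b := by
  have hcm : ∀ a b, Continuous (fun h => F (mk2 h a b)) := by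
    intro a b
    have : Continuous (fun h : ℝ => (!![h + a, b; b, h - a] : Mat2)) := by
      refine continuous_matrix fun i j => ?_
      fin_cases i <;> fin_cases j <;> simp <;> fun_prop
    exact hc.comp this
  have inj : ∀ a b h h', F (mk2 h a b) = 0 → F (mk2 h' a b) = 0 → h = h' := by
    intro a b h h' e e'
    rcases le_total h h' with c | c
    · have := ell_mono hF h a b (sub_nonneg.mpr c)
      rw [add_sub_cancel, e, e'] at this
      nlinarith
    · have := ell_mono hF h' a b (sub_nonneg.mpr c)
      rw [add_sub_cancel, e, e'] at this
      nlinarith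
  have ex : ∀ a b, ∃ h, F (mk2 h a b) = 0 := by
    intro a b
    set t := |F (mk2 0 a b)| / (2 * lam) with ht
    have t0 : 0 ≤ t := by positivity
    have et : 2 * lam * t = |F (mk2 0 a b)| := by rw [ht]; field_simp
    have u1 := ell_mono hF 0 a b t0
    have u2 := ell_mono hF (-t) a b t0
    rw [neg_add_cancel] at u2
    rw [zero_add] at u1
    have := intermediate_value_Icc (a := -t) (b := t) (by linarith) (hcm a b).continuousOn
    have h00 : (0:ℝ) ∈ Icc (F (mk2 (-t) a b)) (F (mk2 t a b)) :=
      ⟨by linarith [le_abs_self (F (mk2 0 a b))], by linarith [neg_abs_le (F (mk2 0 a b))]⟩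
    obtain ⟨h, _, hh⟩ := this h00
    exact ⟨h, hh⟩
  choose H hH using ex
  have iff : ∀ h a b, F (mk2 h a b) = 0 ↔ h = H a b := 
    fun h a b => ⟨fun e => inj a b _ _ e (hH a b), fun e => e ▸ hH a b⟩
  refine ⟨H, ⟨((iff 0 0 0).mp (by rw [mk2_zero, h0])).symm, fun a b a' b' => ?_⟩, iff⟩
  have g1 := hF (mk2 (H a b) a b) (mk2 (H a' b') a' b') (mk2_herm _ _ _) (mk2_herm _ _ _)
  have g2 := hF (mk2 (H a' b') a' b') (mk2 (H a b) a b) (mk2_herm _ _ _) (mk2_herm _ _ _)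
  rw [hH, hH, sub_self, mk2_sub, posNorm_mk2, negNorm_mk2] at g1 g2
  have e : (a' - a) ^ 2 + (b' - b) ^ 2 = (a - a') ^ 2 + (b - b') ^ 2 := by ring
  rw [e, ← neg_sub (H a b)] at g2
  have := lip_case hlam hLam (Real.sqrt_nonneg _) g1 g2
  rw [← sq_abs]
  calc |H a b - H a' b'| ^ 2 ≤ ((Lam - lam) / (Lam + lam) * √((a - a') ^ 2 + (b - b') ^ 2)) ^ 2 := by gcongr
    _ = _ := by rw [mul_pow, Real.sq_sqrt (by positivity)]

theorem kk_bounds {lam Lam : ℝ} (hlam : 0 < lam) (hLam : lam ≤ Lam) :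
    0 ≤ ((Lam - lam) / (Lam + lam)) ^ 2 ∧ ((Lam - lam) / (Lam + lam)) ^ 2 < 1 := by
  have hs : 0 < Lam + lam := by linarith
  refine ⟨by positivity, ?_⟩
  rw [sq_lt_one_iff_abs_lt_one, abs_lt]
  constructor
  · rw [lt_div_iff₀ hs]; linarith
  · rw [div_lt_one hs]; linarith

theorem dd_dd_eq {u : E2 → ℝ} {x : E2} (hu : ContDiffAt ℝ 2 u x) (i j : Fin 2) :
    dd i (dd j u) x = fderiv ℝ (fderiv ℝ u) x (EuclideanSpace.single i 1) (EuclideanSpace.single j 1) := by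
  have hd : DifferentiableAt ℝ (fderiv ℝ u) x :=
    (hu.fderiv_right (m := 1) (by norm_num)).differentiableAt (by norm_num)
  unfold dd
  rw [fderiv_clm_apply hd (differentiableAt_const _)]
  simp

theorem dd_symm {u : E2 → ℝ} {x : E2} (hu : ContDiffAt ℝ 2 u x) (i j : Fin 2) :
    dd i (dd j u) x = dd j (dd i u) x := by
  rw [dd_dd_eq hu, dd_dd_eq hu]
  exact (hu.isSymmSndFDerivAt (by simp)) _ _

theorem hess_mk2 {u : E2 → ℝ} {x : E2} (hu : ContDiffAt ℝ 2 u x) :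
    hess u x = mk2 (hh u x) (aa u x) (bb u x) := by
  ext i j
  rw [hess_apply]
  fin_cases i <;> fin_cases j <;> simp [mk2, hh, aa, bb]
  · ring
  · exact dd_symm hu _ _
  · ring


/-! ### Comparison principle -/

theorem dd_congr {u v : E2 → ℝ} {x : E2} (h : u =ᶠ[𝓝 x] v) (i : Fin 2) : dd i u =ᶠ[𝓝 x] dd i v := by
  filter_upwards [h.fderiv (𝕜 := ℝ)] with y hy
  simp only [dd, hy]

theorem hess_congr {u v : E2 → ℝ} {x : E2} (h : u =ᶠ[𝓝 x] v) : hess u x = hess v x := by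
  ext i j
  rw [hess_apply, hess_apply]
  exact (dd_congr (dd_congr h j) i).eq_of_nhds

theorem dd_neg (u : E2 → ℝ) (i : Fin 2) : dd i (fun x => - u x) = fun x => - dd i u x := by
  funext x; simp only [dd]; rw [fderiv_fun_neg]; rfl

theorem hess_neg (u : E2 → ℝ) (x : E2) : hess (fun x => - u x) x = - hess u x := by
  ext i j
  rw [hess_apply, Matrix.neg_apply, hess_apply, dd_neg, dd_neg]

theorem dd_sub_at {u v : E2 → ℝ} {x : E2} (hu : DifferentiableAt ℝ u x) (hv : DifferentiableAt ℝ v x) (i : Fin 2) :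
    dd i (fun x => u x - v x) x = dd i u x - dd i v x := by
  simp only [dd]; rw [fderiv_fun_sub hu hv]; rfl

theorem C2_diff {u : E2 → ℝ} {x : E2} (hu : ContDiffAt ℝ 2 u x) : ∀ᶠ y in 𝓝 x, DifferentiableAt ℝ u y :=
  (hu.eventually (by simp)).mono fun _ hy => hy.differentiableAt (by norm_num)

theorem C2_dd {u : E2 → ℝ} {x : E2} (hu : ContDiffAt ℝ 2 u x) (i : Fin 2) : DifferentiableAt ℝ (dd i u) x := by
  have hd : DifferentiableAt ℝ (fderiv ℝ u) x :=
    (hu.fderiv_right (m := 1) (by norm_num)).differentiableAt (by norm_num)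
  exact hd.clm_apply (differentiableAt_const _)

theorem hess_sub {u v : E2 → ℝ} {x : E2} (hu : ContDiffAt ℝ 2 u x) (hv : ContDiffAt ℝ 2 v x) :
    hess (fun x => u x - v x) x = hess u x - hess v x := by
  ext i j
  rw [Matrix.sub_apply, hess_apply, hess_apply, hess_apply, ← dd_sub_at (C2_dd hu j) (C2_dd hv j)]
  refine (dd_congr ?_ i).eq_of_nhds
  filter_upwards [C2_diff hu, C2_diff hv] with y h1 h2
  exact dd_sub_at h1 h2 j

theorem quad_form {w : E2 → ℝ} {x : E2} (hw : ContDiffAt ℝ 2 w x) (hm : IsLocalMax w x) (p q : ℝ) :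
    p ^ 2 * (hh w x + aa w x) + 2 * p * q * bb w x + q ^ 2 * (hh w x - aa w x) ≤ 0 := by
  set e : E2 := p • EuclideanSpace.single 0 1 + q • EuclideanSpace.single 1 1 with he
  set g : ℝ → ℝ := fun t => w (x + t • e) with hg
  have hline : ∀ t : ℝ, HasDerivAt (fun t : ℝ => x + t • e) e t := by
    intro t
    simpa using ((hasDerivAt_id t).smul_const e).const_add x
  have hx0 : x + (0:ℝ) • e = x := by simp
  have htend : Tendsto (fun t : ℝ => x + t • e) (𝓝 0) (𝓝 x) := by
    have := (hline 0).continuousAt.tendsto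
    rwa [hx0] at this
  have hgd : deriv g =ᶠ[𝓝 0] fun t => fderiv ℝ w (x + t • e) e := by
    filter_upwards [htend.eventually (C2_diff hw)] with t ht
    exact (ht.hasFDerivAt.comp_hasDerivAt t (hline t)).deriv
  have hd : DifferentiableAt ℝ (fderiv ℝ w) x :=
    (hw.fderiv_right (m := 1) (by norm_num)).differentiableAt (by norm_num)
  have hg2 : deriv (deriv g) 0 = fderiv ℝ (fderiv ℝ w) x e e := by
    rw [hgd.deriv_eq]
    have h1 : HasFDerivAt (fderiv ℝ w) (fderiv ℝ (fderiv ℝ w) x) (x + (0:ℝ) • e) := by rw [hx0]; exact hd.hasFDerivAt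
    have h2 := h1.comp_hasDerivAt 0 (hline 0)
    have h3 := h2.clm_apply (hasDerivAt_const 0 e)
    simpa using h3.deriv
  have hval : fderiv ℝ (fderiv ℝ w) x e e
      = p ^ 2 * (hh w x + aa w x) + 2 * p * q * bb w x + q ^ 2 * (hh w x - aa w x) := by
    simp only [he, map_add, map_smul, add_apply, smul_apply, smul_eq_mul,
      ← dd_dd_eq hw]
    rw [dd_symm hw 1 0]
    simp only [hh, aa, bb]; ring
  rw [← hval, ← hg2]
  by_contra hcon
  push Not at hcon
  have hmg : IsLocalMax g 0 := by
    have : IsLocalMax w (x + (0:ℝ) • e) := by rwa [hx0]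
    have h5 := htend.eventually hm
    filter_upwards [h5] with t ht
    simpa [hg] using ht
  have hming := isLocalMin_of_deriv_deriv_pos hcon hmg.deriv_eq_zero
    ((hw.continuousAt.comp_of_eq (hline 0).continuousAt hx0))
  have hconst : g =ᶠ[𝓝 0] fun _ => g 0 := by
    filter_upwards [hmg, hming] with t h1 h2
    exact le_antisymm h1 h2
  have := hconst.deriv.deriv_eq
  rw [this] at hcon
  simp at hcon

theorem max_eig {h a b : ℝ}
    (hq : ∀ p q : ℝ, p ^ 2 * (h + a) + 2 * p * q * b + q ^ 2 * (h - a) ≤ 0) : h + √(a ^ 2 + b ^ 2) ≤ 0 := by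
  have hρ : √(a ^ 2 + b ^ 2) ^ 2 = a ^ 2 + b ^ 2 := Real.sq_sqrt (by positivity)
  have hρ0 := Real.sqrt_nonneg (a ^ 2 + b ^ 2)
  set ρ := √(a ^ 2 + b ^ 2)
  have hle : |a| ≤ ρ := Real.le_sqrt_of_sq_le (by rw [sq_abs]; nlinarith [sq_nonneg b])
  have hla := abs_le.mp hle
  rcases hla.1.eq_or_lt with c | c
  · have := hq 0 1
    nlinarith
  · have h1 := hq (ρ + a) b
    have h2 : (ρ + a) ^ 2 * (h + a) + 2 * (ρ + a) * b * b + b ^ 2 * (h - a) = (h + ρ) * ((ρ + a) ^ 2 + b ^ 2) := by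
      have : b ^ 2 = ρ ^ 2 - a ^ 2 := by linarith
      have e : 2 * (ρ + a) * b * b = 2 * (ρ + a) * b ^ 2 := by ring
      rw [e, this]; ring
    rw [h2] at h1
    have : 0 < (ρ + a) ^ 2 + b ^ 2 := by
      have : 0 < ρ + a := by linarith
      positivity
    exact nonpos_of_mul_nonpos_left h1 this

def Fn (F : Mat2 → ℝ) : Mat2 → ℝ := fun M => - F (- M)

theorem herm_mk2 {M : Mat2} (h : M.IsHermitian) : M = mk2 ((M 0 0 + M 1 1) / 2) ((M 0 0 - M 1 1) / 2) (M 0 1) := by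
  have := h.apply 0 1
  ext i j; fin_cases i <;> fin_cases j <;> simp [mk2]
  · ring
  · simpa using this
  · ring

theorem Fn_ell {lam Lam : ℝ} {F : Mat2 → ℝ} (hF : UniformlyElliptic lam Lam F) : UniformlyElliptic lam Lam (Fn F) := by
  intro M N hM hN
  have := hF (-N) (-M) hN.neg hM.neg
  simp only [Fn]
  have e : -N - -M = M - N := by abel
  rw [e] at this
  linarith

theorem visc_neg {F : Mat2 → ℝ} {u : E2 → ℝ} {Ω : Set E2} (h : IsViscositySol F u Ω) :
    IsViscositySol (Fn F) (fun x => - u x) Ω := by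
  intro φ hφ x₀ hx
  have := h (fun x => - φ x) hφ.neg x₀ hx
  rw [hess_neg] at this
  simp only [Fn]
  refine ⟨fun hm => ?_, fun hm => ?_⟩
  · have := this.2 (by have h3 := hm.neg; have e3 : (fun x => -(-u x - φ x)) = fun x => u x - -φ x := by {funext x; ring}; rwa [e3] at h3)
    linarith
  · have := this.1 (by have h3 := hm.neg; have e3 : (fun x => -(-u x - φ x)) = fun x => u x - -φ x := by {funext x; ring}; rwa [e3] at h3)
    linarith

theorem class_sub {lam Lam : ℝ} (hlam : 0 < lam) {F : Mat2 → ℝ} (hF : UniformlyElliptic lam Lam F)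
    {u φ : E2 → ℝ} {x : E2} (hu : ContDiffAt ℝ 2 u x) (hφ : ContDiffAt ℝ 2 φ x) (h0 : F (hess u x) = 0)
    (hm : IsLocalMax (fun x => u x - φ x) x) : 0 ≤ F (hess φ x) := by
  have hd := hu.sub hφ
  have hq := max_eig (quad_form hd hm)
  have hs := hess_mk2 hd
  have hs' : hess u x - hess φ x = _ := (hess_sub hu hφ).symm.trans hs
  have := hF (hess u x) (hess φ x) (by rw [hess_mk2 hu]; exact mk2_herm _ _ _) (by rw [hess_mk2 hφ]; exact mk2_herm _ _ _)
  rw [hs', posNorm_mk2, negNorm_mk2, h0, max_eq_right hq, max_eq_right (by linarith [Real.sqrt_nonneg (aa (fun x => u x - φ x) x ^ 2 + bb (fun x => u x - φ x) x ^ 2), show hh (fun x => u x - φ x) x + √(aa (fun x => u x - φ x) x ^ 2 + bb (fun x => u x - φ x) x ^ 2) ≤ 0 from hq])] at this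
  have hn : ∀ s t : ℝ, 0 ≤ lam * (max s 0 + max t 0) := fun s t => by positivity
  linarith [hn (-(hh (fun x => u x - φ x) x + √(aa (fun x => u x - φ x) x ^ 2 + bb (fun x => u x - φ x) x ^ 2))) (-(hh (fun x => u x - φ x) x - √(aa (fun x => u x - φ x) x ^ 2 + bb (fun x => u x - φ x) x ^ 2)))]

theorem class_visc {lam Lam : ℝ} (hlam : 0 < lam) {F : Mat2 → ℝ} (hF : UniformlyElliptic lam Lam F)
    {u : E2 → ℝ} {Ω : Set E2} (hu : ∀ x ∈ Ω, ContDiffAt ℝ 2 u x) (h0 : ∀ x ∈ Ω, F (hess u x) = 0) :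
    IsViscositySol F u Ω := by
  intro φ hφ x hx
  refine ⟨fun hm => class_sub hlam hF (hu x hx) hφ.contDiffAt (h0 x hx) hm, fun hm => ?_⟩
  have := class_sub hlam (Fn_ell hF) (u := fun x => - u x) (φ := fun x => - φ x) (hu x hx).neg hφ.contDiffAt.neg
    (by simp [Fn, hess_neg, h0 x hx]) (by have h3 := hm.neg; simp only [neg_sub, neg_sub_neg] at h3 ⊢; exact h3)
  simp only [Fn, hess_neg, neg_neg] at this
  linarith

theorem cutoff {f : E2 → ℝ} (hf : ∀ x ∈ ball (0:E2) 1, ContDiffAt ℝ 2 f x) {x₀ : E2} (hx : x₀ ∈ ball (0:E2) 1) :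
    ∃ φ : E2 → ℝ, ContDiff ℝ 2 φ ∧ φ =ᶠ[𝓝 x₀] f := by
  rw [mem_ball_zero_iff] at hx
  set r := (1 - ‖x₀‖) / 2 with hr
  have hr0 : 0 < r := by rw [hr]; linarith
  let χ : ContDiffBump x₀ := ⟨r / 2, r, by positivity, by linarith⟩
  refine ⟨fun x => χ x * f x, ?_, ?_⟩
  · rw [contDiff_iff_contDiffAt]
    intro x
    by_cases hxb : x ∈ ball (0:E2) 1
    · exact χ.contDiff.contDiffAt.mul (hf x hxb)
    · have hxn : x ∉ tsupport χ := by
        rw [χ.tsupport_eq]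
        intro hc
        apply hxb
        rw [mem_ball_zero_iff]
        rw [mem_closedBall_iff_norm] at hc
        have : ‖x‖ ≤ ‖x - x₀‖ + ‖x₀‖ := by simpa using norm_add_le (x - x₀) x₀
        have hc' : ‖x - x₀‖ ≤ r := hc
        linarith
      have hz : (fun x => χ x * f x) =ᶠ[𝓝 x] fun _ => 0 := by
        filter_upwards [notMem_tsupport_iff_eventuallyEq.mp hxn] with y hy
        rw [hy]; simp
      exact contDiffAt_const.congr_of_eventuallyEq hz
  · filter_upwards [χ.eventuallyEq_one] with y hy
    rw [hy]; simp

theorem comp_sub {lam Lam : ℝ} (hlam : 0 < lam) {F : Mat2 → ℝ} (hF : UniformlyElliptic lam Lam F)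
    {u v : E2 → ℝ} (hu : ∀ x ∈ ball (0:E2) 1, ContDiffAt ℝ 2 u x) (h0 : ∀ x ∈ ball (0:E2) 1, F (hess u x) = 0)
    (cu : ContinuousOn u (closedBall (0:E2) 1)) (cv : ContinuousOn v (closedBall (0:E2) 1))
    (hv : IsViscositySol F v (ball (0:E2) 1)) {m : ℝ} (hm : ∀ x ∈ sphere (0:E2) 1, v x - u x ≤ m) :
    ∀ x ∈ closedBall (0:E2) 1, v x - u x ≤ m := by
  intro x₁ hx₁
  by_contra hcon
  push Not at hcon
  set ε := (v x₁ - u x₁ - m) / 2 with hε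
  have hε0 : 0 < ε := by rw [hε]; linarith
  have cr : Continuous r2 := Sm_r2.continuous
  have r2n : ∀ x, r2 x = ‖x‖ ^ 2 := fun x => by rw [norm_sq_E2]; simp only [r2]; ring
  obtain ⟨x₀, hx₀, hmax⟩ := (isCompact_closedBall (0:E2) 1).exists_isMaxOn ⟨x₁, hx₁⟩
    (f := fun x => v x - (u x - ε * r2 x))
    (cv.sub (cu.sub (cr.const_mul ε).continuousOn))
  have hmax1 : v x₁ - (u x₁ - ε * r2 x₁) ≤ v x₀ - (u x₀ - ε * r2 x₀) := hmax hx₁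
  have hr1 : 0 ≤ r2 x₁ := by rw [r2n]; positivity
  have hxb : x₀ ∈ ball (0:E2) 1 := by
    rw [mem_ball_zero_iff]
    rw [mem_closedBall_zero_iff] at hx₀
    refine lt_of_le_of_ne hx₀ fun heq => ?_
    have h1 := hm x₀ (by rw [mem_sphere_zero_iff_norm]; exact heq)
    have h2 : r2 x₀ = 1 := by rw [r2n, heq]; norm_num
    rw [h2] at hmax1
    nlinarith [mul_nonneg hε0.le hr1]
  have hC : ∀ x ∈ ball (0:E2) 1, ContDiffAt ℝ 2 (fun x => u x - ε * r2 x) x := fun x hx =>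
    (hu x hx).sub ((((Sm.const ε).mul Sm_r2).contDiff 2).contDiffAt)
  obtain ⟨φ, hφ, hφe⟩ := cutoff hC hxb
  have hloc : IsLocalMax (fun x => v x - φ x) x₀ := by
    filter_upwards [hφe, isOpen_ball.mem_nhds hxb] with y hy hyb
    rw [hy, hφe.eq_of_nhds]
    exact hmax (ball_subset_closedBall hyb)
  have hge := (hv φ hφ x₀ hxb).1 hloc
  rw [hess_congr hφe, hess_sub (hu x₀ hxb) ((((Sm.const ε).mul Sm_r2).contDiff 2).contDiffAt)] at hge
  have hr : hess (fun x => ε * r2 x) x₀ = mk2 (2 * ε) 0 0 := by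
    have hd : ∀ j, dd j (fun x => ε * r2 x) = fun x => (2 * ε) * x j := by
      intro j
      rw [dd_mul (f := fun _ => ε) (Sm.const ε) Sm_r2, dd_const, dd_r2]; funext y; ring
    ext i j
    rw [hess_apply, hd, dd_mul (f := fun _ => 2 * ε) (Sm.const _) (Sm.coord j), dd_const, dd_coord]
    fin_cases i <;> fin_cases j <;> simp [mk2]
  rw [hr, hess_mk2 (hu x₀ hxb), mk2_sub, sub_zero, sub_zero] at hge
  have hmono := ell_mono hF (hh u x₀ - 2 * ε) (aa u x₀) (bb u x₀) (t := 2 * ε) (by positivity)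
  rw [sub_add_cancel, ← hess_mk2 (hu x₀ hxb), h0 x₀ hxb] at hmono
  nlinarith [mul_pos hlam hε0]

theorem comp_abs {lam Lam : ℝ} (hlam : 0 < lam) {F : Mat2 → ℝ} (hF : UniformlyElliptic lam Lam F)
    {u v : E2 → ℝ} (hu : ∀ x ∈ ball (0:E2) 1, ContDiffAt ℝ 2 u x) (h0 : ∀ x ∈ ball (0:E2) 1, F (hess u x) = 0)
    (cu : ContinuousOn u (closedBall (0:E2) 1)) (cv : ContinuousOn v (closedBall (0:E2) 1))
    (hv : IsViscositySol F v (ball (0:E2) 1)) {m : ℝ} (hm : ∀ x ∈ sphere (0:E2) 1, |v x - u x| ≤ m) :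
    ∀ x ∈ closedBall (0:E2) 1, |v x - u x| ≤ m := by
  intro x hx
  rw [abs_le]
  constructor
  · have := comp_sub hlam (Fn_ell hF) (u := fun x => - u x) (v := fun x => - v x) (fun x hx => (hu x hx).neg)
      (fun x hx => by simp [Fn, hess_neg, h0 x hx]) cu.neg cv.neg (visc_neg hv) (m := m)
      (fun x hx => by linarith [(abs_le.mp (hm x hx)).1]) x hx
    linarith
  · exact comp_sub hlam hF hu h0 cu cv hv (fun x hx => (abs_le.mp (hm x hx)).2) x hx


/-! ### Existence -/

def AppSol (H : ℝ → ℝ → ℝ) (u : E2 → ℝ) : Prop := ∀ ε > 0, ∃ w, Sm w ∧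
  (∀ x ∈ closedBall (0:E2) 1, |w x - u x| ≤ ε) ∧ ∫ y in ball (0:E2) 1, res H w y ^ 2 ≤ ε

theorem tend_inv : Tendsto (fun n : ℕ => 1 / ((n:ℝ) + 1)) atTop (𝓝 0) := tendsto_one_div_add_atTop_nhds_zero_nat

theorem AppSol.appr {H : ℝ → ℝ → ℝ} {u : E2 → ℝ} (h : AppSol H u) {M : ℝ}
    (hM : ∀ x ∈ closedBall (0:E2) 1, |u x| ≤ M) : ∃ un e, Appr H u M un e := by
  choose! w h1 h2 h3 using h
  have hp : ∀ n : ℕ, (0:ℝ) < 1 / ((n:ℝ) + 1) := fun n => by positivity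
  exact ⟨fun n => w (1 / ((n:ℝ) + 1)), fun n => 1 / ((n:ℝ) + 1), fun n => h1 _ (hp n), fun n => (hp n).le, tend_inv,
    fun n => h2 _ (hp n), fun n => h3 _ (hp n), hM⟩

theorem AppSol.bdd {H : ℝ → ℝ → ℝ} {u : E2 → ℝ} (h : AppSol H u) : ∃ M, ∀ x ∈ closedBall (0:E2) 1, |u x| ≤ M := by
  obtain ⟨w, h1, h2, _⟩ := h 1 one_pos
  obtain ⟨B, hB⟩ := (isCompact_closedBall (0:E2) 1).exists_bound_of_continuousOn h1.continuous.continuousOn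
  refine ⟨B + 1, fun x hx => ?_⟩
  have a1 := hB x hx
  have a2 := h2 x hx
  rw [Real.norm_eq_abs] at a1
  have := abs_sub_abs_le_abs_sub (u x) (w x)
  rw [abs_sub_comm] at this
  linarith

theorem AppSol.cont {H : ℝ → ℝ → ℝ} {u : E2 → ℝ} (h : AppSol H u) : ContinuousOn u (closedBall (0:E2) 1) := by
  obtain ⟨M, hM⟩ := h.bdd
  obtain ⟨un, e, ha⟩ := h.appr hM
  exact ha.cont

theorem AppSol.sol {k : ℝ} (hk0 : 0 ≤ k) (hk : k < 1) {H : ℝ → ℝ → ℝ} (hH : LipH k H) {u : E2 → ℝ} (h : AppSol H u) :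
    ∀ x ∈ ball (0:E2) 1, ContDiffAt ℝ 2 u x ∧ hh u x = H (aa u x) (bb u x) := by
  obtain ⟨M, hM⟩ := h.bdd
  obtain ⟨un, e, ha⟩ := h.appr hM
  intro x hx
  rw [mem_ball_zero_iff] at hx
  have hn := norm_nonneg x
  obtain ⟨C, _, hC⟩ := reg (r := (1 + ‖x‖) / 2) (R := (3 + ‖x‖) / 4) (by positivity) (by linarith) (by linarith) hk0 hk
  have := (hC H u M un e hH ha).1 x (by rw [mem_ball_zero_iff]; linarith)
  exact ⟨this.1, this.2.2.2⟩

theorem AppSol.solF {k : ℝ} (hk0 : 0 ≤ k) (hk : k < 1) {H : ℝ → ℝ → ℝ} (hH : LipH k H) {F : Mat2 → ℝ}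
    (hFH : ∀ h a b, F (mk2 h a b) = 0 ↔ h = H a b) {u : E2 → ℝ} (h : AppSol H u) :
    ∀ x ∈ ball (0:E2) 1, F (hess u x) = 0 := by
  intro x hx
  obtain ⟨h1, h2⟩ := h.sol hk0 hk hH x hx
  rw [hess_mk2 h1, hFH, h2]

theorem ulim {G : ℕ → E2 → ℝ} {s : Set E2}
    (h : ∀ m n, ∀ x ∈ s, |G m x - G n x| ≤ 1 / ((m:ℝ) + 1) + 1 / ((n:ℝ) + 1)) :
    ∃ f : E2 → ℝ, ∀ ε > 0, ∃ N, ∀ n ≥ N, ∀ x ∈ s, |G n x - f x| ≤ ε := by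
  have hc : ∀ ε > 0, ∃ N, ∀ m ≥ N, ∀ n ≥ N, ∀ x ∈ s, |G m x - G n x| ≤ ε := by
    intro ε hε
    obtain ⟨N, hN⟩ := eventually_atTop.mp (tend_inv.eventually (gt_mem_nhds (half_pos hε)))
    refine ⟨N, fun m hm n hn x hx => (h m n x hx).trans ?_⟩
    have := hN m hm
    have := hN n hn
    linarith
  obtain ⟨f, hf⟩ := ucs_lim hc
  refine ⟨f, fun ε hε => ?_⟩
  obtain ⟨N, hN⟩ := eventually_atTop.mp (Metric.tendstoUniformlyOn_iff.mp hf ε hε)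
  refine ⟨N, fun n hn x hx => ?_⟩
  have := hN n hn x hx
  rw [Real.dist_eq, abs_sub_comm] at this
  exact this.le

theorem eq_of_small {a b : ℝ} (h : ∀ ε > 0, |a - b| ≤ ε) : a = b := by
  have : |a - b| ≤ 0 := le_of_forall_pos_le_add fun ε hε => by simpa using h ε hε
  exact sub_eq_zero.mp (abs_nonpos_iff.mp this)

theorem smooth_data {k : ℝ} (hk0 : 0 ≤ k) (hk : k < 1) {H : ℝ → ℝ → ℝ} (hH : LipH k H) {p : E2 → ℝ} (hp : Sm p) :
    ∃ u, AppSol H u ∧ ∀ x ∈ sphere (0:E2) 1, u x = p x := by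
  obtain ⟨C, hC0, hC⟩ := stab hk0 hk
  have hpos : ∀ n : ℕ, 0 < (1 / ((n:ℝ) + 1)) ^ 2 / (C + 1) := fun n => by positivity
  choose w h1 h2 h3 using fun n : ℕ => approx_exist hk0 hk hH hp (hpos n)
  have hcau : ∀ m n, ∀ x ∈ closedBall (0:E2) 1, |w m x - w n x| ≤ 1 / ((m:ℝ) + 1) + 1 / ((n:ℝ) + 1) := by
    intro m n x hx
    have := hC hH (h1 m) (h1 n) (fun x hx => by rw [h2 m x hx, h2 n x hx]) x hx
    have a1 : (0:ℝ) < 1 / ((m:ℝ) + 1) := by positivity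
    have a2 : (0:ℝ) < 1 / ((n:ℝ) + 1) := by positivity
    have a3 := h3 m
    have a4 := h3 n
    have key : ∀ t : ℝ, 0 ≤ t → C * (t / (C + 1)) ≤ t := by
      intro t ht
      rw [mul_div_assoc', div_le_iff₀ (by positivity)]; nlinarith
    have b1 := key _ (sq_nonneg (1 / ((m:ℝ) + 1)))
    have b2 := key _ (sq_nonneg (1 / ((n:ℝ) + 1)))
    have b3 := mul_le_mul_of_nonneg_left a3 hC0.le
    have b4 := mul_le_mul_of_nonneg_left a4 hC0.le
    refine abs_le_of_sq_le_sq (this.trans ?_) (by positivity)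
    rw [mul_add]
    nlinarith [mul_pos a1 a2]
  obtain ⟨u, hu⟩ := ulim hcau
  refine ⟨u, fun ε hε => ?_, fun x hx => ?_⟩
  · obtain ⟨N, hN⟩ := hu ε hε
    have ht : Tendsto (fun n : ℕ => (1 / ((n:ℝ) + 1)) ^ 2 / (C + 1)) atTop (𝓝 0) := by
      simpa using (tend_inv.pow 2).div_const (C + 1)
    obtain ⟨N', hN'⟩ := eventually_atTop.mp (ht.eventually (gt_mem_nhds hε))
    exact ⟨w (max N N'), h1 _, hN _ (le_max_left _ _), (h3 _).trans (hN' _ (le_max_right _ _)).le⟩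
  · refine (eq_of_small fun ε hε => ?_).symm
    obtain ⟨N, hN⟩ := hu ε hε
    have := hN N le_rfl x (sphere_subset_closedBall hx)
    rwa [h2 N x hx] at this

theorem cont_data {lam Lam k : ℝ} (hlam : 0 < lam) {F : Mat2 → ℝ} (hF : UniformlyElliptic lam Lam F)
    (hk0 : 0 ≤ k) (hk : k < 1) {H : ℝ → ℝ → ℝ} (hH : LipH k H)
    (hFH : ∀ h a b, F (mk2 h a b) = 0 ↔ h = H a b) {g : E2 → ℝ} (hg : ContinuousOn g (sphere (0:E2) 1)) :
    ∃ u, AppSol H u ∧ ∀ x ∈ sphere (0:E2) 1, u x = g x := by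
  have hpos : ∀ n : ℕ, (0:ℝ) < 1 / ((n:ℝ) + 1) := fun n => by positivity
  choose p hp hpg using fun n : ℕ => stone (isCompact_sphere (0:E2) 1) hg (hpos n)
  choose w hw hwp using fun n : ℕ => smooth_data hk0 hk hH (Pol_sm (hp n))
  have hcau : ∀ m n, ∀ x ∈ closedBall (0:E2) 1, |w m x - w n x| ≤ 1 / ((m:ℝ) + 1) + 1 / ((n:ℝ) + 1) := by
    intro m n
    refine comp_abs hlam hF (fun x hx => ((hw n).sol hk0 hk hH x hx).1) ((hw n).solF hk0 hk hH hFH)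
      (hw n).cont (hw m).cont
      (class_visc hlam hF (fun x hx => ((hw m).sol hk0 hk hH x hx).1) ((hw m).solF hk0 hk hH hFH)) ?_
    intro x hx
    rw [hwp m x hx, hwp n x hx]
    have a1 := abs_lt.mp (hpg m x hx)
    have a2 := abs_lt.mp (hpg n x hx)
    rw [abs_le]; constructor <;> linarith [a1.1, a1.2, a2.1, a2.2]
  obtain ⟨u, hu⟩ := ulim hcau
  refine ⟨u, fun ε hε => ?_, fun x hx => ?_⟩
  · obtain ⟨N, hN⟩ := hu (ε / 2) (half_pos hε)
    obtain ⟨v, v1, v2, v3⟩ := hw N (ε / 2) (half_pos hε)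
    refine ⟨v, v1, fun x hx => ?_, by linarith⟩
    have a1 := abs_le.mp (v2 x hx)
    have a2 := abs_le.mp (hN N le_rfl x hx)
    rw [abs_le]; constructor <;> linarith [a1.1, a1.2, a2.1, a2.2]
  · refine (eq_of_small fun ε hε => ?_).symm
    obtain ⟨N, hN⟩ := hu (ε / 2) (half_pos hε)
    obtain ⟨N', hN'⟩ := eventually_atTop.mp (tend_inv.eventually (gt_mem_nhds (half_pos hε)))
    have a2 := abs_le.mp (hN (max N N') (le_max_left _ _) x (sphere_subset_closedBall hx))
    have a1 := abs_lt.mp (hpg (max N N') x hx)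
    have a3 := hN' (max N N') (le_max_right _ _)
    rw [hwp _ x hx] at a2
    rw [abs_le]; constructor <;> linarith [a1.1, a1.2, a2.1, a2.2]

theorem le_supAbs {g : E2 → ℝ} {s : Set E2} (hs : IsCompact s) (hg : ContinuousOn g s) {x : E2} (hx : x ∈ s) :
    |g x| ≤ supAbs g s := by
  obtain ⟨B, hB⟩ := hs.exists_bound_of_continuousOn hg
  have hb : BddAbove (range fun x => ⨆ (_ : x ∈ s), |g x|) := by
    refine ⟨max B 0, ?_⟩
    rintro _ ⟨y, rfl⟩
    by_cases hy : y ∈ s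
    · simp only [hy, ciSup_pos]
      exact (hB y hy).trans (le_max_left _ _)
    · simp [hy]
  have := le_ciSup hb x
  simpa [supAbs, hx] using this

theorem hess_zero (x : E2) : hess (fun _ => (0:ℝ)) x = 0 := by
  ext i j
  rw [hess_apply, dd_const, dd_const]; rfl

theorem matNorm_le {A : Mat2} {c : ℝ} (h : ∀ i j, |A i j| ≤ c) : matNorm A ≤ 4 * c := by
  simp only [matNorm, Fin.sum_univ_two]
  linarith [h 0 0, h 0 1, h 1 0, h 1 1]

/-- Existence and uniqueness for continuous boundary data: for `F` continuous, uniformly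
elliptic with `F(0) = 0` and `g` continuous on `∂B₁`, there is a unique `u ∈ C(B̄₁)`,
of class `C^{2,ᾱ}` on every compact subset of `B₁` (with `ᾱ` the universal interior
exponent), solving `F(D²u) = 0` classically in `B₁` with `u = g` on `∂B₁`; moreover for
every `0 < r < 1`, `‖u‖_{C^{2,ᾱ}(B̄_r)} ≤ C(r) ‖g‖_{L^∞(∂B₁)}` with `C(r)` depending only
on `lam, Lam, r`. Uniqueness is among continuous viscosity solutions. -/
theorem exists_unique_solution_continuous_data (lam Lam : ℝ)
    (hlam : 0 < lam) (hLam : lam ≤ Lam) :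
    ∃ α : ℝ, α ∈ Set.Ioo (0 : ℝ) 1 ∧
    ∃ C : ℝ → ℝ, (∀ r, 0 < r → r < 1 → 0 < C r) ∧
      ∀ (F : Mat2 → ℝ) (g : E2 → ℝ),
        Continuous (fun A : Fin 2 → Fin 2 → ℝ => F (Matrix.of A)) →
        UniformlyElliptic lam Lam F → F 0 = 0 →
        ContinuousOn g (sphere (0 : E2) 1) →
        ∃ u : E2 → ℝ,
          ContinuousOn u (closedBall (0 : E2) 1) ∧
          (∀ x ∈ ball (0 : E2) 1, ContDiffAt ℝ 2 u x) ∧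
          (∀ x ∈ ball (0 : E2) 1, F (hess u x) = 0) ∧
          (∀ x ∈ sphere (0 : E2) 1, u x = g x) ∧
          (∀ r, 0 < r → r < 1 →
            (∀ x ∈ closedBall (0 : E2) r,
              |u x| ≤ C r * supAbs g (sphere 0 1) ∧
              ‖fderiv ℝ u x‖ ≤ C r * supAbs g (sphere 0 1) ∧
              matNorm (hess u x) ≤ C r * supAbs g (sphere 0 1)) ∧
            (∀ x ∈ closedBall (0 : E2) r, ∀ y ∈ closedBall (0 : E2) r,
              matNorm (hess u x - hess u y) ≤ C r * supAbs g (sphere 0 1) * ‖x - y‖ ^ α)) ∧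
          (∀ v : E2 → ℝ, ContinuousOn v (closedBall (0 : E2) 1) →
            IsViscositySol F v (ball (0 : E2) 1) →
            (∀ x ∈ sphere (0 : E2) 1, v x = g x) →
            EqOn v u (closedBall (0 : E2) 1)) := by
  obtain ⟨hk0, hk⟩ := kk_bounds hlam hLam
  set k := ((Lam - lam) / (Lam + lam)) ^ 2 with hkdef
  have hb := bet_pos hk
  have hb1 := bet_lt hk0
  refine ⟨bet k / 2, ⟨by positivity, by linarith⟩, ?_⟩
  have hreg : ∀ r : ℝ, ∃ C, 0 < r → r < 1 → 0 < C ∧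
    ∀ (H : ℝ → ℝ → ℝ) (u : E2 → ℝ) (M : ℝ) (un : ℕ → E2 → ℝ) (e : ℕ → ℝ), LipH k H → Appr H u M un e →
      (∀ x ∈ ball (0:E2) ((1 + r) / 2), ContDiffAt ℝ 2 u x ∧ ‖fderiv ℝ u x‖ ≤ C * M ∧
        (∀ i j, |hess u x i j| ≤ C * M) ∧ hh u x = H (aa u x) (bb u x)) ∧
      (∀ x ∈ ball (0:E2) ((1 + r) / 2), ∀ x' ∈ ball (0:E2) ((1 + r) / 2), ∀ i j,
        |hess u x i j - hess u x' i j| ≤ C * M * ‖x - x'‖ ^ (bet k / 2)) := by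
    intro r
    by_cases hr : 0 < r ∧ r < 1
    · obtain ⟨C, hC⟩ := reg (r := (1 + r) / 2) (R := (3 + r) / 4) (by linarith) (by linarith) (by linarith) hk0 hk
      exact ⟨C, fun _ _ => hC⟩
    · exact ⟨0, fun h1 h2 => absurd ⟨h1, h2⟩ hr⟩
  choose C0 hC0 using hreg
  refine ⟨fun r => 4 * C0 r + 1, fun r h1 h2 => by have := (hC0 r h1 h2).1; positivity, ?_⟩
  intro F g hFc hF hF0 hg
  obtain ⟨H, hH, hFH⟩ := struct_H hlam hLam hFc hF hF0
  obtain ⟨u, hu, hug⟩ := cont_data hlam hF hk0 hk hH hFH hg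
  have hC2 : ∀ x ∈ ball (0:E2) 1, ContDiffAt ℝ 2 u x := fun x hx => (hu.sol hk0 hk hH x hx).1
  have hsol := hu.solF hk0 hk hH hFH
  set M := supAbs g (sphere (0:E2) 1) with hM
  have hbd : ∀ x ∈ closedBall (0:E2) 1, |u x| ≤ M := by
    intro x hx
    have := comp_abs hlam hF (u := fun _ => 0) (v := u) (m := M) (fun x _ => contDiffAt_const)
      (fun x _ => by rw [hess_zero, hF0]) continuousOn_const hu.cont (class_visc hlam hF hC2 hsol)
      (fun x hx => by rw [hug x hx, sub_zero]; exact le_supAbs (isCompact_sphere _ _) hg hx) x hx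
    simpa using this
  obtain ⟨un, e, ha⟩ := hu.appr hbd
  have hM0 : 0 ≤ M := ha.M0
  refine ⟨u, hu.cont, hC2, hsol, hug, fun r hr hr1 => ?_, fun v cv hv hvg x hx => ?_⟩
  · obtain ⟨hCp, hCr⟩ := hC0 r hr hr1
    obtain ⟨hA, hB⟩ := hCr H u M un e hH ha
    have hin : ∀ x ∈ closedBall (0:E2) r, x ∈ ball (0:E2) ((1 + r) / 2) :=
      fun x hx => closedBall_subset_ball (by linarith) hx
    have hCM : 0 ≤ C0 r * M := by positivity
    refine ⟨fun x hx => ?_, fun x hx y hy => ?_⟩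
    · obtain ⟨_, h2, h3, _⟩ := hA x (hin x hx)
      refine ⟨?_, ?_, ?_⟩
      · have := hbd x (closedBall_subset_closedBall hr1.le hx)
        nlinarith
      · nlinarith
      · have := matNorm_le h3
        nlinarith
    · have := matNorm_le (A := hess u x - hess u y) (hB x (hin x hx) y (hin y hy))
      have hn : 0 ≤ M * ‖x - y‖ ^ (bet k / 2) := by positivity
      nlinarith
  · have := comp_abs hlam hF hC2 hsol hu.cont cv hv (m := 0) (fun x hx => by simp [hvg x hx, hug x hx]) x hx
    exact sub_eq_zero.mp (abs_nonpos_iff.mp this)
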